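/- arXiv:2406.15086 — 7 statements merged into one kernel-verified Lean document; each statement's English description precedes it below -/
import Mathlib

section
/- Let K₀ ⊂ ℝⁿ be compact. Suppose (a) for each fixed x ∈ K₀ the solutions of y' = g(x,y,τ) are uniformly ultimately bounded: there is c(x)>0 such that for every d>0 there is T(x,d)>0 with |y(τ+τ₀,g,x,τ₀,y₀)| ≤ c(x) whenever τ₀ ∈ ℝ, τ ≥ T(x,d) and |y₀| ≤ d; and (b) there exists r > 0 such that every bounded solution y : ℝ → ℝᵐ of y' = h(x,y,τ), defined on all of ℝ, with h ∈ H and x ∈ K₀, satisfies |y(τ)| ≤ r for all τ ∈ ℝ. Then the solutions of the parametric family y' = g(x,y,τ), x ∈ K₀, are uniformly ultimately bounded: there is c > 0 such that for every d > 0 there is T(d) > 0 with |y(τ+τ₀,g,x,τ₀,y₀)| ≤ c for every x ∈ K₀, τ₀ ∈ ℝ, τ ≥ T(d) and |y₀| ≤ d. -/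
open Filter Topology Metric Set

noncomputable section

/-- The time-translate h·s of a map, as a continuous map. -/
def timeTranslate {n m : ℕ} (s : ℝ)
    (h : C(EuclideanSpace ℝ (Fin n) × EuclideanSpace ℝ (Fin m) × ℝ,
      EuclideanSpace ℝ (Fin m))) :
    C(EuclideanSpace ℝ (Fin n) × EuclideanSpace ℝ (Fin m) × ℝ,
      EuclideanSpace ℝ (Fin m)) :=
  ⟨fun p => h (p.1, p.2.1, p.2.2 + s), h.continuous.comp (by fun_prop)⟩

/-- Admissibility: bounded and uniformly continuous on K × ℝ for every compact K. -/
def IsAdmissibleMap {n m : ℕ}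
    (g : C(EuclideanSpace ℝ (Fin n) × EuclideanSpace ℝ (Fin m) × ℝ,
      EuclideanSpace ℝ (Fin m))) : Prop :=
  ∀ K : Set (EuclideanSpace ℝ (Fin n) × EuclideanSpace ℝ (Fin m)), IsCompact K →
    (∃ C : ℝ, ∀ x y (τ : ℝ), (x, y) ∈ K → ‖g (x, y, τ)‖ ≤ C) ∧
    (∀ ε > (0:ℝ), ∃ δ > (0:ℝ), ∀ x y (τ : ℝ) x' y' (τ' : ℝ), (x, y) ∈ K → (x', y') ∈ K →
      dist ((x, y, τ) : EuclideanSpace ℝ (Fin n) × EuclideanSpace ℝ (Fin m) × ℝ)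
        (x', y', τ') < δ → dist (g (x, y, τ)) (g (x', y', τ')) < ε)

/-- Uniform Lipschitz continuity in y on compact sets. -/
def IsLipschitzInY {n m : ℕ}
    (g : C(EuclideanSpace ℝ (Fin n) × EuclideanSpace ℝ (Fin m) × ℝ,
      EuclideanSpace ℝ (Fin m))) : Prop :=
  ∀ K₀ : Set (EuclideanSpace ℝ (Fin n)), IsCompact K₀ →
    ∀ K : Set (EuclideanSpace ℝ (Fin m)), IsCompact K →
      ∃ L > (0:ℝ), ∀ x ∈ K₀, ∀ y₁ ∈ K, ∀ y₂ ∈ K, ∀ τ : ℝ,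
        ‖g (x, y₁, τ) - g (x, y₂, τ)‖ ≤ L * ‖y₁ - y₂‖

/-- The compact tubular neighbourhood K₀ of the slow limit x₀. -/
def slowTube {n : ℕ} (x0 : ℝ → EuclideanSpace ℝ (Fin n)) (t₀ r : ℝ) :
    Set (EuclideanSpace ℝ (Fin n)) :=
  {z | ∃ t ∈ Set.Icc (0:ℝ) t₀, ∃ v : EuclideanSpace ℝ (Fin n), ‖v‖ ≤ r ∧ z = x0 t + v}

/-- The fiber A_{(h,x)}: initial values of bounded entire solutions of y' = h(x,y,τ). -/
def attrFiber {n m : ℕ} {H : Type*}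
    (ev : H → C(EuclideanSpace ℝ (Fin n) × EuclideanSpace ℝ (Fin m) × ℝ,
      EuclideanSpace ℝ (Fin m)))
    (h : H) (x : EuclideanSpace ℝ (Fin n)) : Set (EuclideanSpace ℝ (Fin m)) :=
  {z | ∃ y : ℝ → EuclideanSpace ℝ (Fin m), y 0 = z ∧ (∃ C, ∀ τ : ℝ, ‖y τ‖ ≤ C) ∧
    ∀ τ : ℝ, HasDerivAt y (ev h (x, y τ, τ)) τ}

/-- The parametrically inflated fiber A_{(h,x)}[δ] over the base H × K₀. -/
def inflFiber {n m : ℕ} {H : Type*} [MetricSpace H]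
    (ev : H → C(EuclideanSpace ℝ (Fin n) × EuclideanSpace ℝ (Fin m) × ℝ,
      EuclideanSpace ℝ (Fin m)))
    (K₀ : Set (EuclideanSpace ℝ (Fin n)))
    (h : H) (x : EuclideanSpace ℝ (Fin n)) (δ : ℝ) : Set (EuclideanSpace ℝ (Fin m)) :=
  ⋃ p ∈ {p : H × EuclideanSpace ℝ (Fin n) |
    p.2 ∈ K₀ ∧ max (dist h p.1) (dist x p.2) ≤ δ}, attrFiber ev p.1 p.2

/-- The inflated fiber Aˣ_h[δ] (inflation only in the hull variable). -/
def inflFiberH {n m : ℕ} {H : Type*} [MetricSpace H]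
    (ev : H → C(EuclideanSpace ℝ (Fin n) × EuclideanSpace ℝ (Fin m) × ℝ,
      EuclideanSpace ℝ (Fin m)))
    (h : H) (x : EuclideanSpace ℝ (Fin n)) (δ : ℝ) : Set (EuclideanSpace ℝ (Fin m)) :=
  ⋃ h' ∈ {h' : H | dist h' h ≤ δ}, attrFiber ev h' x

/-- The omega-limit set O(g₀) of g₀ for the flow σf. -/
def omegaSet {H : Type*} [TopologicalSpace H] (σf : ℝ → H → H) (g0 : H) : Set H :=
  ⋂ s ∈ Set.Ici (0:ℝ), closure {h : H | ∃ τ ≥ s, h = σf τ g0}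

/-- The parametrically inflated fiber over the base O(g) × K₀. -/
def inflFiberO {n m : ℕ} {H : Type*} [MetricSpace H]
    (ev : H → C(EuclideanSpace ℝ (Fin n) × EuclideanSpace ℝ (Fin m) × ℝ,
      EuclideanSpace ℝ (Fin m)))
    (σf : ℝ → H → H) (g0 : H)
    (K₀ : Set (EuclideanSpace ℝ (Fin n)))
    (h : H) (x : EuclideanSpace ℝ (Fin n)) (δ : ℝ) : Set (EuclideanSpace ℝ (Fin m)) :=
  ⋃ p ∈ {p : H × EuclideanSpace ℝ (Fin n) |
    p.1 ∈ omegaSet σf g0 ∧ p.2 ∈ K₀ ∧ max (dist h p.1) (dist x p.2) ≤ δ},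
      attrFiber ev p.1 p.2

end

section ContinuousDependence

variable {Y : Type*} [NormedAddCommGroup Y] [NormedSpace ℝ Y]

/-- An approximate solution starting close to an exact solution `φ` stays `ε`-close to it,
even though the Lipschitz bound is only available on a ball containing the `ε`-tube around `φ`. -/
theorem dist_lt_of_gronwallBound_lt {v w : ℝ → Y → Y} {φ ψ : ℝ → Y} {T ε ρ δ η : ℝ} {L : NNReal}
    (hφ : ∀ t ∈ Icc 0 T, HasDerivAt φ (v t (φ t)) t)
    (hψ : ∀ t ∈ Icc 0 T, HasDerivAt ψ (w t (ψ t)) t)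
    (hv : ∀ t ∈ Icc 0 T, LipschitzOnWith L (v t) (closedBall 0 ρ))
    (hvw : ∀ t ∈ Icc 0 T, ∀ y ∈ closedBall (0 : Y) ρ, dist (w t y) (v t y) ≤ η)
    (h0 : dist (φ 0) (ψ 0) ≤ δ) (hδ : 0 ≤ δ) (hη : 0 ≤ η)
    (hρ : ∀ t ∈ Icc 0 T, ‖φ t‖ + ε ≤ ρ) (hε : gronwallBound δ L η T < ε) :
    ∀ t ∈ Icc 0 T, dist (φ t) (ψ t) < ε := by
  by_contra! hcon
  obtain ⟨t, ht, htε⟩ := hcon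
  have hφc : ContinuousOn φ (Icc 0 T) := fun s hs => (hφ s hs).continuousAt.continuousWithinAt
  have hψc : ContinuousOn ψ (Icc 0 T) := fun s hs => (hψ s hs).continuousAt.continuousWithinAt
  have hcomp : IsCompact (Icc 0 T ∩ {s | ε ≤ dist (φ s) (ψ s)}) :=
    isCompact_Icc.of_isClosed_subset
      ((continuous_dist.comp_continuousOn (hφc.prodMk hψc)).preimage_isClosed_of_isClosed
        isClosed_Icc isClosed_Ici)
      inter_subset_left
  obtain ⟨b, ⟨hbT, hbε⟩, hmin⟩ := hcomp.exists_isLeast ⟨t, ht, htε⟩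
  have hsub : Icc 0 b ⊆ Icc 0 T := Icc_subset_Icc_right hbT.2
  have hlt : ∀ s ∈ Ico 0 b, dist (φ s) (ψ s) < ε := by
    intro s hs
    by_contra! h
    exact (hmin ⟨⟨hs.1, hs.2.le.trans hbT.2⟩, h⟩).not_gt hs.2
  have hεpos : 0 ≤ ε :=
    (hδ.trans ((gronwallBound_x0 δ L η).symm.le.trans
      (gronwallBound_mono hδ hη L.coe_nonneg (hbT.1.trans hbT.2)))).trans hε.le
  have hψρ : ∀ s ∈ Ico 0 b, ψ s ∈ closedBall (0 : Y) ρ := by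
    intro s hs
    rw [mem_closedBall_zero_iff]
    have h1 := hρ s (hsub (Ico_subset_Icc_self hs))
    have h2 := hlt s hs
    rw [dist_comm, dist_eq_norm] at h2
    linarith [norm_le_norm_add_norm_sub' (ψ s) (φ s)]
  have key := dist_le_of_approx_trajectories_ODE_of_mem (v := v) (K := L)
    (s := fun _ => closedBall (0 : Y) ρ) (a := 0) (b := b) (f := φ) (g := ψ) (δ := δ)
    (εf := 0) (εg := η)
    (fun s hs => hv s (hsub (Ico_subset_Icc_self hs))) (hφc.mono hsub)
    (fun s hs => (hφ s (hsub (Ico_subset_Icc_self hs))).hasDerivWithinAt)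
    (fun s _ => (dist_self _).le)
    (fun s hs => by
      rw [mem_closedBall_zero_iff]
      linarith [hρ s (hsub (Ico_subset_Icc_self hs))])
    (hψc.mono hsub)
    (fun s hs => (hψ s (hsub (Ico_subset_Icc_self hs))).hasDerivWithinAt)
    (fun s hs => hvw s (hsub (Ico_subset_Icc_self hs)) _ (hψρ s hs)) hψρ h0
    b ⟨hbT.1, le_rfl⟩
  rw [zero_add, sub_zero] at key
  have hbε' : ε ≤ dist (φ b) (ψ b) := hbε
  linarith [gronwallBound_mono hδ hη L.coe_nonneg hbT.2]

/-- Forward uniqueness for an equation that is Lipschitz on balls. -/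
theorem eq_of_hasDerivAt_of_lipschitzOnWith_closedBall {v : ℝ → Y → Y} {φ ψ : ℝ → Y}
    (hφ : ∀ t ≥ 0, HasDerivAt φ (v t (φ t)) t) (hψ : ∀ t ≥ 0, HasDerivAt ψ (v t (ψ t)) t)
    (hv : ∀ ρ : ℝ, ∃ L : NNReal, ∀ t ≥ 0, LipschitzOnWith L (v t) (closedBall 0 ρ))
    (h0 : φ 0 = ψ 0) {T : ℝ} (hT : 0 ≤ T) : φ T = ψ T := by
  have hφc : ContinuousOn φ (Icc 0 T) := fun s hs => (hφ s hs.1).continuousAt.continuousWithinAt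
  obtain ⟨C, hC⟩ := isCompact_Icc.exists_bound_of_continuousOn hφc
  refine dist_le_zero.1 (le_of_forall_pos_lt_add fun ε hε => ?_)
  obtain ⟨L, hL⟩ := hv (C + ε)
  rw [zero_add]
  refine dist_lt_of_gronwallBound_lt (v := v) (w := v) (δ := 0) (η := 0) (L := L) (ρ := C + ε)
    (fun t ht => hφ t ht.1) (fun t ht => hψ t ht.1) (fun t ht => hL t ht.1)
    (fun t _ y _ => (dist_self _).le) (by simp [h0]) le_rfl le_rfl
    (fun t ht => by linarith [hC t ht]) ?_ T ⟨hT, le_rfl⟩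
  rwa [gronwallBound_ε0_δ0]

/-- Joint continuity of the global forward solutions of a parametric family of equations. -/
theorem continuous_solution_of_lipschitzOnWith_closedBall [ProperSpace Y]
    {P : Type*} [TopologicalSpace P] {F : P → ℝ → Y → Y}
    (hF : Continuous fun q : P × Y × ℝ => F q.1 q.2.2 q.2.1)
    (hLip : ∀ p, ∀ ρ : ℝ, ∃ L : NNReal, ∀ t ≥ 0, LipschitzOnWith L (F p t) (closedBall 0 ρ))
    {u : P → Y → ℝ → Y} (hu0 : ∀ p y, u p y 0 = y)
    (hu : ∀ p y, ∀ t ≥ 0, HasDerivAt (u p y) (F p t (u p y t)) t) :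
    Continuous fun q : (P × Y) × ℝ => u q.1.1 q.1.2 (max q.2 0) := by
  rw [continuous_iff_continuousAt]
  rintro ⟨⟨p, y⟩, t⟩
  rw [ContinuousAt, Metric.tendsto_nhds]
  intro ε hε
  set T : ℝ := max t 0 + 1 with hTdef
  have hT : 0 ≤ T := by positivity
  have huc : ContinuousOn (u p y) (Icc 0 T) := fun s hs =>
    (hu p y s hs.1).continuousAt.continuousWithinAt
  obtain ⟨C, hC⟩ := isCompact_Icc.exists_bound_of_continuousOn huc
  obtain ⟨L, hL⟩ := hLip p (C + ε / 2)
  obtain ⟨δ, hδ, hδε⟩ : ∃ δ > 0, gronwallBound δ L δ T < ε / 2 := by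
    have hc : Continuous fun δ => gronwallBound δ L δ T := by
      unfold gronwallBound
      split_ifs <;> fun_prop
    have h0 : ∀ᶠ δ in 𝓝 (0 : ℝ), gronwallBound δ L δ T < ε / 2 :=
      hc.continuousAt.eventually_lt continuousAt_const (by simp [gronwallBound_ε0_δ0, hε])
    obtain ⟨δ, hδ⟩ := ((h0.filter_mono nhdsWithin_le_nhds).and
      (self_mem_nhdsWithin : Ioi (0 : ℝ) ∈ 𝓝[>] 0)).exists
    exact ⟨δ, hδ.2, hδ.1⟩
  have hnear : ∀ᶠ p' in 𝓝 p, ∀ z ∈ closedBall (0 : Y) (C + ε / 2) ×ˢ Icc (0 : ℝ) T,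
      dist (F p' z.2 z.1) (F p z.2 z.1) < δ := by
    refine ((isCompact_closedBall _ _).prod isCompact_Icc).eventually_forall_of_forall_eventually
      (P := fun p' z => dist (F p' z.2 z.1) (F p z.2 z.1) < δ) fun z _ => ?_
    have hc : Continuous fun q : P × Y × ℝ => dist (F q.1 q.2.2 q.2.1) (F p q.2.2 q.2.1) :=
      hF.dist (hF.comp (by fun_prop : Continuous fun q : P × Y × ℝ => (p, q.2)))
    exact hc.continuousAt.eventually_lt continuousAt_const (by simpa using hδ)
  have hinit : ∀ᶠ y' in 𝓝 y, dist y' y < δ := Metric.ball_mem_nhds y hδ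
  have htime : ∀ᶠ s in 𝓝 t, max s 0 ≤ T ∧ dist (u p y (max s 0)) (u p y (max t 0)) < ε / 2 := by
    have hmax : ContinuousAt (fun s : ℝ => max s 0) t := by fun_prop
    refine ((hmax.eventually_lt continuousAt_const (by simp [hTdef])).mono fun _ h => h.le).and ?_
    exact ((hu p y _ (le_max_right t 0)).continuousAt.comp_of_eq hmax rfl).eventually
      (Metric.ball_mem_nhds _ (half_pos hε))
  rw [nhds_prod_eq, nhds_prod_eq]
  filter_upwards [(hnear.prod_mk hinit).prod_mk htime]
  rintro ⟨⟨p', y'⟩, s⟩ ⟨⟨hp', hy'⟩, hsT, hs⟩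
  have hclose := dist_lt_of_gronwallBound_lt (v := F p) (w := F p') (φ := u p y) (ψ := u p' y')
    (T := T) (fun s hs => hu p y s hs.1) (fun s hs => hu p' y' s hs.1)
    (fun s hs => hL s hs.1) (fun s hs z hz => (hp' (z, s) ⟨hz, hs⟩).le)
    (by rw [hu0, hu0, dist_comm]; exact hy'.le) hδ.le hδ.le
    (fun s hs => by linarith [hC s hs]) hδε (max s 0) ⟨le_max_right _ _, hsT⟩
  calc dist (u p' y' (max s 0)) (u p y (max t 0))
      ≤ dist (u p y (max s 0)) (u p' y' (max s 0)) + dist (u p y (max s 0)) (u p y (max t 0)) :=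
        dist_triangle_left _ _ _
    _ < ε := by linarith

end ContinuousDependence

section SkewProduct

variable {H Y : Type*} [TopologicalSpace H] [CompactSpace H] [NormedAddCommGroup Y] [ProperSpace Y]

/-- If a skew-product semiflow over a compact base is ultimately bounded, and its bounded entire
trajectories are bounded by `R`, then every ball is mapped into any larger ball of radius `ρ > R`
after some time. -/
theorem exists_time_norm_lt_of_bounded_entire_le {σ : ℝ → H → H} {Φ : H → Y → ℝ → Y}
    (hσ : ∀ s, Continuous (σ s))
    (hσadd : ∀ s t h, σ (s + t) h = σ s (σ t h))
    (hΦ : ∀ t ≥ 0, Continuous fun q : H × Y => Φ q.1 q.2 t)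
    (hcocycle : ∀ h y, ∀ s ≥ 0, ∀ t ≥ 0, Φ h y (s + t) = Φ (σ s h) (Φ h y s) t)
    {c R ρ d : ℝ} (hRρ : R < ρ)
    (hentire : ∀ h (z : ℝ → Y), (∀ s t, s ≤ t → z t = Φ (σ s h) (z s) (t - s)) →
      (∀ t, ‖z t‖ ≤ c) → ‖z 0‖ ≤ R)
    {T₀ : ℝ} (hbound : ∀ h y, ‖y‖ ≤ d → ∀ t ≥ T₀, ‖Φ h y t‖ ≤ c) :
    ∃ T > 0, ∀ h y, ‖y‖ ≤ d → ‖Φ h y T‖ < ρ := by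
  by_contra! hcon
  choose h y hy hρ using fun k : ℕ => hcon (k + 1) (by positivity)
  let 𝒰 : Filter ℕ := hyperfilter ℕ
  have h𝒰 : 𝒰 ≤ atTop := Nat.hyperfilter_le_atTop
  have htop : ∀ a : ℝ, ∀ᶠ k : ℕ in 𝒰, a ≤ (k : ℝ) :=
    fun a => (tendsto_natCast_atTop_atTop.eventually_ge_atTop a).filter_mono h𝒰
  have hlate : ∀ s : ℝ, ∀ᶠ k : ℕ in 𝒰, 0 ≤ (k : ℝ) + 1 + s ∧ T₀ ≤ (k : ℝ) + 1 + s := by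
    intro s
    filter_upwards [htop (-s), htop (T₀ - s)] with k h1 h2
    constructor <;> linarith
  obtain ⟨h', -, hh'⟩ := isCompact_univ.ultrafilter_le_nhds
    ((hyperfilter ℕ).map fun k : ℕ => σ (k + 1) (h k)) (by simp)
  have hh' : Tendsto (fun k : ℕ => σ (k + 1) (h k)) 𝒰 (𝓝 h') := hh'
  have hlim : ∀ s : ℝ, ∃ z ∈ closedBall (0 : Y) c,
      Tendsto (fun k : ℕ => Φ (h k) (y k) (k + 1 + s)) 𝒰 (𝓝 z) := by
    intro s
    refine (isCompact_closedBall (0 : Y) c).ultrafilter_le_nhds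
      ((hyperfilter ℕ).map fun k : ℕ => Φ (h k) (y k) (k + 1 + s)) ?_
    rw [le_principal_iff]
    change ∀ᶠ k in 𝒰, Φ (h k) (y k) (k + 1 + s) ∈ closedBall (0 : Y) c
    filter_upwards [hlate s] with k hk
    rw [mem_closedBall_zero_iff]
    exact hbound _ _ (hy k) _ hk.2
  choose z hzc hz using hlim
  have hz0 : ρ ≤ ‖z 0‖ := by
    refine ge_of_tendsto (hz 0).norm (Eventually.of_forall fun k => ?_)
    simpa using hρ k
  refine absurd (hentire h' z (fun s t hst => ?_) fun t => ?_) (by linarith)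
  · have hst' : 0 ≤ t - s := sub_nonneg.2 hst
    have hlim := ((hΦ (t - s) hst').tendsto (σ s h', z s)).comp
      ((((hσ s).tendsto h').comp hh').prodMk_nhds (hz s))
    refine tendsto_nhds_unique (hz t) (hlim.congr' ?_)
    filter_upwards [hlate s] with k hk
    have := hcocycle (h k) (y k) (k + 1 + s) hk.1 (t - s) hst'
    rw [add_comm ((k : ℝ) + 1) s, hσadd, add_comm s] at this
    simp only [Function.comp_apply]
    rw [← this]
    congr 1
    ring
  · simpa using hzc t

/-- If the closed ball of radius `ρ` returns into itself at time `T`, then trajectories starting in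
it obey for all times the bound they obey on `[0, T]`. -/
theorem norm_le_of_norm_le_on_Icc {H Y : Type*} [NormedAddCommGroup Y]
    {σ : ℝ → H → H} {Φ : H → Y → ℝ → Y}
    (hcocycle : ∀ h y, ∀ s ≥ 0, ∀ t ≥ 0, Φ h y (s + t) = Φ (σ s h) (Φ h y s) t)
    {T ρ M : ℝ} (hT : 0 < T) (hret : ∀ h y, ‖y‖ ≤ ρ → ‖Φ h y T‖ ≤ ρ)
    (hM : ∀ h y, ‖y‖ ≤ ρ → ∀ t ∈ Icc 0 T, ‖Φ h y t‖ ≤ M) {h : H} {y : Y} (hy : ‖y‖ ≤ ρ)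
    {t : ℝ} (ht : 0 ≤ t) : ‖Φ h y t‖ ≤ M := by
  have key : ∀ N : ℕ, ∀ h y, ‖y‖ ≤ ρ → ∀ t, 0 ≤ t → t ≤ N * T → ‖Φ h y t‖ ≤ M := by
    intro N
    induction N with
    | zero =>
      intro h y hy t ht htN
      exact hM h y hy t ⟨ht, htN.trans (by simpa using hT.le)⟩
    | succ N ih =>
      intro h y hy t ht htN
      rcases le_total t T with htT | hTt
      · exact hM h y hy t ⟨ht, htT⟩
      · have := hcocycle h y T hT.le (t - T) (sub_nonneg.2 hTt)
        rw [add_sub_cancel] at this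
        rw [this]
        refine ih _ _ (hret h y hy) _ (sub_nonneg.2 hTt) ?_
        push_cast at htN
        linarith
  obtain ⟨N, hN⟩ := exists_nat_ge (t / T)
  exact key N h y hy t ht ((div_le_iff₀ hT).1 hN)

/-- A parametric skew-product semiflow over a compact base that maps, for each single parameter,
every ball into the open ball of radius `ρ` at some time is uniformly ultimately bounded over
compact sets of parameters. -/
theorem uniformly_ultimately_bounded_of_exists_time {X : Type*} [TopologicalSpace X]
    {σ : ℝ → H → H} {Φ : H → X → Y → ℝ → Y}
    (hΦ : Continuous fun q : ((H × X) × Y) × ℝ => Φ q.1.1.1 q.1.1.2 q.1.2 (max q.2 0))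
    (hcocycle : ∀ h x y, ∀ s ≥ 0, ∀ t ≥ 0, Φ h x y (s + t) = Φ (σ s h) x (Φ h x y s) t)
    {K : Set X} (hK : IsCompact K) {ρ : ℝ}
    (habs : ∀ x ∈ K, ∀ d : ℝ, ∃ T > 0, ∀ h y, ‖y‖ ≤ d → ‖Φ h x y T‖ < ρ) :
    ∃ c > 0, ∀ d : ℝ, ∃ T > 0, ∀ h, ∀ x ∈ K, ∀ y, ‖y‖ ≤ d → ∀ t ≥ T, ‖Φ h x y t‖ ≤ c := by
  have hloc : ∀ x ∈ K, ∀ d : ℝ, ∃ T > 0, ∀ᶠ x' in 𝓝 x, ∀ h y, ‖y‖ ≤ d → ‖Φ h x' y T‖ < ρ := by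
    intro x hx d
    obtain ⟨T, hT, hTρ⟩ := habs x hx d
    refine ⟨T, hT, ?_⟩
    have := ((isCompact_univ (X := H)).prod
      (isCompact_closedBall (0 : Y) d)).eventually_forall_of_forall_eventually
      (x₀ := x) (P := fun x' z => ‖Φ z.1 x' z.2 T‖ < ρ) fun z hz => by
        have hc : Continuous fun q : X × H × Y => ‖Φ q.2.1 q.1 q.2.2 T‖ := by
          have := (hΦ.comp (by fun_prop :
            Continuous fun q : X × H × Y => (((q.2.1, q.1), q.2.2), T))).norm
          simpa [Function.comp_def, max_eq_left hT.le] using this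
        exact hc.continuousAt.eventually_lt continuousAt_const
          (hTρ z.1 z.2 (mem_closedBall_zero_iff.1 hz.2))
    filter_upwards [this] with x' hx' h y hy
    exact hx' (h, y) ⟨mem_univ _, mem_closedBall_zero_iff.2 hy⟩
  obtain ⟨c, hc⟩ : ∃ c, ∀ x ∈ K, ∀ h y, ‖y‖ ≤ ρ → ∀ t ≥ 0, ‖Φ h x y t‖ ≤ c := by
    refine hK.induction_on (p := fun s => ∃ c, ∀ x ∈ s, ∀ h y, ‖y‖ ≤ ρ → ∀ t ≥ 0, ‖Φ h x y t‖ ≤ c)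
      ⟨0, by simp⟩ (fun s s' hss' ⟨c, hc⟩ => ⟨c, fun x hx => hc x (hss' hx)⟩) ?_ ?_
    · rintro s s' ⟨c, hc⟩ ⟨c', hc'⟩
      refine ⟨max c c', fun x hx h y hy t ht => ?_⟩
      rcases hx with hx | hx
      · exact (hc x hx h y hy t ht).trans (le_max_left _ _)
      · exact (hc' x hx h y hy t ht).trans (le_max_right _ _)
    · intro x hx
      obtain ⟨T, hT, hev⟩ := hloc x hx ρ
      obtain ⟨M, hM⟩ := ((((isCompact_univ (X := H)).prod hK).prod
        (isCompact_closedBall (0 : Y) ρ)).prod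
          (isCompact_Icc (a := (0 : ℝ)) (b := T))).exists_bound_of_continuousOn hΦ.continuousOn
      refine ⟨K ∩ {x' | ∀ h y, ‖y‖ ≤ ρ → ‖Φ h x' y T‖ < ρ},
        inter_mem self_mem_nhdsWithin (nhdsWithin_le_nhds hev), M,
        fun x' hx' h y hy t ht => ?_⟩
      refine norm_le_of_norm_le_on_Icc (Φ := fun h y t => Φ h x' y t) (σ := σ)
        (fun h y => hcocycle h x' y) hT (fun h y hy => (hx'.2 h y hy).le) ?_ hy ht
      intro h y hy t ht
      have := hM (((h, x'), y), t) ⟨⟨⟨mem_univ _, hx'.1⟩, mem_closedBall_zero_iff.2 hy⟩, ht⟩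
      simpa only [max_eq_left ht.1] using this
  refine ⟨max c 1, by positivity, fun d => ?_⟩
  obtain ⟨T, hT, habsT⟩ : ∃ T > 0, ∀ x ∈ K, ∀ h y, ‖y‖ ≤ d → ∃ s ∈ Icc 0 T, ‖Φ h x y s‖ ≤ ρ := by
    refine hK.induction_on (p := fun S => ∃ T > 0, ∀ x ∈ S, ∀ h y, ‖y‖ ≤ d →
      ∃ s ∈ Icc 0 T, ‖Φ h x y s‖ ≤ ρ) ⟨1, one_pos, by simp⟩
      (fun s s' hss' ⟨T, hT, h⟩ => ⟨T, hT, fun x hx => h x (hss' hx)⟩) ?_ ?_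
    · rintro s s' ⟨T, hT, hs⟩ ⟨T', hT', hs'⟩
      refine ⟨max T T', lt_max_of_lt_left hT, fun x hx h y hy => ?_⟩
      rcases hx with hx | hx
      · obtain ⟨r, hr, hrρ⟩ := hs x hx h y hy
        exact ⟨r, Icc_subset_Icc_right (le_max_left _ _) hr, hrρ⟩
      · obtain ⟨r, hr, hrρ⟩ := hs' x hx h y hy
        exact ⟨r, Icc_subset_Icc_right (le_max_right _ _) hr, hrρ⟩
    · intro x hx
      obtain ⟨T, hT, hev⟩ := hloc x hx d
      exact ⟨_, nhdsWithin_le_nhds hev, T, hT,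
        fun x' hx' h y hy => ⟨T, ⟨hT.le, le_rfl⟩, (hx' h y hy).le⟩⟩
  refine ⟨T, hT, fun h x hx y hy t ht => le_max_of_le_left ?_⟩
  obtain ⟨s, hs, hsρ⟩ := habsT x hx h y hy
  have hst : 0 ≤ t - s := by linarith [hs.2]
  have := hcocycle h x y s hs.1 (t - s) hst
  rw [add_sub_cancel] at this
  rw [this]
  exact hc x hx _ _ hsρ _ hst

end SkewProduct

/-- Elements of the hull inherit the Lipschitz bounds of `g`. -/
theorem exists_lipschitz_of_mem_closure_timeTranslate {n m : ℕ}
    {g f : C(EuclideanSpace ℝ (Fin n) × EuclideanSpace ℝ (Fin m) × ℝ, EuclideanSpace ℝ (Fin m))}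
    (hlip : IsLipschitzInY g) (hf : f ∈ closure {h | ∃ s : ℝ, h = timeTranslate s g})
    (x : EuclideanSpace ℝ (Fin n)) {K : Set (EuclideanSpace ℝ (Fin m))} (hK : IsCompact K) :
    ∃ L > (0 : ℝ), ∀ y₁ ∈ K, ∀ y₂ ∈ K, ∀ τ : ℝ,
      ‖f (x, y₁, τ) - f (x, y₂, τ)‖ ≤ L * ‖y₁ - y₂‖ := by
  obtain ⟨L, hL, hLip⟩ := hlip {x} isCompact_singleton K hK
  refine ⟨L, hL, fun y₁ h₁ y₂ h₂ τ => ?_⟩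
  have hclosed : IsClosed {f : C(EuclideanSpace ℝ (Fin n) × EuclideanSpace ℝ (Fin m) × ℝ,
      EuclideanSpace ℝ (Fin m)) | ‖f (x, y₁, τ) - f (x, y₂, τ)‖ ≤ L * ‖y₁ - y₂‖} :=
    isClosed_le ((continuous_eval_const _).sub
      (continuous_eval_const _)).norm continuous_const
  refine closure_minimal ?_ hclosed hf
  rintro _ ⟨s, rfl⟩
  exact hLip x rfl y₁ h₁ y₂ h₂ (τ + s)

/-- uniform ultimate boundedness over K₀ from fiberwise ultimate boundedness plus a uniform bound on bounded entire solutions. -/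
theorem stmt_3
    {n m : ℕ} (hn : 1 ≤ n) (hm : 1 ≤ m)
    -- g, admissible and Lipschitz in y on compacts
    (g : C(EuclideanSpace ℝ (Fin n) × EuclideanSpace ℝ (Fin m) × ℝ,
      EuclideanSpace ℝ (Fin m)))
    (hadm : IsAdmissibleMap g) (hlip : IsLipschitzInY g)
    -- the hull H of g, a compact metric space with the continuous shift flow,
    -- identified via the embedding ev with the closure of the translates of g
    (H : Type) [MetricSpace H] [CompactSpace H]
    (σf : ℝ → H → H)
    (hσcont : Continuous fun p : ℝ × H => σf p.1 p.2)
    (hσ0 : ∀ h, σf 0 h = h)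
    (hσadd : ∀ s t : ℝ, ∀ h, σf (s + t) h = σf s (σf t h))
    (ev : H → C(EuclideanSpace ℝ (Fin n) × EuclideanSpace ℝ (Fin m) × ℝ,
      EuclideanSpace ℝ (Fin m)))
    (hev : Topology.IsEmbedding ev)
    (hrange : Set.range ev = closure {h | ∃ s : ℝ, h = timeTranslate s g})
    (g0 : H) (hg0 : ev g0 = g)
    (hequiv : ∀ (s : ℝ) (h : H), ev (σf s h) = timeTranslate s (ev h))
    -- the (unique, maximal) solutions y(τ,h,x,τ₀,y₀) of y' = h(x,y,τ)
    (sol : H → EuclideanSpace ℝ (Fin n) → ℝ → EuclideanSpace ℝ (Fin m) → ℝ →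
      EuclideanSpace ℝ (Fin m))
    (hsolinit : ∀ h x τ₀ y₀, sol h x τ₀ y₀ τ₀ = y₀)
    -- (H1): all solutions over the hull are globally defined in the future
    (hsolode : ∀ h x (τ₀ : ℝ) y₀ (τ : ℝ), τ₀ ≤ τ →
      HasDerivAt (sol h x τ₀ y₀) (ev h (x, sol h x τ₀ y₀ τ, τ)) τ)
    (K₀ : Set (EuclideanSpace ℝ (Fin n))) (hK₀ : IsCompact K₀)
    -- (a) per-parameter uniform ultimate boundedness
    (hfiber : ∀ x ∈ K₀, ∃ c > (0:ℝ), ∀ d > (0:ℝ), ∃ T > (0:ℝ), ∀ τ₀ : ℝ, ∀ τ ≥ T,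
      ∀ y₀ : EuclideanSpace ℝ (Fin m), ‖y₀‖ ≤ d → ‖sol g0 x τ₀ y₀ (τ + τ₀)‖ ≤ c)
    -- (b) a uniform bound r on all bounded entire solutions over the hull
    (hrbound : ∃ R > (0:ℝ), ∀ (h : H), ∀ x ∈ K₀, ∀ y : ℝ → EuclideanSpace ℝ (Fin m),
      (∀ τ : ℝ, HasDerivAt y (ev h (x, y τ, τ)) τ) → (∃ C, ∀ τ : ℝ, ‖y τ‖ ≤ C) →
      ∀ τ : ℝ, ‖y τ‖ ≤ R) :
    ∃ c > (0:ℝ), ∀ d > (0:ℝ), ∃ T > (0:ℝ), ∀ x ∈ K₀, ∀ τ₀ : ℝ, ∀ τ ≥ T,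
      ∀ y₀ : EuclideanSpace ℝ (Fin m), ‖y₀‖ ≤ d → ‖sol g0 x τ₀ y₀ (τ + τ₀)‖ ≤ c := by
  obtain ⟨R, -, hR⟩ := hrbound
  have hF : Continuous fun q : (H × EuclideanSpace ℝ (Fin n)) × EuclideanSpace ℝ (Fin m) × ℝ =>
      ev q.1.1 (q.1.2, q.2.1, q.2.2) :=
    (hev.continuous.comp (by fun_prop)).eval (by fun_prop)
  have hLip : ∀ p : H × EuclideanSpace ℝ (Fin n), ∀ ρ : ℝ, ∃ L : NNReal, ∀ t ≥ (0 : ℝ),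
      LipschitzOnWith L (fun y => ev p.1 (p.2, y, t)) (closedBall 0 ρ) := by
    rintro ⟨h, x⟩ ρ
    obtain ⟨L, hL, hLip⟩ := exists_lipschitz_of_mem_closure_timeTranslate hlip
      (hrange ▸ mem_range_self h) x (isCompact_closedBall 0 ρ)
    exact ⟨L.toNNReal, fun t _ => LipschitzOnWith.of_dist_le_mul fun y₁ h₁ y₂ h₂ => by
      simpa [dist_eq_norm, Real.coe_toNNReal _ hL.le] using hLip y₁ h₁ y₂ h₂ t⟩
  have hshift : ∀ s h x y t, ev (σf s h) (x, y, t) = ev h (x, y, t + s) := fun s h x y t => by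
    rw [hequiv]; rfl
  have hcont := continuous_solution_of_lipschitzOnWith_closedBall
    (F := fun (p : H × EuclideanSpace ℝ (Fin n)) t y => ev p.1 (p.2, y, t)) hF hLip
    (u := fun p y => sol p.1 p.2 0 y) (fun p y => hsolinit _ _ _ _)
    (fun p y t ht => hsolode _ _ _ _ _ ht)
  have htranslate : ∀ h x τ₀ y, ∀ s ≥ τ₀, ∀ t ≥ (0 : ℝ),
      sol h x τ₀ y (t + s) = sol (σf s h) x 0 (sol h x τ₀ y s) t := by
    intro h x τ₀ y s hs t ht
    refine eq_of_hasDerivAt_of_lipschitzOnWith_closedBall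
      (v := fun t y => ev (σf s h) (x, y, t)) (φ := fun t => sol h x τ₀ y (t + s))
      (fun r hr => ?_) (fun r hr => hsolode _ _ _ _ _ hr) (hLip (σf s h, x))
      (by simp [hsolinit]) ht
    simpa only [hshift] using (hsolode h x τ₀ y (r + s) (by linarith)).comp_add_const r s
  have hΦ : ∀ x, ∀ t ≥ (0 : ℝ), Continuous fun q : H × EuclideanSpace ℝ (Fin m) =>
      sol q.1 x 0 q.2 t := by
    intro x t ht
    simpa [Function.comp_def, max_eq_left ht] using hcont.comp (by fun_prop :
      Continuous fun q : H × EuclideanSpace ℝ (Fin m) => (((q.1, x), q.2), t))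
  have hdense : ∀ h, h ∈ closure (range fun s => σf s g0) := by
    intro h
    rw [hev.closure_eq_preimage_closure_image, mem_preimage]
    convert (hrange ▸ mem_range_self h : ev h ∈ closure {h | ∃ s : ℝ, h = timeTranslate s g})
    ext f
    simp [hequiv, hg0, eq_comm]
  obtain ⟨c, hc, hcb⟩ := uniformly_ultimately_bounded_of_exists_time (σ := σf)
    (Φ := fun h x y t => sol h x 0 y t) hcont
    (fun h x y s hs t ht => by rw [add_comm]; exact htranslate h x 0 y s hs t ht)
    hK₀ (ρ := R + 1) (fun x hx d => by
      obtain ⟨c, hc, hfib⟩ := hfiber x hx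
      obtain ⟨T₀, hT₀, hfibT⟩ := hfib (max d 1) (by positivity)
      refine exists_time_norm_lt_of_bounded_entire_le (σ := σf)
        (Φ := fun h y t => sol h x 0 y t) (c := c) (T₀ := T₀) (R := R)
        (fun s => hσcont.comp (by fun_prop : Continuous fun h : H => (s, h))) hσadd (hΦ x)
        (fun h y s hs t ht => by rw [add_comm]; exact htranslate h x 0 y s hs t ht)
        (by linarith) (fun h z hz hzc => ?_) (fun h y hy t ht => ?_)
      · refine hR h x hx z (fun τ => ?_) ⟨c, hzc⟩ 0
        have hsol := (hsolode (σf (τ - 1) h) x 0 (z (τ - 1)) (τ - (τ - 1)) (by simp)).comp_sub_const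
          τ (τ - 1)
        rw [← hz (τ - 1) τ (by linarith), hshift, sub_add_cancel] at hsol
        refine hsol.congr_of_eventuallyEq ?_
        filter_upwards [eventually_ge_nhds (sub_one_lt τ)] with t ht
        exact hz _ _ ht
      · have ht0 : 0 ≤ t := hT₀.le.trans ht
        have hclosed : IsClosed {h | ‖sol h x 0 y t‖ ≤ c} :=
          isClosed_le ((hΦ x t ht0).comp (by fun_prop : Continuous fun h : H => (h, y))).norm
            continuous_const
        refine closure_minimal ?_ hclosed (hdense h)
        rintro _ ⟨s, rfl⟩
        have := hfibT s t ht y (hy.trans (le_max_left _ _))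
        rwa [htranslate g0 x s y s le_rfl t ht0, hsolinit] at this)
  refine ⟨c, hc, fun d _ => ?_⟩
  obtain ⟨T, hT, hcT⟩ := hcb d
  refine ⟨T, hT, fun x hx τ₀ τ hτ y₀ hy₀ => ?_⟩
  rw [htranslate g0 x τ₀ y₀ τ₀ le_rfl τ (hT.le.trans hτ), hsolinit]
  exact hcT _ x hx y₀ hy₀ τ hτ
end

section
/- Suppose 𝔸 ⊂ H×K₀×ℝᵐ is a global attractor for π, that for each x ∈ K₀ the semiflow π^x has a global attractor 𝔸^x ⊂ H×ℝᵐ with A_{(h,x)} ⊆ A^x_h for all (h,x) ∈ H×K₀, and that the set-valued map x ∈ K₀ ↦ 𝔸^x is continuous for the Hausdorff distance on nonempty compact subsets of H×ℝᵐ. Then for every δ > 0 and every bounded set D ⊂ ℝᵐ, lim_{τ→∞} sup_{(h,x)∈H×K₀} dist(u(τ,h,x,D), A^x_{h·τ}[δ]) = 0. -/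
open Filter Topology Metric Set

/-- A map from a compact set into the nonempty compact sets that is continuous for the Hausdorff
distance is uniformly continuous, expressed through the distance of points to the sets. -/
theorem exists_pos_forall_infDist_lt_of_hausdorffDist_tendsto {X Y : Type*} [PseudoMetricSpace X]
    [PseudoMetricSpace Y] {K : Set X} (hK : IsCompact K) {F : X → Set Y}
    (hne : ∀ x ∈ K, (F x).Nonempty) (hc : ∀ x ∈ K, IsCompact (F x))
    (hcont : ∀ x ∈ K, Tendsto (fun x' => hausdorffDist (F x') (F x)) (𝓝[K] x) (𝓝 0))
    {ε : ℝ} (hε : 0 < ε) :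
    ∃ η > 0, ∀ x ∈ K, ∀ x' ∈ K, dist x' x < η → ∀ q ∈ F x', infDist q (F x) < ε := by
  have fin : ∀ x ∈ K, ∀ z ∈ K, hausdorffEDist (F x) (F z) ≠ ⊤ := fun x hx z hz =>
    hausdorffEDist_ne_top_of_nonempty_of_bounded (hne x hx) (hne z hz)
      (hc x hx).isBounded (hc z hz).isBounded
  have key : ∀ z : K, ∃ r > 0, ∀ x ∈ ball (z : X) r, x ∈ K →
      hausdorffDist (F x) (F z) < ε / 2 := by
    intro z
    have h := (hcont z z.2).eventually (gt_mem_nhds (half_pos hε))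
    rw [eventually_nhdsWithin_iff, Metric.eventually_nhds_iff_ball] at h
    exact h
  choose r hr hrF using key
  obtain ⟨η, hη, hcover⟩ := lebesgue_number_lemma_of_metric hK
    (c := fun z : K => ball (z : X) (r z)) (fun _ => isOpen_ball)
    (fun x hx => mem_iUnion.2 ⟨⟨x, hx⟩, mem_ball_self (hr _)⟩)
  refine ⟨η, hη, fun x hx x' hx' hxx' q hq => ?_⟩
  obtain ⟨z, hz⟩ := hcover x hx
  have h₁ := hrF z x (hz (mem_ball_self hη)) hx
  have h₂ := hrF z x' (hz hxx') hx'
  have h₃ := infDist_le_hausdorffDist_of_mem hq (fin x' hx' z z.2)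
  have h₄ := infDist_le_infDist_add_hausdorffDist (x := q) (fin z z.2 x hx)
  rw [hausdorffDist_comm] at h₄
  linarith

/-- under continuity of x ↦ 𝔸ˣ for the Hausdorff distance, the
cocycle forward-attracts, uniformly in (h,x), into the δ-inflated fibers of
the attractors 𝔸ˣ. -/
theorem stmt_5 {n m : ℕ}
    (H : Type) [MetricSpace H] [CompactSpace H]
    (σf : ℝ → H → H)
    (hσcont : Continuous fun p : ℝ × H => σf p.1 p.2)
    (hσ0 : ∀ h, σf 0 h = h)
    (hσadd : ∀ s t : ℝ, ∀ h, σf (s + t) h = σf s (σf t h))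
    (K₀ : Set (EuclideanSpace ℝ (Fin n))) (hK₀ : IsCompact K₀)
    (u : ℝ → H → EuclideanSpace ℝ (Fin n) → EuclideanSpace ℝ (Fin m) →
      EuclideanSpace ℝ (Fin m))
    (hucont : ContinuousOn
      (fun p : ℝ × H × EuclideanSpace ℝ (Fin n) × EuclideanSpace ℝ (Fin m) =>
        u p.1 p.2.1 p.2.2.1 p.2.2.2) {p | 0 ≤ p.1 ∧ p.2.2.1 ∈ K₀})
    (hu0 : ∀ h x y, u 0 h x y = y)
    (hucoc : ∀ τ₁ τ₂ : ℝ, 0 ≤ τ₁ → 0 ≤ τ₂ → ∀ h x y,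
      u (τ₁ + τ₂) h x y = u τ₁ (σf τ₂ h) x (u τ₂ h x y))
    -- 𝔸 is a global attractor for π
    (𝔸 : Set (H × EuclideanSpace ℝ (Fin n) × EuclideanSpace ℝ (Fin m)))
    (h𝔸ne : 𝔸.Nonempty) (h𝔸c : IsCompact 𝔸)
    (h𝔸sub : ∀ p ∈ 𝔸, p.2.1 ∈ K₀)
    (h𝔸inv : ∀ τ : ℝ, 0 ≤ τ →
      (fun p : H × EuclideanSpace ℝ (Fin n) × EuclideanSpace ℝ (Fin m) =>
        (σf τ p.1, p.2.1, u τ p.1 p.2.1 p.2.2)) '' 𝔸 = 𝔸)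
    (h𝔸attr : ∀ D : Set (EuclideanSpace ℝ (Fin m)), Bornology.IsBounded D →
      ∀ ε > (0:ℝ), ∃ T : ℝ, ∀ τ ≥ T, ∀ h x y₀, x ∈ K₀ → y₀ ∈ D →
        Metric.infDist
          ((σf τ h, x, u τ h x y₀) :
            H × EuclideanSpace ℝ (Fin n) × EuclideanSpace ℝ (Fin m)) 𝔸 ≤ ε)
    -- for each x ∈ K₀, 𝔸ˣ is a global attractor for πˣ
    (𝔸x : EuclideanSpace ℝ (Fin n) → Set (H × EuclideanSpace ℝ (Fin m)))
    (h𝔸xne : ∀ x ∈ K₀, (𝔸x x).Nonempty) (h𝔸xc : ∀ x ∈ K₀, IsCompact (𝔸x x))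
    (h𝔸xinv : ∀ x ∈ K₀, ∀ τ : ℝ, 0 ≤ τ →
      (fun p : H × EuclideanSpace ℝ (Fin m) => (σf τ p.1, u τ p.1 x p.2)) '' 𝔸x x = 𝔸x x)
    (h𝔸xattr : ∀ x ∈ K₀, ∀ D : Set (EuclideanSpace ℝ (Fin m)), Bornology.IsBounded D →
      ∀ ε > (0:ℝ), ∃ T : ℝ, ∀ τ ≥ T, ∀ h y₀, y₀ ∈ D →
        Metric.infDist ((σf τ h, u τ h x y₀) : H × EuclideanSpace ℝ (Fin m)) (𝔸x x) ≤ ε)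
    -- A_{(h,x)} ⊆ Aˣ_h
    (hsub : ∀ h x, x ∈ K₀ → ∀ y, (h, x, y) ∈ 𝔸 → (h, y) ∈ 𝔸x x)
    -- continuity of x ↦ 𝔸ˣ for the Hausdorff distance
    (hcont : ∀ x ∈ K₀,
      Tendsto (fun x' => Metric.hausdorffDist (𝔸x x') (𝔸x x)) (𝓝[K₀] x) (𝓝 0)) :
    ∀ δ > (0:ℝ), ∀ D : Set (EuclideanSpace ℝ (Fin m)), Bornology.IsBounded D →
      ∀ ε > (0:ℝ), ∃ T : ℝ, ∀ τ ≥ T, ∀ h x y₀, x ∈ K₀ → y₀ ∈ D →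
        Metric.infDist (u τ h x y₀)
          (⋃ h' ∈ {h' : H | dist (σf τ h) h' ≤ δ}, {y | (h', y) ∈ 𝔸x x}) ≤ ε := by
  intro δ hδ D hD ε hε
  have hρ : 0 < min δ ε := lt_min hδ hε
  obtain ⟨η, hη, hunif⟩ := exists_pos_forall_infDist_lt_of_hausdorffDist_tendsto hK₀ h𝔸xne h𝔸xc
    hcont (half_pos hρ)
  have hη' : 0 < min η (min δ ε / 2) := lt_min hη (half_pos hρ)
  obtain ⟨T, hT⟩ := h𝔸attr D hD _ (half_pos hη')
  refine ⟨T, fun τ hτ h x y₀ hx hy₀ => ?_⟩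
  obtain ⟨⟨h₁, x₁, y₁⟩, hmem, hd⟩ := (infDist_lt_iff h𝔸ne).1
    ((hT τ hτ h x y₀ hx hy₀).trans_lt (half_lt_self hη'))
  simp only [Prod.dist_eq, max_lt_iff, lt_min_iff] at hd
  obtain ⟨⟨-, hdx, -⟩, hd₁, -, hd₂⟩ := hd
  have hx₁ : x₁ ∈ K₀ := h𝔸sub _ hmem
  have hnear := hunif x hx x₁ hx₁ (by rwa [dist_comm]) (h₁, y₁) (hsub h₁ x₁ hx₁ y₁ hmem)
  obtain ⟨⟨h₂, y₂⟩, hmem₂, hd'⟩ := (infDist_lt_iff (h𝔸xne x hx)).1 hnear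
  simp only [Prod.dist_eq, max_lt_iff] at hd'
  have hh : dist (σf τ h) h₂ ≤ δ := by
    linarith [dist_triangle (σf τ h) h₁ h₂, hd'.1, min_le_left δ ε]
  have hy : dist (u τ h x y₀) y₂ ≤ ε := by
    linarith [dist_triangle (u τ h x y₀) y₁ y₂, hd'.2, min_le_right δ ε]
  exact (infDist_le_dist_of_mem (mem_biUnion (show h₂ ∈ {h' | dist (σf τ h) h' ≤ δ} from hh)
    hmem₂)).trans hy
end

section
/- Suppose 𝔸 ⊂ H×K₀×ℝᵐ is a global attractor for π and that the set-valued map (h,x) ∈ H×K₀ ↦ A_{(h,x)} is continuous for the Hausdorff distance on nonempty compact subsets of ℝᵐ. Then there is uniform forward attraction: for every bounded set D ⊂ ℝᵐ, lim_{τ→∞} sup_{(h,x)∈H×K₀} dist(u(τ,h,x,D), A_{(h·τ,x)}) = 0. -/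
open Filter Topology Metric Set

/-- A compact subset of a product which comes arbitrarily close to the slice over `b` meets it. -/
theorem IsCompact.exists_mem_fiber_of_forall_dist_lt {B X Y : Type*} [MetricSpace B]
    [MetricSpace X] [MetricSpace Y] {A : Set (B × X × Y)} (hA : IsCompact A) (b : B) (x : X)
    (h : ∀ ε > 0, ∃ p ∈ A, dist (b, x) (p.1, p.2.1) < ε) : ∃ y, (b, x, y) ∈ A := by
  obtain ⟨p₁, hp₁, -⟩ := h 1 one_pos
  obtain ⟨⟨b', x', y⟩, hp, hmin⟩ := hA.exists_isMinOn ⟨p₁, hp₁⟩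
    (f := fun p : B × X × Y => dist (b, x) (p.1, p.2.1)) (by fun_prop)
  have hzero : dist (b, x) (b', x') ≤ 0 := by
    refine le_of_forall_pos_le_add fun ε hε => ?_
    obtain ⟨q, hq, hqε⟩ := h ε hε
    have := isMinOn_iff.1 hmin q hq
    simp only at this
    linarith
  obtain ⟨rfl, rfl⟩ := Prod.mk.inj (dist_le_zero.1 hzero)
  exact ⟨y, hp⟩

/-- A set-valued map with nonempty bounded values that is continuous for the Hausdorff distance on
a compact set is uniformly so; this is the resulting estimate on distances to the values. -/
theorem IsCompact.exists_forall_infDist_le_of_tendsto_hausdorffDist {P Y : Type*}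
    [PseudoMetricSpace P] [PseudoMetricSpace Y] {K : Set P} (hK : IsCompact K) (F : P → Set Y)
    (hne : ∀ p ∈ K, (F p).Nonempty) (hbdd : ∀ p ∈ K, Bornology.IsBounded (F p))
    (hF : ∀ p ∈ K, Tendsto (fun q => hausdorffDist (F q) (F p)) (𝓝[K] p) (𝓝 0))
    {ε : ℝ} (hε : 0 < ε) :
    ∃ δ > 0, ∀ p ∈ K, ∀ q ∈ K, dist q p < δ → ∀ y ∈ F p, infDist y (F q) ≤ ε := by
  have hfin : ∀ p ∈ K, ∀ q ∈ K, hausdorffEDist (F p) (F q) ≠ ⊤ := fun p hp q hq =>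
    hausdorffEDist_ne_top_of_nonempty_of_bounded (hne p hp) (hne q hq) (hbdd p hp) (hbdd q hq)
  have hloc : ∀ p : K, ∃ r > 0, ∀ q ∈ ball p.1 r ∩ K, hausdorffDist (F q) (F p) < ε / 2 :=
    fun p => mem_nhdsWithin_iff.1 ((hF p p.2).eventually_lt_const (half_pos hε))
  choose r hr hball using hloc
  obtain ⟨δ, hδ, hleb⟩ := lebesgue_number_lemma_of_metric hK
    (c := fun p : K => ball p.1 (r p)) (fun _ => isOpen_ball)
    (fun p hp => mem_iUnion.2 ⟨⟨p, hp⟩, mem_ball_self (hr _)⟩)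
  refine ⟨δ, hδ, fun p hp q hq hqp y hy => ?_⟩
  obtain ⟨c, hc⟩ := hleb p hp
  have hpc := hball c p ⟨hc (mem_ball_self hδ), hp⟩
  have hqc := hball c q ⟨hc hqp, hq⟩
  have h₁ : infDist y (F c) ≤ hausdorffDist (F p) (F c) :=
    infDist_le_hausdorffDist_of_mem hy (hfin p hp c c.2)
  have h₂ : infDist y (F q) ≤ infDist y (F c) + hausdorffDist (F c) (F q) :=
    infDist_le_infDist_add_hausdorffDist (hfin c c.2 q hq)
  rw [hausdorffDist_comm] at h₂
  linarith

/-- under continuity of (h,x) ↦ A_{(h,x)} for the Hausdorff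
distance, there is uniform forward attraction to the fibers of the pullback
attractor (no inflation needed). -/
theorem stmt_6 {n m : ℕ}
    (H : Type) [MetricSpace H] [CompactSpace H]
    (σf : ℝ → H → H)
    (hσcont : Continuous fun p : ℝ × H => σf p.1 p.2)
    (hσ0 : ∀ h, σf 0 h = h)
    (hσadd : ∀ s t : ℝ, ∀ h, σf (s + t) h = σf s (σf t h))
    (K₀ : Set (EuclideanSpace ℝ (Fin n))) (hK₀ : IsCompact K₀)
    (u : ℝ → H → EuclideanSpace ℝ (Fin n) → EuclideanSpace ℝ (Fin m) →
      EuclideanSpace ℝ (Fin m))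
    (hucont : ContinuousOn
      (fun p : ℝ × H × EuclideanSpace ℝ (Fin n) × EuclideanSpace ℝ (Fin m) =>
        u p.1 p.2.1 p.2.2.1 p.2.2.2) {p | 0 ≤ p.1 ∧ p.2.2.1 ∈ K₀})
    (hu0 : ∀ h x y, u 0 h x y = y)
    (hucoc : ∀ τ₁ τ₂ : ℝ, 0 ≤ τ₁ → 0 ≤ τ₂ → ∀ h x y,
      u (τ₁ + τ₂) h x y = u τ₁ (σf τ₂ h) x (u τ₂ h x y))
    -- 𝔸 is a global attractor for π
    (𝔸 : Set (H × EuclideanSpace ℝ (Fin n) × EuclideanSpace ℝ (Fin m)))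
    (h𝔸ne : 𝔸.Nonempty) (h𝔸c : IsCompact 𝔸)
    (h𝔸sub : ∀ p ∈ 𝔸, p.2.1 ∈ K₀)
    (h𝔸inv : ∀ τ : ℝ, 0 ≤ τ →
      (fun p : H × EuclideanSpace ℝ (Fin n) × EuclideanSpace ℝ (Fin m) =>
        (σf τ p.1, p.2.1, u τ p.1 p.2.1 p.2.2)) '' 𝔸 = 𝔸)
    (h𝔸attr : ∀ D : Set (EuclideanSpace ℝ (Fin m)), Bornology.IsBounded D →
      ∀ ε > (0:ℝ), ∃ T : ℝ, ∀ τ ≥ T, ∀ h x y₀, x ∈ K₀ → y₀ ∈ D →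
        Metric.infDist
          ((σf τ h, x, u τ h x y₀) :
            H × EuclideanSpace ℝ (Fin n) × EuclideanSpace ℝ (Fin m)) 𝔸 ≤ ε)
    -- continuity of (h,x) ↦ A_{(h,x)} for the Hausdorff distance
    (hcont : ∀ p : H × EuclideanSpace ℝ (Fin n), p.2 ∈ K₀ →
      Tendsto (fun q : H × EuclideanSpace ℝ (Fin n) =>
          Metric.hausdorffDist {y | (q.1, q.2, y) ∈ 𝔸} {y | (p.1, p.2, y) ∈ 𝔸})
        (𝓝[{q : H × EuclideanSpace ℝ (Fin n) | q.2 ∈ K₀}] p) (𝓝 0)) :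
    ∀ D : Set (EuclideanSpace ℝ (Fin m)), Bornology.IsBounded D →
      ∀ ε > (0:ℝ), ∃ T : ℝ, ∀ τ ≥ T, ∀ h x y₀, x ∈ K₀ → y₀ ∈ D →
        Metric.infDist (u τ h x y₀) {y | (σf τ h, x, y) ∈ 𝔸} ≤ ε := by
  have hfiber : ∀ h, ∀ x ∈ K₀, ∃ y, (h, x, y) ∈ 𝔸 := by
    intro h x hx
    refine h𝔸c.exists_mem_fiber_of_forall_dist_lt h x fun ε hε => ?_
    obtain ⟨T, hT⟩ := h𝔸attr {0} Bornology.isBounded_singleton (ε / 2) (half_pos hε)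
    have hlt := (hT T le_rfl (σf (-T) h) x 0 hx rfl).trans_lt (half_lt_self hε)
    rw [← hσadd, add_neg_cancel, hσ0] at hlt
    obtain ⟨p, hp, hdist⟩ := (infDist_lt_iff h𝔸ne).1 hlt
    simp only [Prod.dist_eq, max_lt_iff] at hdist ⊢
    exact ⟨p, hp, hdist.1, hdist.2.1⟩
  intro D hD ε hε
  have hbase : IsCompact {q : H × EuclideanSpace ℝ (Fin n) | q.2 ∈ K₀} := by
    have hprod := (isCompact_univ (X := H)).prod hK₀
    rwa [univ_prod] at hprod
  obtain ⟨δ, hδ, hunif⟩ := hbase.exists_forall_infDist_le_of_tendsto_hausdorffDist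
    (fun q => {y | (q.1, q.2, y) ∈ 𝔸}) (fun q hq => hfiber q.1 q.2 hq)
    (fun q _ => ((h𝔸c.image (continuous_snd.comp continuous_snd)).isBounded).subset
      fun y hy => ⟨(q.1, q.2, y), hy, rfl⟩)
    hcont (half_pos hε)
  obtain ⟨T, hT⟩ := h𝔸attr D hD (min δ (ε / 2) / 2) (by positivity)
  refine ⟨T, fun τ hτ h x y₀ hx hy₀ => ?_⟩
  have hlt := (hT τ hτ h x y₀ hx hy₀).trans_lt (half_lt_self (by positivity))
  obtain ⟨p, hp, hdist⟩ := (infDist_lt_iff h𝔸ne).1 hlt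
  simp only [Prod.dist_eq, max_lt_iff, lt_min_iff] at hdist
  have hp' := hunif (p.1, p.2.1) (h𝔸sub p hp) (σf τ h, x) hx
    (by rw [Prod.dist_eq]; exact max_lt hdist.1.1 hdist.1.2.1) p.2.2 hp
  have htri : infDist (u τ h x y₀) {y | (σf τ h, x, y) ∈ 𝔸} ≤
      infDist p.2.2 {y | (σf τ h, x, y) ∈ 𝔸} + dist (u τ h x y₀) p.2.2 :=
    infDist_le_infDist_add_dist
  linarith [hdist.2.2.2]
end

section
/- Suppose that for each x ∈ K₀ the semiflow π^x has a global attractor 𝔸^x ⊂ H×ℝᵐ and that there exists ρ > 0 with 𝔸^x ⊆ H × {y ∈ ℝᵐ : |y| ≤ ρ} for all x ∈ K₀. Then the following are equivalent: (1) the map x ∈ K₀ ↦ 𝔸^x is continuous for the Hausdorff distance on nonempty compact subsets of H×ℝᵐ; (2) the family {𝔸^x : x ∈ K₀} is equi-attracting, i.e. for every ε > 0 and every bounded D ⊂ ℝᵐ there exists T = T(ε,D) > 0, independent of x, such that dist(π^x_τ(H×D), 𝔸^x) ≤ ε for every τ ≥ T and every x ∈ K₀. -/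
open Filter Topology Metric Set

/-- A set that is mapped into itself at all times in `[T, 2 * T]` is mapped into itself at all
times `τ ≥ T`. -/
theorem semiflow_mapsTo_of_mapsTo_Icc {Z : Type*} {φ : ℝ → Z → Z}
    (hadd : ∀ s t, 0 ≤ s → 0 ≤ t → ∀ z, φ (s + t) z = φ s (φ t z))
    {B : Set Z} {T : ℝ} (hT : 0 < T) (h : ∀ τ ∈ Icc T (2 * T), MapsTo (φ τ) B B) :
    ∀ τ ≥ T, MapsTo (φ τ) B B := by
  have key : ∀ k : ℕ, ∀ τ, T ≤ τ → τ ≤ (k + 2) * T → MapsTo (φ τ) B B := by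
    intro k
    induction k with
    | zero => intro τ h1 h2; exact h τ ⟨h1, by simpa using h2⟩
    | succ k ih =>
      intro τ h1 h2 z hz
      rcases le_or_gt τ (2 * T) with h3 | h3
      · exact h τ ⟨h1, h3⟩ hz
      · have := hadd T (τ - T) hT.le (by linarith) z
        rw [add_sub_cancel] at this
        rw [this]
        refine h T ⟨le_rfl, by linarith⟩ (ih (τ - T) (by linarith) ?_ hz)
        push_cast at h2
        linarith
  intro τ hτ
  obtain ⟨k, hk⟩ := exists_nat_ge (τ / T)
  refine key k τ hτ ?_
  rw [div_le_iff₀ hT] at hk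
  linarith

section SemiflowFamily

variable {X Z : Type*} [PseudoMetricSpace X] [PseudoMetricSpace Z]

/-- A jointly continuous family of semiflows depends on the parameter uniformly over compact sets
of times and initial states. -/
theorem exists_dist_lt_of_param_close {Φ : ℝ → X → Z → Z} {K : Set X} (hK : IsCompact K)
    (hΦ : ContinuousOn (fun p : ℝ × X × Z => Φ p.1 p.2.1 p.2.2) {p | 0 ≤ p.1 ∧ p.2.1 ∈ K})
    {C : Set Z} (hC : IsCompact C) (b : ℝ) {ε : ℝ} (hε : 0 < ε) :
    ∃ δ > 0, ∀ x ∈ K, ∀ x' ∈ K, dist x x' < δ → ∀ τ ∈ Icc 0 b, ∀ z ∈ C,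
      dist (Φ τ x z) (Φ τ x' z) < ε := by
  have hcomp : IsCompact (Icc 0 b ×ˢ K ×ˢ C) := isCompact_Icc.prod (hK.prod hC)
  have huc := hcomp.uniformContinuousOn_of_continuous
    (hΦ.mono fun p hp => ⟨hp.1.1, hp.2.1⟩)
  obtain ⟨δ, hδ, h⟩ := Metric.uniformContinuousOn_iff.1 huc ε hε
  refine ⟨δ, hδ, fun x hx x' hx' hd τ hτ z hz => ?_⟩
  refine h (τ, x, z) ⟨hτ, hx, hz⟩ (τ, x', z) ⟨hτ, hx', hz⟩ ?_
  simpa [Prod.dist_eq, hδ] using hd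

/-- If the attractors are uniformly bounded and vary continuously, attraction is locally uniform in
the parameter. -/
theorem eventually_attracts_of_tendsto_hausdorffDist [ProperSpace Z]
    {Φ : ℝ → X → Z → Z} {K : Set X} (hK : IsCompact K)
    (hΦ : ContinuousOn (fun p : ℝ × X × Z => Φ p.1 p.2.1 p.2.2) {p | 0 ≤ p.1 ∧ p.2.1 ∈ K})
    (hadd : ∀ x s t, 0 ≤ s → 0 ≤ t → ∀ z, Φ (s + t) x z = Φ s x (Φ t x z))
    {A : X → Set Z} (hne : ∀ x ∈ K, (A x).Nonempty)
    (hattr : ∀ x ∈ K, ∀ D : Set Z, Bornology.IsBounded D → ∀ ε > (0 : ℝ),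
      ∃ T : ℝ, ∀ τ ≥ T, ∀ z ∈ D, infDist (Φ τ x z) (A x) ≤ ε)
    {B₀ : Set Z} (hB₀ : Bornology.IsBounded B₀) (hsub : ∀ x ∈ K, A x ⊆ B₀)
    {x₀ : X} (hx₀ : x₀ ∈ K)
    (hcont : Tendsto (fun x => hausdorffDist (A x) (A x₀)) (𝓝[K] x₀) (𝓝 0))
    {ε : ℝ} (hε : 0 < ε) {D : Set Z} (hD : Bornology.IsBounded D) :
    ∃ T > (0 : ℝ), ∀ᶠ x in 𝓝[K] x₀, ∀ τ ≥ T, ∀ z ∈ D, infDist (Φ τ x z) (A x) ≤ ε := by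
  let B := cthickening 1 B₀
  have hB : IsCompact B := isCompact_of_isClosed_isBounded isClosed_cthickening hB₀.cthickening
  have hmemB : ∀ z w, infDist z (A x₀) ≤ 1 / 3 → dist w z < 1 / 3 → w ∈ B := by
    intro z w hz hw
    obtain ⟨a, ha, haz⟩ := (infDist_lt_iff (hne x₀ hx₀)).1
      (show infDist z (A x₀) < 2 / 3 by linarith)
    exact mem_cthickening_of_dist_le w a 1 B₀ (hsub x₀ hx₀ ha)
      (by linarith [dist_triangle w z a])
  have attr : ∀ C : Set Z, Bornology.IsBounded C → ∀ ε > (0 : ℝ),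
      ∃ T > 0, ∀ τ ≥ T, ∀ z ∈ C, infDist (Φ τ x₀ z) (A x₀) ≤ ε := by
    intro C hC ε hε
    obtain ⟨T, hT⟩ := hattr x₀ hx₀ C hC ε hε
    exact ⟨max T 1, by positivity, fun τ hτ => hT τ ((le_max_left _ _).trans hτ)⟩
  have close : ∀ C : Set Z, Bornology.IsBounded C → ∀ (b : ℝ) (ε : ℝ), 0 < ε →
      ∀ᶠ x in 𝓝[K] x₀, ∀ τ ∈ Icc 0 b, ∀ z ∈ C, dist (Φ τ x z) (Φ τ x₀ z) < ε := by
    intro C hC b ε hε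
    obtain ⟨δ, hδ, h⟩ := exists_dist_lt_of_param_close hK hΦ hC.isCompact_closure b hε
    filter_upwards [self_mem_nhdsWithin, mem_nhdsWithin_of_mem_nhds (ball_mem_nhds x₀ hδ)]
      with x hx hxδ τ hτ z hz
    exact h x hx x₀ hx₀ hxδ τ hτ z (subset_closure hz)
  obtain ⟨T₀, hT₀, h₀⟩ := attr B hB.isBounded (1 / 3) (by norm_num)
  obtain ⟨T₁, hT₁, h₁⟩ := attr D hD (1 / 3) (by norm_num)
  obtain ⟨T₂, hT₂, h₂⟩ := attr B hB.isBounded (ε / 3) (by positivity)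
  refine ⟨T₂ + (T₀ + T₁), by positivity, ?_⟩
  filter_upwards [self_mem_nhdsWithin, close B hB.isBounded (2 * T₀) (1 / 3) (by norm_num),
    close D hD T₁ (1 / 3) (by norm_num), close B hB.isBounded T₂ (ε / 3) (by positivity),
    hcont.eventually_lt_const (show 0 < ε / 3 by positivity)] with x hx c₀ c₁ c₂ hA τ hτ z hz
  have hmaps : ∀ τ ≥ T₀, MapsTo (Φ τ x) B B :=
    semiflow_mapsTo_of_mapsTo_Icc (hadd x) hT₀ fun τ hτ z hz =>
      hmemB _ _ (h₀ τ hτ.1 z hz) (c₀ τ ⟨hT₀.le.trans hτ.1, hτ.2⟩ z hz)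
  have hz₁ : Φ T₁ x z ∈ B := hmemB _ _ (h₁ T₁ le_rfl z hz) (c₁ T₁ ⟨hT₁.le, le_rfl⟩ z hz)
  have hz₂ : Φ (τ - T₂ - T₁) x (Φ T₁ x z) ∈ B := hmaps _ (by linarith) hz₁
  set w := Φ (τ - T₂ - T₁) x (Φ T₁ x z)
  have hw : Φ τ x z = Φ T₂ x w := by
    simp only [w]
    rw [← hadd x _ _ (by linarith) hT₁.le, ← hadd x _ _ hT₂.le (by linarith)]
    congr 1
    ring
  rw [hw]
  have hfin : Metric.hausdorffEDist (A x₀) (A x) ≠ ⊤ :=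
    hausdorffEDist_ne_top_of_nonempty_of_bounded (hne x₀ hx₀) (hne x hx)
      (hB₀.subset (hsub x₀ hx₀)) (hB₀.subset (hsub x hx))
  rw [hausdorffDist_comm] at hA
  have e₁ := infDist_le_infDist_add_hausdorffDist (x := Φ T₂ x w) hfin
  have e₂ := infDist_le_infDist_add_dist (s := A x₀) (x := Φ T₂ x w) (y := Φ T₂ x₀ w)
  have e₃ := h₂ T₂ le_rfl w hz₂
  have e₄ := c₂ T₂ ⟨hT₂.le, le_rfl⟩ w hz₂
  linarith

/-- Uniformly bounded, continuously varying attractors over a compact parameter set are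
equi-attracting. -/
theorem equiattracting_of_tendsto_hausdorffDist [ProperSpace Z]
    {Φ : ℝ → X → Z → Z} {K : Set X} (hK : IsCompact K)
    (hΦ : ContinuousOn (fun p : ℝ × X × Z => Φ p.1 p.2.1 p.2.2) {p | 0 ≤ p.1 ∧ p.2.1 ∈ K})
    (hadd : ∀ x s t, 0 ≤ s → 0 ≤ t → ∀ z, Φ (s + t) x z = Φ s x (Φ t x z))
    {A : X → Set Z} (hne : ∀ x ∈ K, (A x).Nonempty)
    (hattr : ∀ x ∈ K, ∀ D : Set Z, Bornology.IsBounded D → ∀ ε > (0 : ℝ),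
      ∃ T : ℝ, ∀ τ ≥ T, ∀ z ∈ D, infDist (Φ τ x z) (A x) ≤ ε)
    {B₀ : Set Z} (hB₀ : Bornology.IsBounded B₀) (hsub : ∀ x ∈ K, A x ⊆ B₀)
    (hcont : ∀ x₀ ∈ K, Tendsto (fun x => hausdorffDist (A x) (A x₀)) (𝓝[K] x₀) (𝓝 0))
    {ε : ℝ} (hε : 0 < ε) {D : Set Z} (hD : Bornology.IsBounded D) :
    ∃ T > (0 : ℝ), ∀ τ ≥ T, ∀ x ∈ K, ∀ z ∈ D, infDist (Φ τ x z) (A x) ≤ ε := by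
  refine hK.induction_on
    (p := fun S => ∃ T > (0 : ℝ), ∀ τ ≥ T, ∀ x ∈ S, ∀ z ∈ D, infDist (Φ τ x z) (A x) ≤ ε)
    ⟨1, one_pos, by simp⟩ ?_ ?_ ?_
  · rintro S S' hS ⟨T, hT, h⟩
    exact ⟨T, hT, fun τ hτ x hx => h τ hτ x (hS hx)⟩
  · rintro S S' ⟨T, hT, h⟩ ⟨T', hT', h'⟩
    refine ⟨max T T', lt_max_of_lt_left hT, fun τ hτ x hx => ?_⟩
    rcases hx with hx | hx
    · exact h τ ((le_max_left _ _).trans hτ) x hx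
    · exact h' τ ((le_max_right _ _).trans hτ) x hx
  · intro x₀ hx₀
    obtain ⟨T, hT, h⟩ := eventually_attracts_of_tendsto_hausdorffDist hK hΦ hadd hne hattr hB₀ hsub
      hx₀ (hcont x₀ hx₀) hε hD
    exact ⟨_, h, T, hT, fun τ hτ x hx => hx τ hτ⟩

/-- Uniformly bounded, invariant, equi-attracting sets vary continuously with the parameter. -/
theorem tendsto_hausdorffDist_of_equiattracting [ProperSpace Z]
    {Φ : ℝ → X → Z → Z} {K : Set X} (hK : IsCompact K)
    (hΦ : ContinuousOn (fun p : ℝ × X × Z => Φ p.1 p.2.1 p.2.2) {p | 0 ≤ p.1 ∧ p.2.1 ∈ K})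
    {A : X → Set Z} (hne : ∀ x ∈ K, (A x).Nonempty)
    (hinv : ∀ x ∈ K, ∀ τ, 0 ≤ τ → Φ τ x '' A x = A x)
    {B₀ : Set Z} (hB₀ : Bornology.IsBounded B₀) (hsub : ∀ x ∈ K, A x ⊆ B₀)
    (hequi : ∀ ε > (0 : ℝ), ∃ T > (0 : ℝ), ∀ τ ≥ T, ∀ x ∈ K, ∀ z ∈ B₀,
      infDist (Φ τ x z) (A x) ≤ ε)
    {x₀ : X} (hx₀ : x₀ ∈ K) :
    Tendsto (fun x => hausdorffDist (A x) (A x₀)) (𝓝[K] x₀) (𝓝 0) := by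
  rw [Metric.tendsto_nhds]
  intro ε hε
  obtain ⟨T, hT, hatt⟩ := hequi (ε / 4) (by positivity)
  obtain ⟨δ, hδ, h⟩ := exists_dist_lt_of_param_close hK hΦ hB₀.isCompact_closure T
    (show 0 < ε / 4 by positivity)
  have semi : ∀ x ∈ K, ∀ x' ∈ K, dist x x' < δ → ∀ p ∈ A x, ∃ q ∈ A x', dist p q ≤ 3 * ε / 4 := by
    intro x hx x' hx' hd p hp
    rw [← hinv x hx T hT.le] at hp
    obtain ⟨z, hz, rfl⟩ := hp
    have hzB := hsub x hx hz
    obtain ⟨q, hq, hdq⟩ := (infDist_lt_iff (hne x' hx')).1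
      ((hatt T le_rfl x' hx' z hzB).trans_lt (show ε / 4 < ε / 2 by linarith))
    have := h x hx x' hx' hd T ⟨hT.le, le_rfl⟩ z (subset_closure hzB)
    exact ⟨q, hq, by linarith [dist_triangle (Φ T x z) (Φ T x' z) q]⟩
  filter_upwards [self_mem_nhdsWithin, mem_nhdsWithin_of_mem_nhds (ball_mem_nhds x₀ hδ)]
    with x hx hxδ
  rw [Real.dist_0_eq_abs, abs_of_nonneg hausdorffDist_nonneg]
  have hle : hausdorffDist (A x) (A x₀) ≤ 3 * ε / 4 :=
    hausdorffDist_le_of_mem_dist (by positivity) (semi x hx x₀ hx₀ hxδ)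
      (semi x₀ hx₀ x hx (by rwa [dist_comm]))
  linarith

end SemiflowFamily

/-- equivalence between continuity of x ↦ 𝔸ˣ for the Hausdorff
distance and equi-attraction of the family {𝔸ˣ : x ∈ K₀}. -/
theorem stmt_7 {n m : ℕ}
    (H : Type) [MetricSpace H] [CompactSpace H]
    (σf : ℝ → H → H)
    (hσcont : Continuous fun p : ℝ × H => σf p.1 p.2)
    (hσ0 : ∀ h, σf 0 h = h)
    (hσadd : ∀ s t : ℝ, ∀ h, σf (s + t) h = σf s (σf t h))
    (K₀ : Set (EuclideanSpace ℝ (Fin n))) (hK₀ : IsCompact K₀)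
    (u : ℝ → H → EuclideanSpace ℝ (Fin n) → EuclideanSpace ℝ (Fin m) →
      EuclideanSpace ℝ (Fin m))
    (hucont : ContinuousOn
      (fun p : ℝ × H × EuclideanSpace ℝ (Fin n) × EuclideanSpace ℝ (Fin m) =>
        u p.1 p.2.1 p.2.2.1 p.2.2.2) {p | 0 ≤ p.1 ∧ p.2.2.1 ∈ K₀})
    (hu0 : ∀ h x y, u 0 h x y = y)
    (hucoc : ∀ τ₁ τ₂ : ℝ, 0 ≤ τ₁ → 0 ≤ τ₂ → ∀ h x y,
      u (τ₁ + τ₂) h x y = u τ₁ (σf τ₂ h) x (u τ₂ h x y))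
    -- for each x ∈ K₀, 𝔸ˣ is a global attractor for πˣ
    (𝔸x : EuclideanSpace ℝ (Fin n) → Set (H × EuclideanSpace ℝ (Fin m)))
    (h𝔸xne : ∀ x ∈ K₀, (𝔸x x).Nonempty) (h𝔸xc : ∀ x ∈ K₀, IsCompact (𝔸x x))
    (h𝔸xinv : ∀ x ∈ K₀, ∀ τ : ℝ, 0 ≤ τ →
      (fun p : H × EuclideanSpace ℝ (Fin m) => (σf τ p.1, u τ p.1 x p.2)) '' 𝔸x x = 𝔸x x)
    (h𝔸xattr : ∀ x ∈ K₀, ∀ D : Set (EuclideanSpace ℝ (Fin m)), Bornology.IsBounded D →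
      ∀ ε > (0:ℝ), ∃ T : ℝ, ∀ τ ≥ T, ∀ h y₀, y₀ ∈ D →
        Metric.infDist ((σf τ h, u τ h x y₀) : H × EuclideanSpace ℝ (Fin m)) (𝔸x x) ≤ ε)
    -- uniform bound on the attractors
    (ρ : ℝ) (hρ : 0 < ρ)
    (hbound : ∀ x ∈ K₀, ∀ p ∈ 𝔸x x, ‖p.2‖ ≤ ρ) :
    -- (1) continuity ↔ (2) equi-attraction
    ((∀ x ∈ K₀,
        Tendsto (fun x' => Metric.hausdorffDist (𝔸x x') (𝔸x x)) (𝓝[K₀] x) (𝓝 0)) ↔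
      (∀ ε > (0:ℝ), ∀ D : Set (EuclideanSpace ℝ (Fin m)), Bornology.IsBounded D →
        ∃ T > (0:ℝ), ∀ τ ≥ T, ∀ x ∈ K₀, ∀ h y₀, y₀ ∈ D →
          Metric.infDist ((σf τ h, u τ h x y₀) : H × EuclideanSpace ℝ (Fin m)) (𝔸x x) ≤ ε)) := by
  let E := EuclideanSpace ℝ (Fin n)
  let F := EuclideanSpace ℝ (Fin m)
  let Φ : ℝ → E → H × F → H × F := fun τ x p => (σf τ p.1, u τ p.1 x p.2)
  have hΦ : ContinuousOn (fun p : ℝ × E × H × F => Φ p.1 p.2.1 p.2.2)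
      {p | 0 ≤ p.1 ∧ p.2.1 ∈ K₀} := by
    refine ContinuousOn.prodMk (hσcont.comp (by fun_prop :
      Continuous fun p : ℝ × E × H × F => (p.1, p.2.2.1))).continuousOn ?_
    exact hucont.comp (by fun_prop :
      Continuous fun p : ℝ × E × H × F => (p.1, p.2.2.1, p.2.1, p.2.2.2)).continuousOn
      fun p hp => hp
  have hadd : ∀ x s t, 0 ≤ s → 0 ≤ t → ∀ z, Φ (s + t) x z = Φ s x (Φ t x z) :=
    fun x s t hs ht z => Prod.ext (hσadd s t z.1) (hucoc s t hs ht z.1 x z.2)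
  have hbdd : ∀ D : Set F, Bornology.IsBounded D →
      Bornology.IsBounded ((univ : Set H) ×ˢ D) :=
    fun D hD => isCompact_univ.isBounded.prod hD
  have hB₀ := hbdd (closedBall 0 ρ) isBounded_closedBall
  have hsub : ∀ x ∈ K₀, 𝔸x x ⊆ (univ : Set H) ×ˢ closedBall (0 : F) ρ :=
    fun x hx p hp => ⟨mem_univ _, by simpa using hbound x hx p hp⟩
  constructor
  · intro hcont ε hε D hD
    have hattr : ∀ x ∈ K₀, ∀ D : Set (H × F), Bornology.IsBounded D → ∀ ε > (0 : ℝ),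
        ∃ T : ℝ, ∀ τ ≥ T, ∀ z ∈ D, infDist (Φ τ x z) (𝔸x x) ≤ ε := by
      intro x hx D hD ε hε
      obtain ⟨T, hT⟩ := h𝔸xattr x hx (Prod.snd '' D) hD.image_snd ε hε
      exact ⟨T, fun τ hτ z hz => hT τ hτ z.1 z.2 (mem_image_of_mem _ hz)⟩
    obtain ⟨T, hT, h⟩ := equiattracting_of_tendsto_hausdorffDist hK₀ hΦ hadd h𝔸xne hattr hB₀ hsub
      hcont hε (hbdd D hD)
    exact ⟨T, hT, fun τ hτ x hx y y₀ hy => h τ hτ x hx (y, y₀) ⟨mem_univ _, hy⟩⟩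
  · intro hequi x₀ hx₀
    refine tendsto_hausdorffDist_of_equiattracting hK₀ hΦ h𝔸xne h𝔸xinv hB₀ hsub ?_ hx₀
    intro ε hε
    obtain ⟨T, hT, h⟩ := hequi ε hε (closedBall 0 ρ) isBounded_closedBall
    exact ⟨T, hT, fun τ hτ x hx z hz => h τ hτ x hx z.1 z.2 hz.2⟩
end

section
/- Given δ > 0, there exist T > 0 and an index k₀ with 2T < t₀/ε_{k₀} such that for every k ≥ k₀ and every τ ∈ [T, t₀/ε_k], dist(y_{ε_k}(τ), A_{(g·τ, x₀(ε_kτ))}[δ]) ≤ δ. -/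
open Filter Topology Metric Set

section ParametricODE

variable {P E : Type*} [PseudoMetricSpace P] [NormedAddCommGroup E] [NormedSpace ℝ E]

/-- A Gronwall estimate in which only the reference solution is known to stay in a ball on which
the vector field is Lipschitz. -/
theorem exists_dist_lt_of_approx_solution {G : ℝ → E → E} {z : ℝ → E} {T R η : ℝ} {L : NNReal}
    (hT : 0 ≤ T) (hL : ∀ t ∈ Icc 0 T, LipschitzOnWith L (G t) (closedBall 0 (R + η)))
    (hz : ∀ t ∈ Icc 0 T, HasDerivAt z (G t (z t)) t) (hzR : ∀ t ∈ Icc 0 T, ‖z t‖ ≤ R)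
    (hη : 0 < η) :
    ∃ ρ > 0, ∀ (w : ℝ → E) (G' : ℝ → E → E), (∀ t ∈ Icc 0 T, HasDerivAt w (G' t (w t)) t) →
      dist (w 0) (z 0) ≤ ρ →
      (∀ t ∈ Icc 0 T, ∀ y ∈ closedBall (0 : E) (R + η), dist (G' t y) (G t y) ≤ ρ) →
      ∀ t ∈ Icc 0 T, dist (w t) (z t) < η := by
  set B := gronwallBound 1 L 1 T with hB
  have hB1 : 1 ≤ B := by
    have := gronwallBound_mono (δ := 1) (K := L) (ε := 1) zero_le_one zero_le_one L.coe_nonneg hT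
    rwa [gronwallBound_x0] at this
  have hscale : ∀ ρ : ℝ, gronwallBound ρ L ρ T = ρ * B := by
    intro ρ
    rw [hB]
    unfold gronwallBound
    split_ifs <;> ring
  refine ⟨η / (2 * B), by positivity, fun w G' hw hw0 hG' => ?_⟩
  set ρ := η / (2 * B) with hρ
  have hρ0 : 0 < ρ := by positivity
  have hρB : ρ * B < η := by
    rw [hρ]
    field_simp
    norm_num
  by_contra! hcon
  have hcw : ContinuousOn w (Icc 0 T) := fun t ht => (hw t ht).continuousAt.continuousWithinAt
  have hcz : ContinuousOn z (Icc 0 T) := fun t ht => (hz t ht).continuousAt.continuousWithinAt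
  set S := {t ∈ Icc 0 T | η ≤ dist (w t) (z t)} with hS
  have hSc : IsClosed S := by
    have := (continuous_dist.comp_continuousOn (hcw.prodMk hcz)).preimage_isClosed_of_isClosed
      isClosed_Icc (isClosed_Ici (a := η))
    exact this
  have hScpt : IsCompact S := isCompact_Icc.of_isClosed_subset hSc fun t ht => ht.1
  obtain ⟨t, ht⟩ := hScpt.exists_isLeast (by obtain ⟨t, ht, h⟩ := hcon; exact ⟨t, ht, h⟩)
  have htT : t ∈ Icc 0 T := ht.1.1
  have hsub : ∀ s ∈ Ico 0 t, s ∈ Icc 0 T := fun s hs => ⟨hs.1, hs.2.le.trans htT.2⟩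
  have hlt : ∀ s ∈ Ico 0 t, dist (w s) (z s) < η := fun s hs => by
    by_contra! h
    exact absurd (ht.2 ⟨hsub s hs, h⟩) (not_le.2 hs.2)
  have hwball : ∀ s ∈ Ico 0 t, w s ∈ closedBall (0 : E) (R + η) := fun s hs => by
    rw [mem_closedBall_zero_iff]
    have h1 := hlt s hs
    have h2 := hzR s (hsub s hs)
    rw [dist_eq_norm] at h1
    linarith [norm_le_norm_add_norm_sub' (w s) (z s)]
  have hIcc : Icc 0 t ⊆ Icc 0 T := Icc_subset_Icc_right htT.2
  have key := dist_le_of_approx_trajectories_ODE_of_mem (v := G) (K := L)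
    (s := fun _ => closedBall (0 : E) (R + η)) (f := w) (g := z) (εf := ρ) (εg := 0) (δ := ρ)
    (a := 0) (b := t) (fun s hs => hL s (hsub s hs)) (hcw.mono hIcc)
    (fun s hs => (hw s (hsub s hs)).hasDerivWithinAt)
    (fun s hs => hG' s (hsub s hs) _ (hwball s hs)) hwball (hcz.mono hIcc)
    (fun s hs => (hz s (hsub s hs)).hasDerivWithinAt) (fun s _ => (dist_self _).le)
    (fun s hs => by
      rw [mem_closedBall_zero_iff]
      linarith [hzR s (hsub s hs)]) hw0 t ⟨htT.1, le_rfl⟩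
  rw [add_zero, sub_zero] at key
  have hmono := gronwallBound_mono hρ0.le hρ0.le L.coe_nonneg htT.2
  have h3 : η ≤ dist (w t) (z t) := ht.1.2
  have := hscale ρ
  linarith

/-- Continuous dependence: solutions with slowly varying parameters converge, uniformly on compact
time intervals, to the solution for the limit parameter. -/
theorem eventually_dist_solution_lt [ProperSpace E] {F : P → E × ℝ → E}
    (hF : Continuous (Function.uncurry F)) {p : P}
    (hLip : ∀ R, ∃ L : NNReal, ∀ t, LipschitzOnWith L (fun y => F p (y, t)) (closedBall 0 R))
    {ι : Type*} {l : Filter ι} {q : ι → ℝ → P} {w : ι → ℝ → E} {z : ℝ → E} {T : ℝ} (hT : 0 ≤ T)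
    (hq : ∀ η > 0, ∀ᶠ j in l, ∀ s ∈ Icc 0 T, dist (q j s) p < η)
    (hz : ∀ t ∈ Icc 0 T, HasDerivAt z (F p (z t, t)) t)
    (hw : ∀ j, ∀ t ∈ Icc 0 T, HasDerivAt (w j) (F (q j t) (w j t, t)) t)
    (hw0 : Tendsto (fun j => w j 0) l (𝓝 (z 0))) {η : ℝ} (hη : 0 < η) :
    ∀ᶠ j in l, ∀ t ∈ Icc 0 T, dist (w j t) (z t) < η := by
  have hcz : ContinuousOn z (Icc 0 T) := fun t ht => (hz t ht).continuousAt.continuousWithinAt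
  obtain ⟨R, hR⟩ := isCompact_Icc.exists_bound_of_continuousOn hcz
  obtain ⟨L, hL⟩ := hLip (R + η)
  obtain ⟨ρ, hρ, H⟩ := exists_dist_lt_of_approx_solution (G := fun t y => F p (y, t)) hT
    (fun t _ => hL t) hz hR hη
  obtain ⟨v, hv, hvF⟩ := ((isCompact_closedBall (0 : E) (R + η)).prod
    (isCompact_Icc (a := (0 : ℝ)) (b := T))).mem_uniformity_of_prod (s := univ) (q := p)
    hF.continuousOn (mem_univ p) (Metric.dist_mem_uniformity hρ)
  rw [nhdsWithin_univ] at hv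
  obtain ⟨θ, hθ, hθv⟩ := Metric.mem_nhds_iff.1 hv
  filter_upwards [hq θ hθ, hw0 (Metric.closedBall_mem_nhds _ hρ)] with j hj hj0
  exact H (w j) (fun t y => F (q j t) (y, t)) (hw j) hj0 fun t ht y hy =>
    (hvF _ (hθv (hj t ht)) (y, t) ⟨hy, ht⟩).le

/-- A pointwise limit of bounded solutions, whose parameters converge locally uniformly in time,
solves the limit equation. -/
theorem hasDerivAt_of_tendsto_solutions [ProperSpace E] {F : P → E × ℝ → E}
    (hF : Continuous (Function.uncurry F)) {p : P} {ι : Type*} {l : Filter ι} [NeBot l]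
    {q : ι → ℝ → P} {w : ι → ℝ → E} {z : ℝ → E} {s R : ℝ}
    (hq : ∀ η > 0, ∀ᶠ j in l, ∀ u ∈ ball s 1, dist (q j u) p < η)
    (hw : ∀ᶠ j in l, ∀ u ∈ ball s 1, HasDerivAt (w j) (F (q j u) (w j u, u)) u)
    (hR : ∀ᶠ j in l, ∀ u ∈ ball s 1, ‖w j u‖ ≤ R)
    (hwz : ∀ u, Tendsto (fun j => w j u) l (𝓝 (z u))) :
    HasDerivAt z (F p (z s, s)) s := by
  have hcpt := (isCompact_closedBall (0 : E) R).prod (isCompact_closedBall s 1)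
  obtain ⟨M, hM⟩ := hcpt.exists_bound_of_continuousOn (f := F p)
    (hF.comp (Continuous.prodMk_right p)).continuousOn
  obtain ⟨v, hv, hvF⟩ := hcpt.mem_uniformity_of_prod (s := univ) (q := p)
    hF.continuousOn (mem_univ p) (Metric.dist_mem_uniformity one_pos)
  rw [nhdsWithin_univ] at hv
  obtain ⟨θ, hθ, hθv⟩ := Metric.mem_nhds_iff.1 hv
  have hderiv : ∀ᶠ j in l, ∀ u ∈ ball s 1, ‖F (q j u) (w j u, u)‖ ≤ |M| + 1 := by
    filter_upwards [hq θ hθ, hR] with j hj hjR u hu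
    have hmem : (w j u, u) ∈ closedBall (0 : E) R ×ˢ closedBall s 1 :=
      ⟨mem_closedBall_zero_iff.2 (hjR u hu), ball_subset_closedBall hu⟩
    have h1 : dist (F (q j u) (w j u, u)) (F p (w j u, u)) < 1 := hvF _ (hθv (hj u hu)) _ hmem
    have h2 := hM _ hmem
    rw [dist_eq_norm] at h1
    linarith [norm_le_norm_add_norm_sub' (F (q j u) (w j u, u)) (F p (w j u, u)), le_abs_self M]
  set N := |M| + 1 with hN
  have hN0 : 0 < N := by positivity
  rw [hasDerivAt_iff_isLittleO, Asymptotics.isLittleO_iff]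
  intro c hc
  obtain ⟨ρ, hρ, hFρ⟩ := Metric.continuousAt_iff.1 (hF.continuousAt (x := (p, z s, s))) c hc
  set r := min 1 (ρ / (2 * (N + 1))) with hr
  have hr0 : 0 < r := by positivity
  have hr1 : r ≤ 1 := min_le_left _ _
  have hrρ : (N + 1) * r ≤ ρ / 2 := by
    have : r ≤ ρ / (2 * (N + 1)) := min_le_right _ _
    calc (N + 1) * r ≤ (N + 1) * (ρ / (2 * (N + 1))) := by gcongr
      _ = ρ / 2 := by field_simp
  filter_upwards [Metric.ball_mem_nhds s hr0] with u hu
  have hlim : Tendsto (fun j => ‖w j u - w j s - (u - s) • F p (z s, s)‖) l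
      (𝓝 ‖z u - z s - (u - s) • F p (z s, s)‖) :=
    (((hwz u).sub (hwz s)).sub_const _).norm
  refine le_of_tendsto hlim ?_
  filter_upwards [hderiv, hw, hq ρ hρ, hwz s (Metric.ball_mem_nhds _ (half_pos hρ))]
    with j hjd hjw hjq hjs
  have hs : s ∈ ball s r := mem_ball_self hr0
  have hsub : ball s r ⊆ ball s 1 := ball_subset_ball hr1
  have hclose : ∀ x ∈ ball s r, dist (F (q j x) (w j x, x)) (F p (z s, s)) < c := by
    intro x hx
    have hlip := Convex.norm_image_sub_le_of_norm_hasDerivWithin_le (f := w j)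
      (fun y hy => (hjw y (hsub hy)).hasDerivWithinAt) (fun y hy => hjd y (hsub hy))
      (convex_ball s r) hs hx
    have hxr : dist x s < r := hx
    have h1 : dist (w j x) (z s) < ρ := by
      have h2 : dist (w j s) (z s) < ρ / 2 := hjs
      have h3 : dist (w j x) (w j s) ≤ N * r := by
        rw [dist_eq_norm]
        refine hlip.trans ?_
        rw [← dist_eq_norm]
        gcongr
      linarith [dist_triangle (w j x) (w j s) (z s)]
    have h4 : dist x s < ρ := by nlinarith
    exact hFρ (x := (q j x, w j x, x)) (max_lt (hjq x (hsub hx)) (max_lt h1 h4))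
  have hmv := Convex.norm_image_sub_le_of_norm_hasDerivWithin_le
    (f := fun x => w j x - (x - s) • F p (z s, s))
    (f' := fun x => F (q j x) (w j x, x) - (1 : ℝ) • F p (z s, s)) (s := ball s r) (C := c)
    (fun x hx => ((hjw x (hsub hx)).sub
      (((hasDerivAt_id x).sub_const s).smul_const _)).hasDerivWithinAt)
    (fun x hx => by
      rw [one_smul, ← dist_eq_norm]
      exact (hclose x hx).le) (convex_ball s r) hs hu
  refine le_trans (le_of_eq ?_) hmv
  congr 1
  simp only [sub_self, zero_smul]
  abel

end ParametricODE

theorem HasDerivAt.ite_le {E : Type*} [NormedAddCommGroup E] [NormedSpace ℝ E] {u v : ℝ → E}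
    {d : E} {a : ℝ} (hu : HasDerivAt u d a) (hv : HasDerivAt v d a) (huv : u a = v a) :
    HasDerivAt (fun t => if t ≤ a then u t else v t) d a := by
  have h1 : HasDerivWithinAt (fun t => if t ≤ a then u t else v t) d (Iic a) a :=
    hu.hasDerivWithinAt.congr (fun t ht => if_pos ht) (if_pos le_rfl)
  have h2 : HasDerivWithinAt (fun t => if t ≤ a then u t else v t) d (Ici a) a := by
    refine hv.hasDerivWithinAt.congr (fun t ht => ?_) ((if_pos le_rfl).trans huv)
    rcases (show a ≤ t from ht).eq_or_lt with rfl | h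
    · exact (if_pos le_rfl).trans huv
    · exact if_neg (not_le.2 h)
  rw [← hasDerivWithinAt_univ, ← Iic_union_Ici (a := a)]
  exact h1.union h2

/-- Along every sequence of indices tending to infinity and every sequence of base times, the
curves `X k` become constant, with value in `C`, on compact windows around the base times. -/
def AsymptoticallyFrozen {V : Type*} [PseudoMetricSpace V] (X : ℕ → ℝ → V) (C : Set V) : Prop :=
  ∀ (κ : ℕ → ℕ) (τ : ℕ → ℝ), Tendsto κ atTop atTop → ∃ x ∈ C, ∀ S, ∀ η > 0,
    ∀ᶠ j in (hyperfilter ℕ : Filter ℕ), ∀ s, |s| ≤ S → dist (X (κ j) (τ j + s)) x < η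

theorem asymptoticallyFrozen_of_tendstoUniformlyOn {V : Type*} [PseudoMetricSpace V] {t₀ : ℝ}
    (ht₀ : 0 ≤ t₀) {ε : ℕ → ℝ} (hεlim : Tendsto ε atTop (𝓝 0)) {xe : ℕ → ℝ → V} {x0 : ℝ → V}
    (hx0 : ContinuousOn x0 (Icc 0 t₀))
    (hconv : TendstoUniformlyOn (fun k t => xe k (t / ε k)) x0 atTop (Icc 0 t₀)) :
    AsymptoticallyFrozen (fun k τ => xe k (projIcc 0 t₀ ht₀ (ε k * τ) / ε k))
      (x0 '' Icc 0 t₀) := by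
  intro κ τ hκ
  have hκU : Tendsto κ (hyperfilter ℕ) atTop := hκ.mono_left Nat.hyperfilter_le_atTop
  obtain ⟨t, ht, htlim⟩ := (isCompact_Icc (a := (0 : ℝ)) (b := t₀)).ultrafilter_le_nhds'
    ((hyperfilter ℕ).map fun j => (projIcc 0 t₀ ht₀ (ε (κ j) * τ j) : ℝ))
    (Ultrafilter.mem_map.2 (univ_mem' fun j => (projIcc 0 t₀ ht₀ (ε (κ j) * τ j)).2))
  have htlim' : Tendsto (fun j => (projIcc 0 t₀ ht₀ (ε (κ j) * τ j) : ℝ)) (hyperfilter ℕ)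
    (𝓝 t) := htlim
  refine ⟨x0 t, mem_image_of_mem _ ht, fun S η hη => ?_⟩
  obtain ⟨ρ, hρ, hx0ρ⟩ := Metric.continuousOn_iff.1 hx0 t ht (η / 2) (half_pos hη)
  have hεS : Tendsto (fun j => |ε (κ j)| * S) (hyperfilter ℕ) (𝓝 0) := by
    simpa using ((hεlim.comp hκU).abs).mul_const S
  filter_upwards [htlim' (Metric.ball_mem_nhds _ (half_pos hρ)),
    hεS.eventually (gt_mem_nhds (half_pos hρ)),
    hκU.eventually (Metric.tendstoUniformlyOn_iff.1 hconv (η / 2) (half_pos hη))]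
    with j hj1 hj2 hj3 s hs
  set t' := projIcc 0 t₀ ht₀ (ε (κ j) * (τ j + s)) with ht'
  have hproj : |(t' : ℝ) - projIcc 0 t₀ ht₀ (ε (κ j) * τ j)| ≤ |ε (κ j)| * S := by
    refine (abs_projIcc_sub_projIcc ht₀).trans ?_
    rw [← mul_sub, add_sub_cancel_left, abs_mul]
    gcongr
  have hdist : dist (t' : ℝ) t < ρ := by
    have h1 : dist (projIcc 0 t₀ ht₀ (ε (κ j) * τ j) : ℝ) t < ρ / 2 := hj1
    rw [← Real.dist_eq] at hproj
    linarith [dist_triangle (t' : ℝ) (projIcc 0 t₀ ht₀ (ε (κ j) * τ j)) t]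
  have h1 := hx0ρ t' t'.2 hdist
  have h2 := hj3 t' t'.2
  rw [dist_comm] at h2
  linarith [dist_triangle (xe (κ j) (t' / ε (κ j))) (x0 t') (x0 t)]

section Hull

variable {n m : ℕ}
  {g : C(EuclideanSpace ℝ (Fin n) × EuclideanSpace ℝ (Fin m) × ℝ, EuclideanSpace ℝ (Fin m))}
  {H : Type*} {σf : ℝ → H → H}
  {ev : H → C(EuclideanSpace ℝ (Fin n) × EuclideanSpace ℝ (Fin m) × ℝ,
    EuclideanSpace ℝ (Fin m))} {g0 : H}

/-- Every map in the hull inherits the Lipschitz bounds of `g`. -/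
theorem exists_lipschitzOnWith_of_mem_hull (hlip : IsLipschitzInY g)
    (hrange : range ev ⊆ closure {h | ∃ s : ℝ, h = timeTranslate s g}) (h : H)
    (x : EuclideanSpace ℝ (Fin n)) (R : ℝ) :
    ∃ L : NNReal, ∀ t, LipschitzOnWith L (fun y => ev h (x, y, t)) (closedBall 0 R) := by
  obtain ⟨L, hL, hgL⟩ := hlip {x} isCompact_singleton (closedBall 0 R) (isCompact_closedBall _ _)
  refine ⟨⟨L, hL.le⟩, fun t => LipschitzOnWith.of_dist_le_mul fun y₁ h₁ y₂ h₂ => ?_⟩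
  have hclosed : IsClosed {φ : C(EuclideanSpace ℝ (Fin n) × EuclideanSpace ℝ (Fin m) × ℝ,
      EuclideanSpace ℝ (Fin m)) | dist (φ (x, y₁, t)) (φ (x, y₂, t)) ≤ L * dist y₁ y₂} :=
    isClosed_le ((continuous_eval_const _).dist (continuous_eval_const _)) continuous_const
  refine closure_minimal ?_ hclosed (hrange (mem_range_self h))
  rintro _ ⟨s, rfl⟩
  simp only [mem_ofPred_eq, dist_eq_norm]
  exact hgL x rfl y₁ h₁ y₂ h₂ (t + s)

theorem hasDerivAt_comp_const_add_hull (hg0 : ev g0 = g)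
    (hequiv : ∀ (s : ℝ) (h : H), ev (σf s h) = timeTranslate s (ev h))
    {Y : ℝ → EuclideanSpace ℝ (Fin m)} {x : EuclideanSpace ℝ (Fin n)} {τ s : ℝ}
    (hY : HasDerivAt Y (g (x, Y (τ + s), τ + s)) (τ + s)) :
    HasDerivAt (fun u => Y (τ + u)) (ev (σf τ g0) (x, Y (τ + s), s)) s := by
  have := hY.comp_const_add τ s
  rw [hequiv, hg0]
  change HasDerivAt _ (g (x, Y (τ + s), s + τ)) s
  rwa [add_comm s τ]

variable [MetricSpace H]

theorem continuous_uncurry_hull (hev : Continuous ev) :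
    Continuous (Function.uncurry fun (p : H × EuclideanSpace ℝ (Fin n))
      (q : EuclideanSpace ℝ (Fin m) × ℝ) => ev p.1 (p.2, q)) :=
  Continuous.eval (hev.comp (by fun_prop)) (by fun_prop)

/-- Solutions of the `g`-equation with nearly constant slow components, started at times along which
the translates of `g0` converge to `h`, converge to the solution of the limit equation. -/
theorem eventually_dist_hull_solution_lt (hlip : IsLipschitzInY g) (hev : Continuous ev)
    (hrange : range ev ⊆ closure {h | ∃ s : ℝ, h = timeTranslate s g}) (hg0 : ev g0 = g)
    (hequiv : ∀ (s : ℝ) (h : H), ev (σf s h) = timeTranslate s (ev h))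
    {ι : Type*} {l : Filter ι} {τ : ι → ℝ} {h : H}
    (hh : Tendsto (fun j => σf (τ j) g0) l (𝓝 h)) {T : ℝ} (hT : 0 ≤ T)
    {x : EuclideanSpace ℝ (Fin n)} {Xs : ι → ℝ → EuclideanSpace ℝ (Fin n)}
    (hx : ∀ η > 0, ∀ᶠ j in l, ∀ s ∈ Icc 0 T, dist (Xs j s) x < η)
    {z : ℝ → EuclideanSpace ℝ (Fin m)}
    (hz : ∀ t ∈ Icc 0 T, HasDerivAt z (ev h (x, z t, t)) t)
    {w : ι → ℝ → EuclideanSpace ℝ (Fin m)}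
    (hw : ∀ j, ∀ s ∈ Icc 0 T,
      HasDerivAt (w j) (g (Xs j s, w j (τ j + s), τ j + s)) (τ j + s))
    (hw0 : Tendsto (fun j => w j (τ j)) l (𝓝 (z 0))) {η : ℝ} (hη : 0 < η) :
    ∀ᶠ j in l, ∀ t ∈ Icc 0 T, dist (w j (τ j + t)) (z t) < η :=
  eventually_dist_solution_lt (continuous_uncurry_hull hev) (p := (h, x))
    (exists_lipschitzOnWith_of_mem_hull hlip hrange h x)
    (q := fun j s => (σf (τ j) g0, Xs j s)) (w := fun j s => w j (τ j + s)) hT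
    (fun η hη => by
      filter_upwards [hh (Metric.ball_mem_nhds h hη), hx η hη] with j h1 h2 s hs
      exact max_lt h1 (h2 s hs)) hz
    (fun j t ht => hasDerivAt_comp_const_add_hull hg0 hequiv (hw j t ht))
    (by simpa using hw0) hη

variable [CompactSpace H]

/-- If the frozen equations are uniformly ultimately bounded, then so are the solutions with
asymptotically frozen slow components. -/
theorem exists_norm_le_of_asymptoticallyFrozen (hlip : IsLipschitzInY g) (hev : Continuous ev)
    (hrange : range ev ⊆ closure {h | ∃ s : ℝ, h = timeTranslate s g}) (hg0 : ev g0 = g)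
    (hequiv : ∀ (s : ℝ) (h : H), ev (σf s h) = timeTranslate s (ev h))
    {sol : H → EuclideanSpace ℝ (Fin n) → ℝ → EuclideanSpace ℝ (Fin m) → ℝ →
      EuclideanSpace ℝ (Fin m)}
    (hsolinit : ∀ h x τ₀ y₀, sol h x τ₀ y₀ τ₀ = y₀)
    (hsolode : ∀ h x (τ₀ : ℝ) y₀ (τ : ℝ), τ₀ ≤ τ →
      HasDerivAt (sol h x τ₀ y₀) (ev h (x, sol h x τ₀ y₀ τ, τ)) τ)
    {C : Set (EuclideanSpace ℝ (Fin n))}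
    (hC : ∃ c > (0:ℝ), ∀ d > (0:ℝ), ∃ T > (0:ℝ), ∀ x ∈ C, ∀ τ₀ : ℝ, ∀ τ ≥ T,
        ∀ y₀ : EuclideanSpace ℝ (Fin m), ‖y₀‖ ≤ d → ‖sol g0 x τ₀ y₀ (τ + τ₀)‖ ≤ c)
    {X : ℕ → ℝ → EuclideanSpace ℝ (Fin n)} (hX : AsymptoticallyFrozen X C)
    {Y : ℕ → ℝ → EuclideanSpace ℝ (Fin m)}
    (hY : ∀ k τ, 0 ≤ τ → HasDerivAt (Y k) (g (X k τ, Y k τ, τ)) τ)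
    {yInit : EuclideanSpace ℝ (Fin m)} (hY0 : ∀ k, Y k 0 = yInit) :
    ∃ (R : ℝ) (N : ℕ), ∀ k ≥ N, ∀ τ ≥ 0, ‖Y k τ‖ ≤ R := by
  obtain ⟨c, hc, hcT⟩ := hC
  set D := c + 1 + ‖yInit‖ with hD
  have hD0 : 0 < D := by positivity
  obtain ⟨T, hT, hsolT⟩ := hcT D hD0
  have window : ∃ N : ℕ, ∀ k ≥ N, ∀ τ ≥ 0, ‖Y k τ‖ ≤ D →
      (∀ s ∈ Icc 0 T, ‖Y k (τ + s)‖ ≤ N) ∧ ‖Y k (τ + T)‖ ≤ c + 1 := by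
    by_contra! hcon
    choose κ hκ τ hτ hYD hbad using hcon
    obtain ⟨x, hxC, hx⟩ := hX κ τ (tendsto_atTop_mono hκ tendsto_id)
    obtain ⟨h, -, hh⟩ := isCompact_univ.ultrafilter_le_nhds'
      ((hyperfilter ℕ).map fun j => σf (τ j) g0) univ_mem
    have hh' : Tendsto (fun j => σf (τ j) g0) (hyperfilter ℕ) (𝓝 h) := hh
    obtain ⟨y, hyD, hy⟩ := (isCompact_closedBall (0 : EuclideanSpace ℝ (Fin m)) D
      ).ultrafilter_le_nhds' ((hyperfilter ℕ).map fun j => Y (κ j) (τ j))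
      (Ultrafilter.mem_map.2 (univ_mem' fun j => mem_closedBall_zero_iff.2 (hYD j)))
    have hy' : Tendsto (fun j => Y (κ j) (τ j)) (hyperfilter ℕ) (𝓝 y) := hy
    have hz : ∀ t ∈ Icc 0 T, HasDerivAt (sol h x 0 y) (ev h (x, sol h x 0 y t, t)) t :=
      fun t ht => hsolode h x 0 y t ht.1
    have hslow := eventually_dist_hull_solution_lt hlip hev hrange hg0 hequiv hh' hT.le
      (Xs := fun j s => X (κ j) (τ j + s)) (w := fun j => Y (κ j))
      (fun η hη => (hx T η hη).mono fun j hj s hs => hj s (by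
        rw [abs_of_nonneg hs.1]
        exact hs.2)) hz
      (fun j s hs => hY (κ j) (τ j + s) (add_nonneg (hτ j) hs.1))
      (by rwa [hsolinit]) (half_pos one_pos)
    have hfrozen := eventually_dist_hull_solution_lt hlip hev hrange hg0 hequiv hh' hT.le
      (Xs := fun _ _ => x) (w := fun j => sol g0 x (τ j) (Y (κ j) (τ j)))
      (fun η hη => Eventually.of_forall fun j s _ => by rwa [dist_self]) hz
      (fun j s hs => by
        rw [← hg0]
        exact hsolode g0 x (τ j) (Y (κ j) (τ j)) (τ j + s) (by linarith [hs.1]))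
      (by simpa only [hsolinit] using hy') (half_pos one_pos)
    obtain ⟨B, hB⟩ := isCompact_Icc.exists_bound_of_continuousOn
      (fun t ht => (hz t ht).continuousAt.continuousWithinAt : ContinuousOn _ (Icc 0 T))
    have hlarge : ∀ᶠ j : ℕ in (hyperfilter ℕ : Filter ℕ), B + 1 ≤ (j : ℝ) :=
      (tendsto_natCast_atTop_atTop.mono_left Nat.hyperfilter_le_atTop).eventually_ge_atTop _
    obtain ⟨j, hj1, hj2, hj3⟩ := (hslow.and (hfrozen.and hlarge)).exists
    refine absurd (hbad j fun s hs => ?_) (not_lt.2 ?_)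
    · have h1 := hj1 s hs
      have h2 := hB s hs
      rw [dist_eq_norm] at h1
      linarith [norm_le_norm_add_norm_sub' (Y (κ j) (τ j + s)) (sol h x 0 y s)]
    · have hTT : T ∈ Icc 0 T := ⟨hT.le, le_rfl⟩
      have h1 := hj1 T hTT
      have h2 := hj2 T hTT
      have h3 := hsolT x hxC (τ j) T le_rfl _ (hYD j)
      rw [add_comm] at h3
      have h4 := dist_triangle_right (Y (κ j) (τ j + T))
        (sol g0 x (τ j) (Y (κ j) (τ j)) (τ j + T)) (sol h x 0 y T)
      rw [dist_eq_norm (Y (κ j) (τ j + T)) (sol g0 x (τ j) (Y (κ j) (τ j)) (τ j + T))] at h4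
      linarith [norm_le_norm_add_norm_sub' (Y (κ j) (τ j + T))
        (sol g0 x (τ j) (Y (κ j) (τ j)) (τ j + T))]
  obtain ⟨N, hN⟩ := window
  refine ⟨N, N, fun k hk τ hτ => ?_⟩
  have hind : ∀ i : ℕ, ‖Y k (i * T)‖ ≤ D := by
    intro i
    induction i with
    | zero =>
      rw [Nat.cast_zero, zero_mul, hY0]
      linarith
    | succ i ih =>
      have := (hN k hk (i * T) (by positivity) ih).2
      rw [Nat.cast_succ, add_one_mul]
      linarith [norm_nonneg yInit]
  have hfl : (⌊τ / T⌋₊ : ℝ) * T ≤ τ := (le_div_iff₀ hT).1 (Nat.floor_le (by positivity))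
  have hlt : τ < (⌊τ / T⌋₊ + 1 : ℝ) * T := (div_lt_iff₀ hT).1 (Nat.lt_floor_add_one _)
  have := (hN k hk (⌊τ / T⌋₊ * T) (by positivity) (hind _)).1 (τ - ⌊τ / T⌋₊ * T)
    ⟨by linarith, by linarith⟩
  rwa [add_sub_cancel] at this

/-- Bounded solutions with asymptotically frozen slow components accumulate, at late times, on the
fibers of bounded entire solutions over the hull. -/
theorem exists_attrFiber_limit_of_asymptoticallyFrozen (hev : Continuous ev) (hg0 : ev g0 = g)
    (hequiv : ∀ (s : ℝ) (h : H), ev (σf s h) = timeTranslate s (ev h))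
    {C : Set (EuclideanSpace ℝ (Fin n))}
    {X : ℕ → ℝ → EuclideanSpace ℝ (Fin n)} (hX : AsymptoticallyFrozen X C)
    {Y : ℕ → ℝ → EuclideanSpace ℝ (Fin m)}
    (hY : ∀ k τ, 0 ≤ τ → HasDerivAt (Y k) (g (X k τ, Y k τ, τ)) τ) {R : ℝ} {N : ℕ}
    (hR : ∀ k ≥ N, ∀ τ ≥ 0, ‖Y k τ‖ ≤ R) {κ : ℕ → ℕ} {τ : ℕ → ℝ}
    (hκ : Tendsto κ atTop atTop) (hτ : Tendsto τ atTop atTop) :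
    ∃ h, ∃ x ∈ C, ∃ z ∈ attrFiber ev h x,
      Tendsto (fun j => σf (τ j) g0) (hyperfilter ℕ) (𝓝 h) ∧
      Tendsto (fun j => X (κ j) (τ j)) (hyperfilter ℕ) (𝓝 x) ∧
      Tendsto (fun j => Y (κ j) (τ j)) (hyperfilter ℕ) (𝓝 z) := by
  have hκN : ∀ᶠ j in (hyperfilter ℕ : Filter ℕ), N ≤ κ j :=
    (hκ.mono_left Nat.hyperfilter_le_atTop).eventually_ge_atTop N
  have hτs : ∀ s, ∀ᶠ j in (hyperfilter ℕ : Filter ℕ), s ≤ τ j := fun s =>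
    (hτ.mono_left Nat.hyperfilter_le_atTop).eventually_ge_atTop s
  obtain ⟨x, hxC, hx⟩ := hX κ τ hκ
  obtain ⟨h, -, hh⟩ := isCompact_univ.ultrafilter_le_nhds'
    ((hyperfilter ℕ).map fun j => σf (τ j) g0) univ_mem
  have hh' : Tendsto (fun j => σf (τ j) g0) (hyperfilter ℕ) (𝓝 h) := hh
  have hlim : ∀ s, ∃ y ∈ closedBall (0 : EuclideanSpace ℝ (Fin m)) R,
      Tendsto (fun j => Y (κ j) (τ j + s)) (hyperfilter ℕ) (𝓝 y) := by
    intro s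
    refine (isCompact_closedBall (0 : EuclideanSpace ℝ (Fin m)) R).ultrafilter_le_nhds'
      ((hyperfilter ℕ).map fun j => Y (κ j) (τ j + s)) (Ultrafilter.mem_map.2 ?_)
    change ∀ᶠ j in (hyperfilter ℕ : Filter ℕ), Y (κ j) (τ j + s) ∈ closedBall 0 R
    filter_upwards [hκN, hτs (-s)] with j h1 h2
    exact mem_closedBall_zero_iff.2 (hR _ h1 _ (by linarith))
  choose y hyR hy using hlim
  have hball : ∀ s u : ℝ, u ∈ ball s 1 → |u| ≤ |s| + 1 := fun s u hu => by
    have hu' : dist u s < 1 := hu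
    rw [Real.dist_eq] at hu'
    linarith [abs_sub_abs_le_abs_sub u s]
  refine ⟨h, x, hxC, y 0, ⟨y, rfl, ⟨R, fun s => mem_closedBall_zero_iff.1 (hyR s)⟩, fun s => ?_⟩,
    hh', Metric.tendsto_nhds.2 fun η hη => ?_, by simpa using hy 0⟩
  · refine hasDerivAt_of_tendsto_solutions (continuous_uncurry_hull hev) (p := (h, x))
      (q := fun j s => (σf (τ j) g0, X (κ j) (τ j + s))) (w := fun j s => Y (κ j) (τ j + s))
      (l := hyperfilter ℕ) (R := R) (fun η hη => ?_) ?_ ?_ hy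
    · filter_upwards [hh' (Metric.ball_mem_nhds h hη), hx (|s| + 1) η hη] with j h1 h2 u hu
      exact max_lt h1 (h2 u (hball s u hu))
    · filter_upwards [hτs (|s| + 1)] with j h1 u hu
      exact hasDerivAt_comp_const_add_hull hg0 hequiv
        (hY (κ j) (τ j + u) (by linarith [hball s u hu, neg_abs_le u]))
    · filter_upwards [hκN, hτs (|s| + 1)] with j h1 h2 u hu
      exact hR _ h1 _ (by linarith [hball s u hu, neg_abs_le u])
  · filter_upwards [hx 0 η hη] with j hj
    simpa using hj 0 (by simp)

end Hull

/-- the fast motion tracks the parametrically inflated fibers of the pullback attractor. -/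
theorem stmt_8
    {n m : ℕ} (hn : 1 ≤ n) (hm : 1 ≤ m)
    -- g, admissible and Lipschitz in y on compacts
    (g : C(EuclideanSpace ℝ (Fin n) × EuclideanSpace ℝ (Fin m) × ℝ,
      EuclideanSpace ℝ (Fin m)))
    (hadm : IsAdmissibleMap g) (hlip : IsLipschitzInY g)
    -- the hull H of g, a compact metric space with the continuous shift flow,
    -- identified via the embedding ev with the closure of the translates of g
    (H : Type) [MetricSpace H] [CompactSpace H]
    (σf : ℝ → H → H)
    (hσcont : Continuous fun p : ℝ × H => σf p.1 p.2)
    (hσ0 : ∀ h, σf 0 h = h)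
    (hσadd : ∀ s t : ℝ, ∀ h, σf (s + t) h = σf s (σf t h))
    (ev : H → C(EuclideanSpace ℝ (Fin n) × EuclideanSpace ℝ (Fin m) × ℝ,
      EuclideanSpace ℝ (Fin m)))
    (hev : Topology.IsEmbedding ev)
    (hrange : Set.range ev = closure {h | ∃ s : ℝ, h = timeTranslate s g})
    (g0 : H) (hg0 : ev g0 = g)
    (hequiv : ∀ (s : ℝ) (h : H), ev (σf s h) = timeTranslate s (ev h))
    -- the (unique, maximal) solutions y(τ,h,x,τ₀,y₀) of y' = h(x,y,τ)
    (sol : H → EuclideanSpace ℝ (Fin n) → ℝ → EuclideanSpace ℝ (Fin m) → ℝ →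
      EuclideanSpace ℝ (Fin m))
    (hsolinit : ∀ h x τ₀ y₀, sol h x τ₀ y₀ τ₀ = y₀)
    -- (H1): all solutions over the hull are globally defined in the future
    (hsolode : ∀ h x (τ₀ : ℝ) y₀ (τ : ℝ), τ₀ ≤ τ →
      HasDerivAt (sol h x τ₀ y₀) (ev h (x, sol h x τ₀ y₀ τ, τ)) τ)
    -- (H2): uniform ultimate boundedness over compact sets of parameters
    (hH2 : ∀ K₀ : Set (EuclideanSpace ℝ (Fin n)), IsCompact K₀ →
      ∃ c > (0:ℝ), ∀ d > (0:ℝ), ∃ T > (0:ℝ), ∀ x ∈ K₀, ∀ τ₀ : ℝ, ∀ τ ≥ T,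
        ∀ y₀ : EuclideanSpace ℝ (Fin m), ‖y₀‖ ≤ d → ‖sol g0 x τ₀ y₀ (τ + τ₀)‖ ≤ c)
    -- the slow vector field f, continuous and of linear growth
    (f : EuclideanSpace ℝ (Fin n) → EuclideanSpace ℝ (Fin m) → EuclideanSpace ℝ (Fin n))
    (hf : Continuous fun p : EuclideanSpace ℝ (Fin n) × EuclideanSpace ℝ (Fin m) =>
      f p.1 p.2)
    (a b : ℝ) (ha : 0 < a) (hb : 0 < b)
    (hgrowth : ∀ x y, ‖f x y‖ ≤ a + b * ‖x‖)
    -- initial data, final slow time, the sequence ε_k ↓ 0, and the solutions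
    -- (x_{ε_k}, y_{ε_k}) of the slow-fast system in the fast time
    (xInit : EuclideanSpace ℝ (Fin n)) (yInit : EuclideanSpace ℝ (Fin m))
    (t₀ : ℝ) (ht₀ : 0 < t₀)
    (ε : ℕ → ℝ) (hεpos : ∀ k, 0 < ε k) (hεanti : StrictAnti ε)
    (hεlim : Tendsto ε atTop (𝓝 0))
    (xe : ℕ → ℝ → EuclideanSpace ℝ (Fin n)) (ye : ℕ → ℝ → EuclideanSpace ℝ (Fin m))
    (hxe0 : ∀ k, xe k 0 = xInit) (hye0 : ∀ k, ye k 0 = yInit)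
    (hxeode : ∀ k : ℕ, ∀ τ ∈ Set.Icc (0:ℝ) (t₀ / ε k),
      HasDerivAt (xe k) (ε k • f (xe k τ) (ye k τ)) τ)
    (hyeode : ∀ k : ℕ, ∀ τ ∈ Set.Icc (0:ℝ) (t₀ / ε k),
      HasDerivAt (ye k) (g (xe k τ, ye k τ, τ)) τ)
    -- the slow components converge uniformly (in the slow time) to x₀
    (x0 : ℝ → EuclideanSpace ℝ (Fin n)) (hx0cont : ContinuousOn x0 (Set.Icc 0 t₀))
    (hconv : TendstoUniformlyOn (fun k t => xe k (t / ε k)) x0 atTop (Set.Icc 0 t₀))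
    -- the radius of the compact tube K₀ around x₀
    (r : ℝ) (hr : 0 < r)
    (δ : ℝ) (hδ : 0 < δ) :
    ∃ T > (0:ℝ), ∃ k₀ : ℕ, 2 * T < t₀ / ε k₀ ∧
      ∀ k ≥ k₀, ∀ τ ∈ Set.Icc T (t₀ / ε k),
        Metric.infDist (ye k τ)
          (inflFiber ev (slowTube x0 t₀ r) (σf τ g0) (x0 (ε k * τ)) δ) ≤ δ := by
  have hCcpt : IsCompact (x0 '' Set.Icc 0 t₀) := isCompact_Icc.image_of_continuousOn hx0cont
  set X : ℕ → ℝ → EuclideanSpace ℝ (Fin n) :=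
    fun k τ => xe k (projIcc 0 t₀ ht₀.le (ε k * τ) / ε k) with hXdef
  have hX : AsymptoticallyFrozen X (x0 '' Set.Icc 0 t₀) :=
    asymptoticallyFrozen_of_tendstoUniformlyOn ht₀.le hεlim hx0cont hconv
  have hmem : ∀ k, ∀ τ ∈ Set.Icc 0 (t₀ / ε k), ε k * τ ∈ Set.Icc 0 t₀ := fun k τ hτ =>
    ⟨mul_nonneg (hεpos k).le hτ.1, by
      rw [mul_comm]
      exact (le_div_iff₀ (hεpos k)).1 hτ.2⟩
  have hXle : ∀ k, ∀ τ ∈ Set.Icc 0 (t₀ / ε k), X k τ = xe k τ := fun k τ hτ => by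
    simp only [hXdef]
    rw [projIcc_of_mem ht₀.le (hmem k τ hτ), mul_div_cancel_left₀ _ (hεpos k).ne']
  have hXge : ∀ k τ, t₀ / ε k ≤ τ → X k τ = xe k (t₀ / ε k) := fun k τ hτ => by
    simp only [hXdef]
    rw [projIcc_of_right_le ht₀.le (by rw [mul_comm]; exact (div_le_iff₀ (hεpos k)).1 hτ)]
  have hend : ∀ k, 0 ≤ t₀ / ε k := fun k => (div_pos ht₀ (hεpos k)).le
  set Y : ℕ → ℝ → EuclideanSpace ℝ (Fin m) := fun k τ => if τ ≤ t₀ / ε k then ye k τ else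
    sol g0 (xe k (t₀ / ε k)) (t₀ / ε k) (ye k (t₀ / ε k)) τ with hYdef
  have hYle : ∀ k τ, τ ≤ t₀ / ε k → Y k τ = ye k τ := fun k τ hτ => if_pos hτ
  have hYgt : ∀ k τ, t₀ / ε k < τ →
      Y k τ = sol g0 (xe k (t₀ / ε k)) (t₀ / ε k) (ye k (t₀ / ε k)) τ := fun k τ hτ =>
    if_neg (not_le.2 hτ)
  have hY : ∀ k τ, 0 ≤ τ → HasDerivAt (Y k) (g (X k τ, Y k τ, τ)) τ := by
    intro k τ hτ
    have hs := hsolode g0 (xe k (t₀ / ε k)) (t₀ / ε k) (ye k (t₀ / ε k)) τ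
    rw [hg0] at hs
    rcases lt_trichotomy τ (t₀ / ε k) with h | h | h
    · rw [hXle k τ ⟨hτ, h.le⟩, hYle k τ h.le]
      refine (hyeode k τ ⟨hτ, h.le⟩).congr_of_eventuallyEq ?_
      filter_upwards [gt_mem_nhds h] with u hu using hYle k u (le_of_lt hu)
    · subst h
      rw [hXle k _ ⟨hτ, le_rfl⟩, hYle k _ le_rfl]
      have hs' := hs le_rfl
      rw [hsolinit] at hs'
      exact (hyeode k _ ⟨hτ, le_rfl⟩).ite_le hs' (hsolinit _ _ _ _).symm
    · rw [hXge k τ h.le, hYgt k τ h]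
      refine (hs h.le).congr_of_eventuallyEq ?_
      filter_upwards [lt_mem_nhds h] with u hu using hYgt k u hu
  obtain ⟨R, N, hR⟩ := exists_norm_le_of_asymptoticallyFrozen hlip hev.continuous hrange.subset
    hg0 hequiv hsolinit hsolode (hH2 _ hCcpt) hX hY
    (fun k => (hYle k 0 (hend k)).trans (hye0 k))
  have hlen : Tendsto (fun k => t₀ / ε k) atTop atTop := by
    refine Tendsto.const_mul_atTop ht₀ (tendsto_inv_nhdsGT_zero.comp ?_)
    exact tendsto_nhdsWithin_iff.2 ⟨hεlim, Eventually.of_forall hεpos⟩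
  by_contra! hcon
  have hbad : ∀ j : ℕ, ∃ k ≥ j, ∃ τ ∈ Set.Icc (j + 1 : ℝ) (t₀ / ε k),
      δ < Metric.infDist (ye k τ)
        (inflFiber ev (slowTube x0 t₀ r) (σf τ g0) (x0 (ε k * τ)) δ) := by
    intro j
    obtain ⟨k₀, hk₀, hj⟩ :=
      ((hlen.eventually_gt_atTop (2 * (j + 1 : ℝ))).and (eventually_ge_atTop j)).exists
    obtain ⟨k, hk, h⟩ := hcon (j + 1) (by positivity) k₀ hk₀
    exact ⟨k, hj.trans hk, h⟩
  choose κ hκ τ hτ hfar using hbad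
  have hκt : Tendsto κ atTop atTop := tendsto_atTop_mono hκ tendsto_id
  have hτt : Tendsto τ atTop atTop :=
    tendsto_atTop_mono (fun j => by linarith [(hτ j).1]) tendsto_natCast_atTop_atTop
  have hτmem : ∀ j, τ j ∈ Set.Icc 0 (t₀ / ε (κ j)) := fun j =>
    ⟨le_trans (by positivity) (hτ j).1, (hτ j).2⟩
  obtain ⟨h, x, ⟨t, ht, rfl⟩, z, hz, hhlim, hxlim, hzlim⟩ :=
    exists_attrFiber_limit_of_asymptoticallyFrozen hev.continuous hg0 hequiv hX hY hR hκt hτt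
  have hunif := (hκt.mono_left Nat.hyperfilter_le_atTop).eventually
    (Metric.tendstoUniformlyOn_iff.1 hconv (δ / 2) (half_pos hδ))
  obtain ⟨j, hj1, hj2, hj3, hj4⟩ := ((Metric.tendsto_nhds.1 hhlim δ hδ).and
    ((Metric.tendsto_nhds.1 hxlim (δ / 2) (half_pos hδ)).and
      ((Metric.tendsto_nhds.1 hzlim δ hδ).and hunif))).exists
  rw [hXle _ _ (hτmem j)] at hj2
  rw [hYle _ _ (hτ j).2] at hj3
  have hj5 := hj4 (ε (κ j) * τ j) (hmem _ _ (hτmem j))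
  rw [mul_div_cancel_left₀ _ (hεpos (κ j)).ne'] at hj5
  have hxδ : dist (x0 (ε (κ j) * τ j)) (x0 t) ≤ δ := by
    linarith [dist_triangle (x0 (ε (κ j) * τ j)) (xe (κ j) (τ j)) (x0 t)]
  have hzmem : z ∈ inflFiber ev (slowTube x0 t₀ r) (σf (τ j) g0) (x0 (ε (κ j) * τ j)) δ :=
    mem_biUnion (x := (h, x0 t))
      ⟨⟨t, ht, 0, by simpa using hr.le, by simp⟩, max_le hj1.le hxδ⟩ hz
  linarith [hfar j, Metric.infDist_le_dist_of_mem (x := ye (κ j) (τ j)) hzmem]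
end

section
/- For each integer k ≥ 1 let δ_k := inf{ δ > 0 : dist(y_{ε_k}(t₀/ε_k), A_{(g·(t₀/ε_k), x₀(t₀))}[δ]) ≤ δ }. Then lim_{k→∞} δ_k = 0. -/
open Filter Topology Metric Set

/-- `w` solves `w' = h(ξ(s), w, s)` on `[0, q]`. -/
def IsDrivenSolution {H X Y : Type*} [TopologicalSpace X] [NormedAddCommGroup Y] [NormedSpace ℝ Y]
    (ev : H → C(X × Y × ℝ, Y)) (h : H) (ξ : ℝ → X) (w : ℝ → Y) (q : ℝ) : Prop :=
  ∀ s ∈ Icc 0 q, HasDerivAt w (ev h (ξ s, w s, s)) s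

/-- Lipschitz continuity in the second variable on balls, uniformly in time. -/
def IsLipschitzOnBalls {X Y : Type*} [TopologicalSpace X] [NormedAddCommGroup Y]
    (φ : C(X × Y × ℝ, Y)) (x : X) : Prop :=
  ∀ R : ℝ, ∃ L > (0 : ℝ), ∀ y₁ ∈ closedBall (0 : Y) R, ∀ y₂ ∈ closedBall (0 : Y) R, ∀ τ : ℝ,
    ‖φ (x, y₁, τ) - φ (x, y₂, τ)‖ ≤ L * ‖y₁ - y₂‖

theorem gronwallBound_self_eq_mul {L : ℝ} (hL : L ≠ 0) (e s : ℝ) :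
    gronwallBound e L e s = e * gronwallBound 1 L 1 s := by
  simp only [gronwallBound_of_K_ne_0 hL]
  ring

/-- Dependence of solutions on the driving element, a slowly varying parameter and the initial
value, uniform over subintervals. -/
theorem exists_radius_dist_le {H X Y : Type*} [PseudoMetricSpace H] [PseudoMetricSpace X]
    [LocallyCompactSpace X] [NormedAddCommGroup Y] [NormedSpace ℝ Y] [ProperSpace Y]
    {ev : H → C(X × Y × ℝ, Y)} (hev : Continuous ev) {h : H} {x : X}
    (hL : IsLipschitzOnBalls (ev h) x) {v : ℝ → Y} {S : ℝ}
    (hv : IsDrivenSolution ev h (fun _ => x) v S) {η : ℝ} (hη : 0 < η) :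
    ∃ δ > 0, ∀ (h' : H) (ξ : ℝ → X) (w : ℝ → Y) (q : ℝ), q ≤ S → dist h' h < δ →
      (∀ s ∈ Icc 0 q, dist (ξ s) x < δ) → IsDrivenSolution ev h' ξ w q → dist (w 0) (v 0) < δ →
      ∀ s ∈ Icc 0 q, dist (w s) (v s) ≤ η := by
  have hvc : ContinuousOn v (Icc 0 S) := fun s hs => (hv s hs).continuousAt.continuousWithinAt
  obtain ⟨R, hR⟩ := (isCompact_Icc.image_of_continuousOn hvc).isBounded.exists_norm_le
  obtain ⟨L, hL0, hL⟩ := hL (R + 1)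
  set M := gronwallBound 1 L 1 |S|
  have hM1 : 1 ≤ M := by
    simpa [gronwallBound_x0] using
      gronwallBound_mono zero_le_one (zero_le_one (α := ℝ)) hL0.le (abs_nonneg S)
  set η' := min 1 η with hη'
  have hη'0 : 0 < η' := lt_min one_pos hη
  set e := η' / (2 * M) with he
  have he0 : 0 < e := by positivity
  have heM : e * M < η' := by
    rw [he]; field_simp; linarith
  have heη : e < η' := lt_of_le_of_lt (le_mul_of_one_le_right he0.le hM1) heM
  have hcont : Continuous (fun p : (H × X) × (Y × ℝ) => ev p.1.1 (p.1.2, p.2.1, p.2.2)) := by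
    fun_prop
  obtain ⟨U, hU, hUe⟩ := IsCompact.mem_uniformity_of_prod
    (f := fun (p : H × X) (y : Y × ℝ) => ev p.1 (p.2, y.1, y.2)) (s := univ) (q := (h, x))
    ((isCompact_closedBall (0 : Y) (R + 1)).prod (isCompact_Icc (a := (0 : ℝ)) (b := S)))
    hcont.continuousOn (mem_univ _) (dist_mem_uniformity he0)
  rw [nhdsWithin_univ, Metric.mem_nhds_iff] at hU
  obtain ⟨δ, hδ, hU⟩ := hU
  refine ⟨min δ e, lt_min hδ he0, fun h' ξ w q hqS hh' hξ hw h0 => ?_⟩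
  have hwc : ContinuousOn w (Icc 0 q) := fun s hs => (hw s hs).continuousAt.continuousWithinAt
  have hvc' : ContinuousOn v (Icc 0 q) := hvc.mono (Icc_subset_Icc_right hqS)
  have hvR : ∀ s ∈ Icc 0 q, ‖v s‖ ≤ R := fun s hs => hR _ ⟨s, ⟨hs.1, hs.2.trans hqS⟩, rfl⟩
  suffices hlt : ∀ s ∈ Icc 0 q, dist (w s) (v s) < η' from
    fun s hs => (hlt s hs).le.trans (min_le_right _ _)
  by_contra! hcon
  obtain ⟨s₁, hs₁, hs₁'⟩ := hcon
  have hcl : IsCompact (Icc 0 q ∩ (fun s => dist (w s) (v s)) ⁻¹' Ici η') :=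
    isCompact_Icc.of_isClosed_subset
      ((continuous_dist.comp_continuousOn (hwc.prodMk hvc')).preimage_isClosed_of_isClosed isClosed_Icc isClosed_Ici) inter_subset_left
  obtain ⟨t, ⟨ht, htη⟩, hmin⟩ := hcl.exists_isLeast ⟨s₁, hs₁, hs₁'⟩
  have hbefore : ∀ s ∈ Ico 0 t, dist (w s) (v s) < η' := by
    intro s hs
    by_contra! hge
    exact absurd (hmin ⟨⟨hs.1, hs.2.le.trans ht.2⟩, hge⟩) (not_le.2 hs.2)
  have hsub : Icc 0 t ⊆ Icc 0 q := Icc_subset_Icc_right ht.2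
  have hvB : ∀ s ∈ Ico 0 t, v s ∈ closedBall (0 : Y) (R + 1) := fun s hs => by
    rw [mem_closedBall_zero_iff]
    linarith [hvR s (hsub ⟨hs.1, hs.2.le⟩)]
  have hwB : ∀ s ∈ Ico 0 t, w s ∈ closedBall (0 : Y) (R + 1) := fun s hs => by
    rw [mem_closedBall_zero_iff]
    have h1 := hvR s (hsub ⟨hs.1, hs.2.le⟩)
    have h2 := hbefore s hs
    have h3 : η' ≤ 1 := min_le_left _ _
    rw [dist_eq_norm] at h2
    linarith [norm_le_norm_add_norm_sub (v s) (w s), norm_sub_rev (v s) (w s)]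
  have key := dist_le_of_approx_trajectories_ODE_of_mem (a := 0) (b := t) (f := w) (g := v)
    (v := fun s y => ev h (x, y, s)) (s := fun _ => closedBall (0 : Y) (R + 1))
    (K := ⟨L, hL0.le⟩) (f' := fun s => ev h' (ξ s, w s, s)) (g' := fun s => ev h (x, v s, s))
    (εf := e) (εg := 0) (δ := e)
    (fun s _ => LipschitzOnWith.of_dist_le_mul fun y₁ h₁ y₂ h₂ => by
      rw [dist_eq_norm, dist_eq_norm]
      exact hL y₁ h₁ y₂ h₂ s)
    (hwc.mono hsub)
    (fun s hs => (hw s (hsub ⟨hs.1, hs.2.le⟩)).hasDerivWithinAt)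
    (fun s hs => by
      have hs' := hsub ⟨hs.1, hs.2.le⟩
      have hmem : (h', ξ s) ∈ ball (h, x) δ := by
        rw [mem_ball, Prod.dist_eq]
        exact max_lt (hh'.trans_le (min_le_left _ _)) ((hξ s hs').trans_le (min_le_left _ _))
      exact le_of_lt (hUe _ (hU hmem) (w s, s) ⟨hwB s hs, hs'.1, hs'.2.trans hqS⟩))
    hwB (hvc'.mono hsub)
    (fun s hs => (hv s ⟨hs.1, (hs.2.le.trans ht.2).trans hqS⟩).hasDerivWithinAt)
    (fun s _ => by simp) hvB (h0.le.trans (min_le_right _ _)) t ⟨ht.1, le_rfl⟩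
  rw [add_zero, sub_zero] at key
  have hmono : gronwallBound e L e t ≤ gronwallBound e L e |S| :=
    gronwallBound_mono he0.le he0.le hL0.le ((ht.2.trans hqS).trans (le_abs_self S))
  rw [gronwallBound_self_eq_mul hL0.ne' e |S|] at hmono
  have : η' ≤ dist (w t) (v t) := htη
  have key' : dist (w t) (v t) ≤ gronwallBound e L e t := key
  linarith

/-- Forward uniqueness of solutions. -/
theorem IsDrivenSolution.eqOn {H X Y : Type*} [PseudoMetricSpace H] [PseudoMetricSpace X]
    [LocallyCompactSpace X] [NormedAddCommGroup Y] [NormedSpace ℝ Y] [ProperSpace Y]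
    {ev : H → C(X × Y × ℝ, Y)} (hev : Continuous ev) {h : H} {x : X}
    (hL : IsLipschitzOnBalls (ev h) x) {v w : ℝ → Y} {S : ℝ}
    (hv : IsDrivenSolution ev h (fun _ => x) v S) (hw : IsDrivenSolution ev h (fun _ => x) w S)
    (h0 : w 0 = v 0) : EqOn w v (Icc 0 S) := by
  intro s hs
  refine dist_le_zero.1 (le_of_forall_pos_le_add fun η hη => ?_)
  obtain ⟨δ, hδ, hd⟩ := exists_radius_dist_le hev hL hv hη
  simpa using hd h (fun _ => x) w S le_rfl (by simpa) (fun _ _ => by simpa) hw (by simpa [h0]) s hs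

/-- Uniform version of `exists_radius_dist_le` over a compact set of data: bounds for the solutions
of the unperturbed family at time `T` persist, up to an arbitrary margin, for perturbed ones. -/
theorem exists_uniform_bound {H X Y : Type*} [PseudoMetricSpace H] [CompactSpace H]
    [PseudoMetricSpace X]
    [LocallyCompactSpace X] [NormedAddCommGroup Y] [NormedSpace ℝ Y] [ProperSpace Y]
    {ev : H → C(X × Y × ℝ, Y)} (hev : Continuous ev) (hL : ∀ h x, IsLipschitzOnBalls (ev h) x)
    {K : Set X} (hK : IsCompact K) {c d T : ℝ} (hT : 0 ≤ T)
    {V : H → X → Y → ℝ → Y} (hV0 : ∀ h x z, V h x z 0 = z)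
    (hV : ∀ h x z, IsDrivenSolution ev h (fun _ => x) (V h x z) T)
    (hVT : ∀ h, ∀ x ∈ K, ∀ z, ‖z‖ ≤ d → ‖V h x z T‖ ≤ c) :
    ∃ C, ∃ δ > 0, ∀ (h : H), ∀ x ∈ K, ∀ (ξ : ℝ → X) (w : ℝ → Y) (q : ℝ), q ≤ T →
      (∀ s ∈ Icc 0 q, dist (ξ s) x < δ) → IsDrivenSolution ev h ξ w q → ‖w 0‖ ≤ d →
      (∀ s ∈ Icc 0 q, ‖w s‖ ≤ C) ∧ (q = T → ‖w T‖ ≤ c + 1) := by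
  have hcomp : IsCompact ((univ : Set H) ×ˢ K ×ˢ closedBall (0 : Y) d) :=
    isCompact_univ.prod (hK.prod (isCompact_closedBall _ _))
  have main : ∃ C, ∃ δ > 0, ∀ P ∈ (univ : Set H) ×ˢ K ×ˢ closedBall (0 : Y) d,
      ∀ (ξ : ℝ → X) (w : ℝ → Y) (q : ℝ), q ≤ T →
      (∀ s ∈ Icc 0 q, dist (ξ s) P.2.1 < δ) → IsDrivenSolution ev P.1 ξ w q → w 0 = P.2.2 →
      (∀ s ∈ Icc 0 q, ‖w s‖ ≤ C) ∧ (q = T → ‖w T‖ ≤ c + 1) := by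
    refine hcomp.induction_on (p := fun A => ∃ C, ∃ δ > 0, ∀ P ∈ A,
      ∀ (ξ : ℝ → X) (w : ℝ → Y) (q : ℝ), q ≤ T →
      (∀ s ∈ Icc 0 q, dist (ξ s) P.2.1 < δ) → IsDrivenSolution ev P.1 ξ w q → w 0 = P.2.2 →
      (∀ s ∈ Icc 0 q, ‖w s‖ ≤ C) ∧ (q = T → ‖w T‖ ≤ c + 1)) ?_ ?_ ?_ ?_
    · exact ⟨0, 1, one_pos, by simp⟩
    · rintro A B hAB ⟨C, δ, hδ, hB⟩
      exact ⟨C, δ, hδ, fun P hP => hB P (hAB hP)⟩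
    · rintro A B ⟨C, δ, hδ, hA⟩ ⟨C', δ', hδ', hB⟩
      refine ⟨max C C', min δ δ', lt_min hδ hδ', ?_⟩
      rintro P (hP | hP) ξ w q hq hξ hw h0
      · have := hA P hP ξ w q hq (fun s hs => (hξ s hs).trans_le (min_le_left _ _)) hw h0
        exact ⟨fun s hs => (this.1 s hs).trans (le_max_left _ _), this.2⟩
      · have := hB P hP ξ w q hq (fun s hs => (hξ s hs).trans_le (min_le_right _ _)) hw h0
        exact ⟨fun s hs => (this.1 s hs).trans (le_max_right _ _), this.2⟩
    · rintro ⟨h, x, z⟩ ⟨-, hx, hz⟩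
      obtain ⟨δ, hδ, hd⟩ := exists_radius_dist_le hev (hL h x) (hV h x z) one_pos
      have hvc : ContinuousOn (V h x z) (Icc 0 T) :=
        fun s hs => (hV h x z s hs).continuousAt.continuousWithinAt
      obtain ⟨R, hR⟩ := (isCompact_Icc.image_of_continuousOn hvc).isBounded.exists_norm_le
      refine ⟨ball (h, x, z) (δ / 2), mem_nhdsWithin_of_mem_nhds (ball_mem_nhds _ (by positivity)),
        R + 1, δ / 2, by positivity, ?_⟩
      rintro ⟨h', x', z'⟩ hP ξ w q hq hξ hw h0
      rw [mem_ball, Prod.dist_eq, Prod.dist_eq, max_lt_iff, max_lt_iff] at hP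
      obtain ⟨hP1, hP2, hP3⟩ := hP
      dsimp only at hP1 hP2 hP3 hξ hw h0
      have hclose := hd h' ξ w q hq (by linarith)
        (fun s hs => by linarith [dist_triangle (ξ s) x' x, hξ s hs]) hw
        (by rw [h0, hV0]; linarith)
      have hnorm : ∀ s ∈ Icc 0 q, ‖w s‖ ≤ ‖V h x z s‖ + 1 := fun s hs => by
        have := hclose s hs
        rw [dist_eq_norm] at this
        linarith [norm_le_norm_add_norm_sub (V h x z s) (w s),
          norm_sub_rev (V h x z s) (w s)]
      refine ⟨fun s hs => ?_, fun hqT => ?_⟩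
      · linarith [hnorm s hs, hR _ ⟨s, ⟨hs.1, hs.2.trans hq⟩, rfl⟩]
      · linarith [hnorm T ⟨hT, hqT.ge⟩, hVT h x hx z (mem_closedBall_zero_iff.1 hz)]
  obtain ⟨C, δ, hδ, hC⟩ := main
  exact ⟨C, δ, hδ, fun h x hx ξ w q hq hξ hw h0 =>
    hC (h, x, w 0) ⟨mem_univ _, hx, mem_closedBall_zero_iff.2 h0⟩ ξ w q hq hξ hw rfl⟩

/-- A bound at time `τ` valid along a dense orbit of the driving flow passes to the whole hull. -/
theorem norm_le_of_dense {H X Y ι : Type*} [PseudoMetricSpace H] [PseudoMetricSpace X]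
    [LocallyCompactSpace X] [NormedAddCommGroup Y] [NormedSpace ℝ Y] [ProperSpace Y]
    {ev : H → C(X × Y × ℝ, Y)} (hev : Continuous ev) {h : H} {x : X}
    (hL : IsLipschitzOnBalls (ev h) x) {orbit : ι → H} (hdense : DenseRange orbit)
    {v : ℝ → Y} {τ c : ℝ} (hτ : 0 ≤ τ) (hv : IsDrivenSolution ev h (fun _ => x) v τ)
    (hw : ∀ p, ∃ w, IsDrivenSolution ev (orbit p) (fun _ => x) w τ ∧ w 0 = v 0 ∧ ‖w τ‖ ≤ c) :
    ‖v τ‖ ≤ c := by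
  refine le_of_forall_pos_le_add fun η hη => ?_
  obtain ⟨δ, hδ, hd⟩ := exists_radius_dist_le hev hL hv hη
  obtain ⟨p, hp⟩ := hdense.exists_dist_lt h hδ
  obtain ⟨w, hw, hw0, hwc⟩ := hw p
  have := hd (orbit p) (fun _ => x) w τ le_rfl (by rwa [dist_comm]) (fun _ _ => by simpa) hw
    (by simpa [hw0]) τ ⟨hτ, le_rfl⟩
  rw [dist_eq_norm] at this
  linarith [norm_le_norm_add_norm_sub (w τ) (v τ)]

/-- If trajectories starting in the `d`-ball stay in the `C`-ball for time `T` and are back in the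
`d`-ball at time `T`, they stay in the `C`-ball. -/
theorem norm_le_of_returns {Y : Type*} [NormedAddCommGroup Y] {y : ℝ → Y} {T S C d : ℝ}
    (hT : 0 < T) (h0 : ‖y 0‖ ≤ d)
    (hstep : ∀ p q, 0 ≤ p → 0 ≤ q → q ≤ T → p + q ≤ S → ‖y p‖ ≤ d →
      ‖y (p + q)‖ ≤ C ∧ (q = T → ‖y (p + q)‖ ≤ d)) :
    ∀ τ ∈ Icc 0 S, ‖y τ‖ ≤ C := by
  have hind : ∀ j : ℕ, j * T ≤ S → ‖y (j * T)‖ ≤ d := by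
    intro j
    induction j with
    | zero => intro _; simpa using h0
    | succ j ih =>
      intro hj
      push_cast at hj ⊢
      rw [add_one_mul] at hj ⊢
      exact (hstep _ T (by positivity) hT.le le_rfl hj (ih (by linarith))).2 rfl
  intro τ hτ
  have h1 : (⌊τ / T⌋₊ : ℝ) * T ≤ τ :=
    (le_div_iff₀ hT).1 (Nat.floor_le (div_nonneg hτ.1 hT.le))
  have h2 : τ < ((⌊τ / T⌋₊ : ℝ) + 1) * T := (div_lt_iff₀ hT).1 (Nat.lt_floor_add_one _)
  have := (hstep (⌊τ / T⌋₊ * T) (τ - ⌊τ / T⌋₊ * T) (by positivity) (by linarith) (by linarith)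
    (by linarith [hτ.2]) (hind _ (h1.trans hτ.2))).1
  rwa [add_sub_cancel] at this

/-- On bounded fast-time windows the slow components are eventually close to a constant value of
their limit. -/
theorem eventually_dist_slow_lt {X : Type*} [PseudoMetricSpace X] {t₀ : ℝ} {ε : ℕ → ℝ}
    (hεpos : ∀ k, 0 < ε k) (hεlim : Tendsto ε atTop (𝓝 0)) {xe : ℕ → ℝ → X} {x0 : ℝ → X}
    (hx0 : ContinuousOn x0 (Icc 0 t₀))
    (hconv : TendstoUniformlyOn (fun k t => xe k (t / ε k)) x0 atTop (Icc 0 t₀))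
    {δ : ℝ} (hδ : 0 < δ) (S : ℝ) :
    ∀ᶠ k in atTop, ∀ p ∈ Icc 0 (t₀ / ε k), ∀ s ∈ Icc 0 (t₀ / ε k), |s - p| ≤ S →
      dist (xe k s) (x0 (ε k * p)) < δ := by
  have huc := isCompact_Icc.uniformContinuousOn_of_continuous hx0
  obtain ⟨ρ, hρ, hρ'⟩ := Metric.uniformContinuousOn_iff.1 huc (δ / 2) (half_pos hδ)
  have hlim : Tendsto (fun k => ε k * S) atTop (𝓝 0) := by simpa using hεlim.mul_const S
  filter_upwards [Metric.tendstoUniformlyOn_iff.1 hconv (δ / 2) (half_pos hδ),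
    hlim.eventually (gt_mem_nhds hρ)] with k hk1 hk2 p hp s hs hps
  have hmem : ∀ s ∈ Icc 0 (t₀ / ε k), ε k * s ∈ Icc 0 t₀ := fun s hs =>
    ⟨mul_nonneg (hεpos k).le hs.1, by
      rw [mul_comm]; exact (le_div_iff₀ (hεpos k)).1 hs.2⟩
  have h1 := hk1 _ (hmem s hs)
  rw [mul_div_cancel_left₀ _ (hεpos k).ne', dist_comm] at h1
  have h2 := hρ' _ (hmem s hs) _ (hmem p hp) (by
    rw [Real.dist_eq, ← mul_sub, abs_mul, abs_of_pos (hεpos k)]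
    exact (mul_le_mul_of_nonneg_left hps (hεpos k).le).trans_lt hk2)
  linarith [dist_triangle (xe k s) (x0 (ε k * s)) (x0 (ε k * p))]

theorem isLipschitzOnBalls_of_mem_closure {n m : ℕ}
    {g φ : C(EuclideanSpace ℝ (Fin n) × EuclideanSpace ℝ (Fin m) × ℝ, EuclideanSpace ℝ (Fin m))}
    (hlip : IsLipschitzInY g) (hφ : φ ∈ closure {h | ∃ s : ℝ, h = timeTranslate s g})
    (x : EuclideanSpace ℝ (Fin n)) : IsLipschitzOnBalls φ x := by
  intro R
  obtain ⟨L, hL, hLip⟩ := hlip {x} isCompact_singleton _ (isCompact_closedBall 0 R)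
  refine ⟨L, hL, fun y₁ h₁ y₂ h₂ τ => ?_⟩
  refine closure_minimal (t := {φ | ‖φ (x, y₁, τ) - φ (x, y₂, τ)‖ ≤ L * ‖y₁ - y₂‖}) ?_ ?_ hφ
  · rintro _ ⟨s, rfl⟩
    exact hLip x rfl y₁ h₁ y₂ h₂ (τ + s)
  · exact isClosed_le (((continuous_eval_const _).sub
      (continuous_eval_const _)).norm) continuous_const

theorem IsDrivenSolution.of_shift {n m : ℕ} {H : Type*}
    {ev : H → C(EuclideanSpace ℝ (Fin n) × EuclideanSpace ℝ (Fin m) × ℝ,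
      EuclideanSpace ℝ (Fin m))} {h h' : H} {p q : ℝ} (hh : ev h' = timeTranslate p (ev h))
    {ξ : ℝ → EuclideanSpace ℝ (Fin n)} {y : ℝ → EuclideanSpace ℝ (Fin m)}
    (hy : ∀ s ∈ Icc p (p + q), HasDerivAt y (ev h (ξ s, y s, s)) s) :
    IsDrivenSolution ev h' (fun s => ξ (p + s)) (fun s => y (p + s)) q := by
  intro s hs
  have := hy (p + s) ⟨by linarith [hs.1], by linarith [hs.2]⟩
  have key := this.comp_const_add p s
  rw [hh]
  simpa [timeTranslate, add_comm s p] using key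

theorem denseRange_flow {n m : ℕ} {H : Type*} [TopologicalSpace H] {σf : ℝ → H → H}
    {g : C(EuclideanSpace ℝ (Fin n) × EuclideanSpace ℝ (Fin m) × ℝ, EuclideanSpace ℝ (Fin m))}
    {ev : H → C(EuclideanSpace ℝ (Fin n) × EuclideanSpace ℝ (Fin m) × ℝ,
      EuclideanSpace ℝ (Fin m))} (hev : Topology.IsEmbedding ev)
    (hrange : Set.range ev = closure {h | ∃ s : ℝ, h = timeTranslate s g})
    {g0 : H} (hg0 : ev g0 = g) (hequiv : ∀ s h, ev (σf s h) = timeTranslate s (ev h)) :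
    DenseRange fun s => σf s g0 := by
  intro h
  rw [hev.isInducing.closure_eq_preimage_closure_image, mem_preimage]
  have hsub : {h | ∃ s : ℝ, h = timeTranslate s g} ⊆ ev '' range fun s => σf s g0 := by
    rintro _ ⟨s, rfl⟩
    exact ⟨_, ⟨s, rfl⟩, by rw [hequiv, hg0]⟩
  exact closure_mono hsub (hrange ▸ mem_range_self h)

/-- the optimal inflation radii δ_k at the final time tend to zero. -/
theorem stmt_9
    {n m : ℕ} (hn : 1 ≤ n) (hm : 1 ≤ m)
    -- g, admissible and Lipschitz in y on compacts
    (g : C(EuclideanSpace ℝ (Fin n) × EuclideanSpace ℝ (Fin m) × ℝ,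
      EuclideanSpace ℝ (Fin m)))
    (hadm : IsAdmissibleMap g) (hlip : IsLipschitzInY g)
    -- the hull H of g, a compact metric space with the continuous shift flow,
    -- identified via the embedding ev with the closure of the translates of g
    (H : Type) [MetricSpace H] [CompactSpace H]
    (σf : ℝ → H → H)
    (hσcont : Continuous fun p : ℝ × H => σf p.1 p.2)
    (hσ0 : ∀ h, σf 0 h = h)
    (hσadd : ∀ s t : ℝ, ∀ h, σf (s + t) h = σf s (σf t h))
    (ev : H → C(EuclideanSpace ℝ (Fin n) × EuclideanSpace ℝ (Fin m) × ℝ,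
      EuclideanSpace ℝ (Fin m)))
    (hev : Topology.IsEmbedding ev)
    (hrange : Set.range ev = closure {h | ∃ s : ℝ, h = timeTranslate s g})
    (g0 : H) (hg0 : ev g0 = g)
    (hequiv : ∀ (s : ℝ) (h : H), ev (σf s h) = timeTranslate s (ev h))
    -- the (unique, maximal) solutions y(τ,h,x,τ₀,y₀) of y' = h(x,y,τ)
    (sol : H → EuclideanSpace ℝ (Fin n) → ℝ → EuclideanSpace ℝ (Fin m) → ℝ →
      EuclideanSpace ℝ (Fin m))
    (hsolinit : ∀ h x τ₀ y₀, sol h x τ₀ y₀ τ₀ = y₀)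
    -- (H1): all solutions over the hull are globally defined in the future
    (hsolode : ∀ h x (τ₀ : ℝ) y₀ (τ : ℝ), τ₀ ≤ τ →
      HasDerivAt (sol h x τ₀ y₀) (ev h (x, sol h x τ₀ y₀ τ, τ)) τ)
    -- (H2): uniform ultimate boundedness over compact sets of parameters
    (hH2 : ∀ K₀ : Set (EuclideanSpace ℝ (Fin n)), IsCompact K₀ →
      ∃ c > (0:ℝ), ∀ d > (0:ℝ), ∃ T > (0:ℝ), ∀ x ∈ K₀, ∀ τ₀ : ℝ, ∀ τ ≥ T,
        ∀ y₀ : EuclideanSpace ℝ (Fin m), ‖y₀‖ ≤ d → ‖sol g0 x τ₀ y₀ (τ + τ₀)‖ ≤ c)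
    -- the slow vector field f, continuous and of linear growth
    (f : EuclideanSpace ℝ (Fin n) → EuclideanSpace ℝ (Fin m) → EuclideanSpace ℝ (Fin n))
    (hf : Continuous fun p : EuclideanSpace ℝ (Fin n) × EuclideanSpace ℝ (Fin m) =>
      f p.1 p.2)
    (a b : ℝ) (ha : 0 < a) (hb : 0 < b)
    (hgrowth : ∀ x y, ‖f x y‖ ≤ a + b * ‖x‖)
    -- initial data, final slow time, the sequence ε_k ↓ 0, and the solutions
    -- (x_{ε_k}, y_{ε_k}) of the slow-fast system in the fast time
    (xInit : EuclideanSpace ℝ (Fin n)) (yInit : EuclideanSpace ℝ (Fin m))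
    (t₀ : ℝ) (ht₀ : 0 < t₀)
    (ε : ℕ → ℝ) (hεpos : ∀ k, 0 < ε k) (hεanti : StrictAnti ε)
    (hεlim : Tendsto ε atTop (𝓝 0))
    (xe : ℕ → ℝ → EuclideanSpace ℝ (Fin n)) (ye : ℕ → ℝ → EuclideanSpace ℝ (Fin m))
    (hxe0 : ∀ k, xe k 0 = xInit) (hye0 : ∀ k, ye k 0 = yInit)
    (hxeode : ∀ k : ℕ, ∀ τ ∈ Set.Icc (0:ℝ) (t₀ / ε k),
      HasDerivAt (xe k) (ε k • f (xe k τ) (ye k τ)) τ)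
    (hyeode : ∀ k : ℕ, ∀ τ ∈ Set.Icc (0:ℝ) (t₀ / ε k),
      HasDerivAt (ye k) (g (xe k τ, ye k τ, τ)) τ)
    -- the slow components converge uniformly (in the slow time) to x₀
    (x0 : ℝ → EuclideanSpace ℝ (Fin n)) (hx0cont : ContinuousOn x0 (Set.Icc 0 t₀))
    (hconv : TendstoUniformlyOn (fun k t => xe k (t / ε k)) x0 atTop (Set.Icc 0 t₀))
    -- the radius of the compact tube K₀ around x₀
    (r : ℝ) (hr : 0 < r)
 :
    Tendsto (fun k : ℕ => sInf {δ : ℝ | 0 < δ ∧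
        Metric.infDist (ye k (t₀ / ε k))
          (inflFiber ev (slowTube x0 t₀ r) (σf (t₀ / ε k) g0) (x0 t₀) δ) ≤ δ})
      atTop (𝓝 0) := by
  have hevc : Continuous ev := hev.continuous
  have hL : ∀ h x, IsLipschitzOnBalls (ev h) x := fun h x =>
    isLipschitzOnBalls_of_mem_closure hlip (hrange ▸ mem_range_self h) x
  have hdense := denseRange_flow hev hrange hg0 hequiv
  have hsol : ∀ h x p z S, IsDrivenSolution ev (σf p h) (fun _ => x)
      (fun s => sol h x p z (p + s)) S := fun h x p z S =>
    IsDrivenSolution.of_shift (ξ := fun _ => x) (hequiv p h)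
      fun s hs => hsolode h x p z s hs.1
  have hsol0 : ∀ h x z S, IsDrivenSolution ev h (fun _ => x) (sol h x 0 z) S :=
    fun h x z S s hs => hsolode h x 0 z s hs.1
  have hTk : ∀ k, 0 < t₀ / ε k := fun k => div_pos ht₀ (hεpos k)
  have hTlim : Tendsto (fun k => t₀ / ε k) atTop atTop :=
    (Tendsto.inv_tendsto_nhdsGT_zero (tendsto_nhdsWithin_iff.2
      ⟨hεlim, Eventually.of_forall hεpos⟩)).const_mul_atTop ht₀
  have hK : IsCompact (x0 '' Icc 0 t₀) := isCompact_Icc.image_of_continuousOn hx0cont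
  obtain ⟨c, hc, hH2⟩ := hH2 _ hK
  have htail : ∀ d > 0, ∃ T > 0, ∀ h, ∀ x ∈ x0 '' Icc 0 t₀, ∀ τ ≥ T, ∀ z, ‖z‖ ≤ d →
      ‖sol h x 0 z τ‖ ≤ c := by
    intro d hd
    obtain ⟨T, hT, hTc⟩ := hH2 d hd
    refine ⟨T, hT, fun h x hx τ hτ z hz => ?_⟩
    refine norm_le_of_dense hevc (hL h x) hdense (hT.le.trans hτ) (hsol0 h x z τ) fun p =>
      ⟨_, hsol g0 x p z τ, ?_, ?_⟩
    · simp [hsolinit]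
    · rw [add_comm]
      exact hTc x hx p τ hτ z hz
  have hslow := fun (δ : ℝ) (hδ : 0 < δ) (S : ℝ) =>
    eventually_dist_slow_lt hεpos hεlim hx0cont hconv hδ S
  have hdriven : ∀ k p q, 0 ≤ p → p + q ≤ t₀ / ε k →
      IsDrivenSolution ev (σf p g0) (fun s => xe k (p + s)) (fun s => ye k (p + s)) q :=
    fun k p q hp hq => IsDrivenSolution.of_shift (hequiv p g0) fun s hs => by
      rw [hg0]
      exact hyeode k s ⟨hp.trans hs.1, hs.2.trans hq⟩
  obtain ⟨C, hC⟩ : ∃ C, ∀ᶠ k in atTop, ∀ τ ∈ Icc 0 (t₀ / ε k), ‖ye k τ‖ ≤ C := by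
    set d := max (c + 1) ‖yInit‖
    have hd0 : 0 < d := lt_max_of_lt_left (by linarith)
    obtain ⟨T, hT, hTc⟩ := htail d hd0
    obtain ⟨C, δ, hδ, hb⟩ := exists_uniform_bound hevc hL hK (V := fun h x z => sol h x 0 z)
      hT.le (fun h x z => hsolinit h x 0 z) (fun h x z => hsol0 h x z T)
      (fun h x hx z hz => hTc h x hx T le_rfl z hz)
    refine ⟨C, ?_⟩
    filter_upwards [hslow δ hδ T] with k hk
    refine norm_le_of_returns (d := d) hT (by rw [hye0]; exact le_max_right _ _)
      fun p q hp hq hqT hpq hpd => ?_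
    have hx : x0 (ε k * p) ∈ x0 '' Icc 0 t₀ := by
      refine ⟨_, ⟨mul_nonneg (hεpos k).le hp, ?_⟩, rfl⟩
      rw [mul_comm]
      exact (le_div_iff₀ (hεpos k)).1 (by linarith)
    have := hb (σf p g0) _ hx _ _ q hqT
      (fun s hs => hk p ⟨hp, by linarith⟩ (p + s) ⟨by linarith [hs.1], by linarith [hs.2]⟩ (by
        rw [add_sub_cancel_left, abs_of_nonneg hs.1]
        exact hs.2.trans hqT))
      (hdriven k p q hp hpq) (by simpa using hpd)
    refine ⟨this.1 q ⟨hq, le_rfl⟩, fun h => ?_⟩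
    rw [h]
    exact (this.2 h).trans (le_max_left _ _)
  set xT := x0 t₀ with hxT
  have hxK : xT ∈ x0 '' Icc 0 t₀ := ⟨t₀, ⟨ht₀.le, le_rfl⟩, rfl⟩
  have hclose : ∀ η > 0, ∀ᶠ k in atTop, infDist (ye k (t₀ / ε k))
      (inflFiber ev (slowTube x0 t₀ r) (σf (t₀ / ε k) g0) xT η) ≤ η := by
    intro η hη
    by_contra hbad
    rw [not_eventually, frequently_iff_neBot] at hbad
    set F := Ultrafilter.of (atTop ⊓ 𝓟 {k | ¬ infDist (ye k (t₀ / ε k))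
      (inflFiber ev (slowTube x0 t₀ r) (σf (t₀ / ε k) g0) xT η) ≤ η})
    have hFtop : (F : Filter ℕ) ≤ atTop := (Ultrafilter.of_le _).trans inf_le_left
    have hFbad : ∀ᶠ k in (F : Filter ℕ), ¬ infDist (ye k (t₀ / ε k))
        (inflFiber ev (slowTube x0 t₀ r) (σf (t₀ / ε k) g0) xT η) ≤ η :=
      (Ultrafilter.of_le _).trans inf_le_right (mem_principal_self _)
    obtain ⟨h, -, hh⟩ := isCompact_univ.ultrafilter_le_nhds
      (F.map fun k => σf (t₀ / ε k) g0) (by simp)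
    replace hh : Tendsto (fun k => σf (t₀ / ε k) g0) F (𝓝 h) := hh
    have hex : ∀ τ ≤ 0, ∃ z, ‖z‖ ≤ C ∧ Tendsto (fun k => ye k (t₀ / ε k + τ)) F (𝓝 z) := by
      intro τ hτ
      have hmem : ∀ᶠ k in (F : Filter ℕ), ye k (t₀ / ε k + τ) ∈ closedBall 0 C := by
        filter_upwards [hFtop hC, hFtop (hTlim.eventually_ge_atTop (-τ))] with k hk1 hk2
        exact mem_closedBall_zero_iff.2 (hk1 _ ⟨by linarith, by linarith⟩)
      obtain ⟨z, hz, hlim⟩ := (isCompact_closedBall (0 : EuclideanSpace ℝ (Fin m)) C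
        ).ultrafilter_le_nhds (F.map fun k => ye k (t₀ / ε k + τ)) (le_principal_iff.2 hmem)
      exact ⟨z, mem_closedBall_zero_iff.1 hz, hlim⟩
    choose! U hUC hU using hex
    have hback : ∀ p s, 0 ≤ s → p + s ≤ 0 → U (p + s) = sol h xT p (U p) (p + s) := by
      intro p s hs hps
      have hp : p ≤ 0 := by linarith
      refine dist_le_zero.1 (le_of_forall_pos_le_add fun ρ hρ => ?_)
      obtain ⟨δ, hδ, hd⟩ := exists_radius_dist_le hevc (hL (σf p h) xT)
        (hsol h xT p (U p) s) hρ
      have hσp : Tendsto (fun k => σf p (σf (t₀ / ε k) g0)) F (𝓝 (σf p h)) :=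
        ((hσcont.comp (Continuous.prodMk_right p)).tendsto h).comp hh
      rw [zero_add]
      refine le_of_tendsto ((hU (p + s) hps).dist tendsto_const_nhds) ?_
      filter_upwards [hFtop (hslow δ hδ (-p)), hFtop (hTlim.eventually_ge_atTop (-p)),
        hσp.eventually (ball_mem_nhds _ hδ), (hU p hp).eventually (ball_mem_nhds _ hδ)]
        with k hk1 hk2 hk3 hk4
      have hpt : ε k * (t₀ / ε k) = t₀ := mul_div_cancel₀ _ (hεpos k).ne'
      have := hd (σf p (σf (t₀ / ε k) g0)) _ _ s le_rfl hk3
        (fun s' hs' => by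
          have := hk1 (t₀ / ε k) ⟨(hTk k).le, le_rfl⟩ (t₀ / ε k + p + s')
            ⟨by linarith [hs'.1], by linarith [hs'.2]⟩
            (by rw [abs_le]; constructor <;> linarith [hs'.1, hs'.2])
          rwa [hpt] at this)
        (by
          rw [← hσadd, add_comm p]
          exact hdriven k (t₀ / ε k + p) s (by linarith) (by linarith))
        (by simpa [hsolinit] using hk4) s ⟨hs, le_rfl⟩
      simpa [add_assoc] using this
    set y : ℝ → EuclideanSpace ℝ (Fin m) :=
      fun τ => if τ ≤ 0 then U τ else sol h xT 0 (U 0) τ with hy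
    have hysol : ∀ p ≤ 0, ∀ τ, p ≤ τ → y τ = sol h xT p (U p) τ := by
      intro p hp τ hpτ
      by_cases hτ : τ ≤ 0
      · have := hback p (τ - p) (by linarith) (by linarith)
        rw [add_sub_cancel] at this
        simpa [hy, hτ] using this
      · have h0 : U 0 = sol h xT p (U p) 0 := by
          have := hback p (0 - p) (by linarith) (by linarith)
          rwa [add_sub_cancel] at this
        have hp' : IsDrivenSolution ev h (fun _ => xT) (sol h xT p (U p)) τ :=
          fun s hs => hsolode h xT p _ s (hp.trans hs.1)
        have := IsDrivenSolution.eqOn hevc (hL h xT) hp' (hsol0 h xT (U 0) τ)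
          (by rw [hsolinit, h0]) ⟨(not_le.1 hτ).le, le_rfl⟩
        simpa [hy, hτ] using this
    have hyderiv : ∀ τ, HasDerivAt y (ev h (xT, y τ, τ)) τ := by
      intro τ
      have hp0 : min τ 0 - 1 ≤ 0 := by linarith [min_le_right τ 0]
      have hpτ : min τ 0 - 1 < τ := by linarith [min_le_left τ 0]
      rw [hysol _ hp0 τ hpτ.le]
      refine (hsolode h xT (min τ 0 - 1) _ τ hpτ.le).congr_of_eventuallyEq ?_
      filter_upwards [Ioi_mem_nhds hpτ] with s hs
      exact hysol _ hp0 s (le_of_lt hs)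
    have hybdd : ∃ B, ∀ τ, ‖y τ‖ ≤ B := by
      obtain ⟨T, hT, hTc⟩ := htail (max C 1) (by positivity)
      have hyc : ContinuousOn y (Icc 0 T) :=
        fun τ _ => (hyderiv τ).continuousAt.continuousWithinAt
      obtain ⟨B, hB⟩ := (isCompact_Icc.image_of_continuousOn hyc).isBounded.exists_norm_le
      refine ⟨max C (max B c), fun τ => ?_⟩
      rcases le_total τ 0 with hτ | hτ
      · simpa [hy, hτ] using Or.inl (hUC τ hτ)
      · rcases le_total τ T with hτT | hτT
        · exact (hB _ ⟨τ, ⟨hτ, hτT⟩, rfl⟩).trans (by simp)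
        · rw [hysol 0 le_rfl τ hτ]
          exact (hTc h xT hxK τ hτT _ ((hUC 0 le_rfl).trans (le_max_left _ _))).trans (by simp)
    have hmem : U 0 ∈ attrFiber ev h xT := ⟨y, by simp [hy], hybdd, hyderiv⟩
    have hcon : ∀ᶠ k in (F : Filter ℕ), infDist (ye k (t₀ / ε k))
        (inflFiber ev (slowTube x0 t₀ r) (σf (t₀ / ε k) g0) xT η) ≤ η := by
      have hU0 := hU 0 le_rfl
      simp only [add_zero] at hU0
      filter_upwards [hh.eventually (ball_mem_nhds _ hη), hU0.eventually (ball_mem_nhds _ hη)]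
        with k hk1 hk2
      refine (infDist_le_dist_of_mem ?_).trans (le_of_lt hk2)
      refine mem_biUnion (x := (h, xT)) ⟨?_, ?_⟩ hmem
      · exact ⟨t₀, ⟨ht₀.le, le_rfl⟩, 0, by simpa using hr.le, by simp [hxT]⟩
      · simpa [hη.le] using le_of_lt hk1
    obtain ⟨k, hk1, hk2⟩ := (hFbad.and hcon).exists
    exact hk1 hk2
  refine Metric.tendsto_nhds.2 fun ρ hρ => ?_
  filter_upwards [hclose (ρ / 2) (half_pos hρ)] with k hk
  refine (Real.dist_0_eq_abs _).trans_lt (abs_lt.2 ⟨?_, ?_⟩)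
  · exact (neg_lt_zero.2 hρ).trans_le (Real.sInf_nonneg fun δ hδ => le_of_lt hδ.1)
  · refine lt_of_le_of_lt (csInf_le ?_ ?_) (half_lt_self hρ)
    · exact ⟨0, fun δ hδ => le_of_lt hδ.1⟩
    · exact ⟨half_pos hρ, hk⟩
end

section
/- If g·(t₀/ε_k) → h₀ in (H,d) as k → ∞, then h₀ belongs to the omega-limit set O(g) of g for the shift flow on H, and lim_{k→∞} dist(y_{ε_k}(t₀/ε_k), A_{(h₀, x₀(t₀))}) = 0. -/
open Filter Topology Metric Set

section Perturbation

variable {X Y : Type*} [NormedAddCommGroup X] [NormedAddCommGroup Y] [NormedSpace ℝ Y]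

/-- A Gronwall estimate in which the differential inequality is only required as long as the two
curves stay within the distance that the estimate gives. -/
lemma norm_sub_le_mul_exp_of_deriv_le {u v u' v' : ℝ → Y} {α β L δ : ℝ} (hδ : 0 < δ) (hL : 0 ≤ L)
    (hu : ∀ t ∈ Icc α β, HasDerivAt u (u' t) t) (hv : ∀ t ∈ Icc α β, HasDerivAt v (v' t) t)
    (h0 : ‖v α - u α‖ ≤ δ)
    (hd : ∀ t ∈ Icc α β, ‖v t - u t‖ ≤ δ * Real.exp ((L + 2) * (β - α)) →
      ‖v' t - u' t‖ ≤ δ + L * ‖v t - u t‖) :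
    ∀ t ∈ Icc α β, ‖v t - u t‖ ≤ δ * Real.exp ((L + 2) * (t - α)) := by
  have hB : ∀ t, HasDerivAt (fun t => δ * Real.exp ((L + 2) * (t - α)))
      (δ * (Real.exp ((L + 2) * (t - α)) * ((L + 2) * 1))) t := fun t =>
    ((((hasDerivAt_id t).sub_const α).const_mul (L + 2)).exp).const_mul δ
  refine image_norm_le_of_norm_deriv_right_lt_deriv_boundary (f := fun t => v t - u t)
    (f' := fun t => v' t - u' t)
    (fun t ht => ((hv t ht).sub (hu t ht)).continuousAt.continuousWithinAt)
    (fun t ht => ((hv t (Ico_subset_Icc_self ht)).sub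
      (hu t (Ico_subset_Icc_self ht))).hasDerivWithinAt) (by simpa using h0) hB ?_
  intro t ht heq
  have h1 : (1 : ℝ) ≤ Real.exp ((L + 2) * (t - α)) :=
    Real.one_le_exp (mul_nonneg (by linarith) (by linarith [ht.1]))
  have h2 := hd t (Ico_subset_Icc_self ht) (by
    rw [heq]
    have := ht.2.le
    gcongr)
  rw [heq] at h2
  nlinarith [mul_le_mul_of_nonneg_left h1 hδ.le]

/-- Solutions of `y' = φ (x, y, τ)` on a compact time interval are stable under perturbations of
the initial value, of the parameter (which may become time dependent) and of the vector field. -/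
lemma exists_eventually_norm_sub_le [ProperSpace X] [ProperSpace Y] (φ : C(X × Y × ℝ, Y)) (x : X)
    (hlip : ∀ R : ℝ, ∃ L ≥ (0 : ℝ), ∀ y₁ y₂, ‖y₁‖ ≤ R → ‖y₂‖ ≤ R → ∀ τ : ℝ,
      ‖φ (x, y₁, τ) - φ (x, y₂, τ)‖ ≤ L * ‖y₁ - y₂‖)
    {u : ℝ → Y} {α β : ℝ} (hu : ∀ t ∈ Icc α β, HasDerivAt u (φ (x, u t, t)) t)
    {ρ : ℝ} (hρ : 0 < ρ) :
    ∃ η > 0, ∀ᶠ ψ in 𝓝 φ, ∀ γ ≤ β, ∀ (ξ : ℝ → X) (v : ℝ → Y), ‖v α - u α‖ < η →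
      (∀ t ∈ Icc α γ, ‖ξ t - x‖ < η) →
      (∀ t ∈ Icc α γ, HasDerivAt v (ψ (ξ t, v t, t)) t) →
      ∀ t ∈ Icc α γ, ‖v t - u t‖ ≤ ρ := by
  have hucont : ContinuousOn u (Icc α β) := fun t ht => (hu t ht).continuousAt.continuousWithinAt
  obtain ⟨R, hR⟩ := isCompact_Icc.exists_bound_of_continuousOn hucont
  obtain ⟨L, hL, hLip⟩ := hlip (R + ρ)
  set δ := ρ * Real.exp (-((L + 2) * (β - α))) with hδdef
  have hδ : 0 < δ := by positivity
  have hδρ : δ * Real.exp ((L + 2) * (β - α)) = ρ := by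
    rw [hδdef, mul_assoc, ← Real.exp_add]; simp
  have hK : IsCompact (closedBall x 1 ×ˢ closedBall (0 : Y) (R + ρ) ×ˢ Icc α β) :=
    (isCompact_closedBall x 1).prod ((isCompact_closedBall 0 _).prod isCompact_Icc)
  set K := closedBall x 1 ×ˢ closedBall (0 : Y) (R + ρ) ×ˢ Icc α β
  obtain ⟨η, hη, hηuc⟩ := Metric.uniformContinuousOn_iff.1
    (hK.uniformContinuousOn_of_continuous φ.continuous.continuousOn) (δ / 2) (by positivity)
  have hU : ∀ᶠ ψ in 𝓝 φ, ∀ p ∈ K, dist (φ p) (ψ p) < δ / 2 :=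
    Metric.tendstoUniformlyOn_iff.1
      (ContinuousMap.tendsto_iff_forall_isCompact_tendstoUniformlyOn.1
        (tendsto_id (x := 𝓝 φ)) K hK) (δ / 2) (by positivity)
  refine ⟨min (min η 1) δ, by positivity, hU.mono fun ψ hψ γ hγ ξ v hv0 hξ hv t ht => ?_⟩
  have hsub : Icc α γ ⊆ Icc α β := Icc_subset_Icc_right hγ
  have hexp : ∀ s ∈ Icc α β, δ * Real.exp ((L + 2) * (s - α)) ≤ ρ := fun s hs => by
    rw [← hδρ]
    have := hs.2
    gcongr
  refine (norm_sub_le_mul_exp_of_deriv_le hδ hL (fun s hs => hu s (hsub hs)) hv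
    (hv0.le.trans (min_le_right _ _)) (fun s hs hle => ?_) t ht).trans (hexp t (hsub ht))
  have hle' : ‖v s - u s‖ ≤ ρ :=
    hle.trans (hexp γ ⟨hs.1.trans hs.2, hγ⟩)
  have hus := hR s (hsub hs)
  have hvs : ‖v s‖ ≤ R + ρ := by
    calc ‖v s‖ = ‖u s + (v s - u s)‖ := by rw [add_sub_cancel]
      _ ≤ R + ρ := (norm_add_le _ _).trans (add_le_add hus hle')
  have hξs := hξ s hs
  have hξη : ‖ξ s - x‖ < η := hξs.trans_le ((min_le_left _ _).trans (min_le_left _ _))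
  have hξ1 : ‖ξ s - x‖ ≤ 1 := (hξs.trans_le ((min_le_left _ _).trans (min_le_right _ _))).le
  have hmem1 : (ξ s, v s, s) ∈ K :=
    ⟨by simpa [dist_eq_norm] using hξ1, by simpa using hvs, hsub hs⟩
  have hmem2 : (x, v s, s) ∈ K := ⟨by simp, by simpa using hvs, hsub hs⟩
  have e1 := hψ _ hmem1
  have e2 := hηuc _ hmem1 _ hmem2 (by simpa [Prod.dist_eq, dist_eq_norm, hη] using hξη)
  have e3 := hLip (v s) (u s) hvs (by linarith) s
  rw [dist_comm, dist_eq_norm] at e1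
  rw [dist_eq_norm] at e2
  calc ‖ψ (ξ s, v s, s) - φ (x, u s, s)‖
      = ‖(ψ (ξ s, v s, s) - φ (ξ s, v s, s)) + (φ (ξ s, v s, s) - φ (x, v s, s))
          + (φ (x, v s, s) - φ (x, u s, s))‖ := by congr 1; abel
    _ ≤ δ / 2 + δ / 2 + L * ‖v s - u s‖ :=
        (norm_add₃_le).trans (add_le_add (add_le_add e1.le e2.le) e3)
    _ = δ + L * ‖v s - u s‖ := by ring

/-- Uniqueness of solutions for vector fields that are locally Lipschitz in the state. -/
lemma eq_of_hasDerivAt_of_lipschitz [ProperSpace X] [ProperSpace Y] (φ : C(X × Y × ℝ, Y)) (x : X)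
    (hlip : ∀ R : ℝ, ∃ L ≥ (0 : ℝ), ∀ y₁ y₂, ‖y₁‖ ≤ R → ‖y₂‖ ≤ R → ∀ τ : ℝ,
      ‖φ (x, y₁, τ) - φ (x, y₂, τ)‖ ≤ L * ‖y₁ - y₂‖)
    {u v : ℝ → Y} {α β : ℝ} (hαβ : α ≤ β) (hu : ∀ t ∈ Icc α β, HasDerivAt u (φ (x, u t, t)) t)
    (hv : ∀ t ∈ Icc α β, HasDerivAt v (φ (x, v t, t)) t) (h0 : v α = u α) : v β = u β := by
  rw [← sub_eq_zero, ← norm_le_zero_iff]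
  refine le_of_forall_pos_le_add fun ρ hρ => ?_
  obtain ⟨η, hη, hev⟩ := exists_eventually_norm_sub_le φ x hlip hu hρ
  simpa using hev.self_of_nhds β le_rfl (fun _ => x) v (by simpa [h0] using hη)
    (by simpa using fun _ _ _ => hη) hv β ⟨hαβ, le_rfl⟩

/-- Over a compact family of vector fields, parameters and initial values, the solutions on a fixed
time interval are bounded uniformly, even if the parameter drifts slightly. -/
lemma exists_uniform_bound_of_drifting_parameter [ProperSpace X] [ProperSpace Y]
    {H : Type*} [TopologicalSpace H] [CompactSpace H]
    {ev : H → C(X × Y × ℝ, Y)} (hev : Continuous ev)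
    (hlip : ∀ h x, ∀ R : ℝ, ∃ L ≥ (0 : ℝ), ∀ y₁ y₂, ‖y₁‖ ≤ R → ‖y₂‖ ≤ R → ∀ τ : ℝ,
      ‖ev h (x, y₁, τ) - ev h (x, y₂, τ)‖ ≤ L * ‖y₁ - y₂‖)
    {K : Set X} (hK : IsCompact K) {B : Set Y} (hB : IsCompact B) {T c : ℝ} (hT : 0 ≤ T)
    (u : H → X → Y → ℝ → Y) (hu0 : ∀ h x y, u h x y 0 = y)
    (hu : ∀ h x y, ∀ t, 0 ≤ t → HasDerivAt (u h x y) (ev h (x, u h x y t, t)) t)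
    (hb : ∀ h, ∀ x ∈ K, ∀ y ∈ B, ‖u h x y T‖ ≤ c) :
    ∃ D, ∃ η > 0, ∀ h, ∀ x ∈ K, ∀ γ ≤ T, ∀ (ξ : ℝ → X) (v : ℝ → Y), v 0 ∈ B →
      (∀ t ∈ Icc 0 γ, ‖ξ t - x‖ < η) →
      (∀ t ∈ Icc 0 γ, HasDerivAt v (ev h (ξ t, v t, t)) t) →
      (∀ t ∈ Icc 0 γ, ‖v t‖ ≤ D) ∧ (γ = T → ‖v T‖ ≤ c + 1) := by
  suffices key : ∃ D, ∃ η > 0, ∀ p ∈ (univ : Set H) ×ˢ K ×ˢ B, ∀ γ ≤ T, ∀ (ξ : ℝ → X) (v : ℝ → Y),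
      v 0 = p.2.2 → (∀ t ∈ Icc 0 γ, ‖ξ t - p.2.1‖ < η) →
      (∀ t ∈ Icc 0 γ, HasDerivAt v (ev p.1 (ξ t, v t, t)) t) →
      (∀ t ∈ Icc 0 γ, ‖v t‖ ≤ D) ∧ (γ = T → ‖v T‖ ≤ c + 1) by
    obtain ⟨D, η, hη, h⟩ := key
    exact ⟨D, η, hη, fun h' x hx γ hγ ξ v hv => h (h', x, v 0) ⟨mem_univ _, hx, hv⟩ γ hγ ξ v rfl⟩
  refine (isCompact_univ.prod (hK.prod hB)).induction_on ⟨0, 1, one_pos, by simp⟩ ?_ ?_ ?_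
  · rintro s t hst ⟨D, η, hη, h⟩
    exact ⟨D, η, hη, fun p hp => h p (hst hp)⟩
  · rintro s t ⟨D₁, η₁, hη₁, h₁⟩ ⟨D₂, η₂, hη₂, h₂⟩
    refine ⟨max D₁ D₂, min η₁ η₂, lt_min hη₁ hη₂, ?_⟩
    rintro p (hp | hp) γ hγ ξ v hv hξ hode
    · have := h₁ p hp γ hγ ξ v hv (fun t ht => (hξ t ht).trans_le (min_le_left _ _)) hode
      exact ⟨fun t ht => (this.1 t ht).trans (le_max_left _ _), this.2⟩
    · have := h₂ p hp γ hγ ξ v hv (fun t ht => (hξ t ht).trans_le (min_le_right _ _)) hode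
      exact ⟨fun t ht => (this.1 t ht).trans (le_max_right _ _), this.2⟩
  · rintro ⟨h, x, y⟩ ⟨-, hx, hy⟩
    obtain ⟨R, hR⟩ := (isCompact_Icc (a := (0 : ℝ)) (b := T)).exists_bound_of_continuousOn
      (f := u h x y) fun t ht => (hu h x y t ht.1).continuousAt.continuousWithinAt
    obtain ⟨η, hη, hU⟩ := exists_eventually_norm_sub_le (ev h) x (hlip h x)
      (fun t ht => hu h x y t ht.1) (α := 0) (β := T) one_pos
    refine ⟨_, mem_nhdsWithin_of_mem_nhds (prod_mem_nhds (hev.continuousAt.eventually hU)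
      (prod_mem_nhds (ball_mem_nhds x (half_pos hη)) (ball_mem_nhds y hη))),
      R + 1, η / 2, half_pos hη, ?_⟩
    rintro ⟨h', x', y'⟩ ⟨hh', hx', hy'⟩ γ hγ ξ v hv hξ hode
    simp only [mem_ball, dist_eq_norm] at hx' hy' hv hξ hode
    have hclose := hh' γ hγ ξ v (by rwa [hv, hu0]) (fun t ht => by
      calc ‖ξ t - x‖ = ‖(ξ t - x') + (x' - x)‖ := by rw [sub_add_sub_cancel]
        _ ≤ ‖ξ t - x'‖ + ‖x' - x‖ := norm_add_le _ _
        _ < η := by linarith [hξ t ht]) hode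
    have htri : ∀ t ∈ Icc 0 γ, ‖v t‖ ≤ ‖u h x y t‖ + 1 := fun t ht => by
      calc ‖v t‖ = ‖u h x y t + (v t - u h x y t)‖ := by rw [add_sub_cancel]
        _ ≤ _ := (norm_add_le _ _).trans (by linarith [hclose t ht])
    refine ⟨fun t ht => (htri t ht).trans ?_, ?_⟩
    · linarith [hR t ⟨ht.1, ht.2.trans hγ⟩]
    · rintro rfl
      linarith [htri γ ⟨hT, le_rfl⟩, hb h x hx y hy]

/-- A bound that reproduces itself after each time step `T` propagates. -/
lemma norm_le_of_step_bound {E : Type*} [Norm E] {y : ℝ → E} {T S d D : ℝ} (hT : 0 < T) (h0 : ‖y 0‖ ≤ d)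
    (hstep : ∀ τ ≥ 0, ‖y τ‖ ≤ d → ∀ γ ≥ 0, γ ≤ T → τ + γ ≤ S →
      ‖y (τ + γ)‖ ≤ D ∧ (γ = T → ‖y (τ + γ)‖ ≤ d)) :
    ∀ τ ∈ Icc 0 S, ‖y τ‖ ≤ D := by
  have hgrid : ∀ j : ℕ, (j : ℝ) * T ≤ S → ‖y (j * T)‖ ≤ d := by
    intro j
    induction j with
    | zero => simpa using fun _ => h0
    | succ j ih =>
      intro hj
      push_cast [add_mul] at hj ⊢
      rw [one_mul] at hj ⊢
      exact (hstep (j * T) (by positivity) (ih (by linarith)) T hT.le le_rfl hj).2 rfl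
  rintro τ ⟨h1, h2⟩
  have hj1 : (⌊τ / T⌋₊ : ℝ) * T ≤ τ := (le_div_iff₀ hT).1 (Nat.floor_le (by positivity))
  have hj2 : τ < (⌊τ / T⌋₊ + 1 : ℝ) * T := (div_lt_iff₀ hT).1 (Nat.lt_floor_add_one _)
  have := (hstep (⌊τ / T⌋₊ * T) (by positivity) (hgrid _ (hj1.trans h2)) (τ - ⌊τ / T⌋₊ * T)
    (by linarith) (by linarith) (by linarith)).1
  rwa [add_sub_cancel] at this

/-- Compatible solutions on the half-lines `[-j, ∞)` glue to an entire solution. -/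
lemma exists_entire_of_compatible {G : ℝ → Y → Y} {w : ℕ → ℝ → Y}
    (hw : ∀ j : ℕ, ∀ t : ℝ, -(j : ℝ) ≤ t → HasDerivAt (w j) (G t (w j t)) t)
    (hcomp : ∀ j : ℕ, ∀ t : ℝ, -(j : ℝ) ≤ t → w (j + 1) t = w j t) :
    ∃ y : ℝ → Y, (∀ j : ℕ, ∀ t : ℝ, -(j : ℝ) ≤ t → y t = w j t) ∧
      ∀ t, HasDerivAt y (G t (y t)) t := by
  have hle : ∀ i j : ℕ, i ≤ j → ∀ t : ℝ, -(i : ℝ) ≤ t → w j t = w i t := by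
    intro i j hij
    induction j, hij using Nat.le_induction with
    | base => exact fun _ _ => rfl
    | succ j hij ih =>
      intro t ht
      have : (i : ℝ) ≤ j := by exact_mod_cast hij
      rw [hcomp j t (by linarith), ih t ht]
  have hy : ∀ j : ℕ, ∀ t : ℝ, -(j : ℝ) ≤ t → w ⌈-t⌉₊ t = w j t := fun j t ht =>
    (hle _ j (Nat.ceil_le.2 (by linarith)) t (by linarith [Nat.le_ceil (-t)])).symm
  refine ⟨fun t => w ⌈-t⌉₊ t, hy, fun t => ?_⟩
  obtain ⟨j, hj⟩ := exists_nat_gt (-t)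
  have hjt : -(j : ℝ) < t := by linarith
  show HasDerivAt _ (G t (w ⌈-t⌉₊ t)) t
  rw [hy j t hjt.le]
  exact (hw j t hjt.le).congr_of_eventuallyEq
    ((eventually_gt_nhds hjt).mono fun s hs => hy j s hs.le)

end Perturbation

/-- Elements of the hull inherit local Lipschitz continuity in the state. -/
lemma IsLipschitzInY.of_mem_closure {n m : ℕ}
    {g φ : C(EuclideanSpace ℝ (Fin n) × EuclideanSpace ℝ (Fin m) × ℝ, EuclideanSpace ℝ (Fin m))}
    (hlip : IsLipschitzInY g) (hφ : φ ∈ closure {h | ∃ s : ℝ, h = timeTranslate s g})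
    (x : EuclideanSpace ℝ (Fin n)) (R : ℝ) :
    ∃ L ≥ (0 : ℝ), ∀ y₁ y₂, ‖y₁‖ ≤ R → ‖y₂‖ ≤ R → ∀ τ : ℝ,
      ‖φ (x, y₁, τ) - φ (x, y₂, τ)‖ ≤ L * ‖y₁ - y₂‖ := by
  obtain ⟨L, hL, h⟩ := hlip {x} isCompact_singleton (closedBall 0 R) (isCompact_closedBall 0 R)
  refine ⟨L, hL.le, fun y₁ y₂ h₁ h₂ τ => ?_⟩
  have hclosed : IsClosed {ψ : C(EuclideanSpace ℝ (Fin n) × EuclideanSpace ℝ (Fin m) × ℝ,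
      EuclideanSpace ℝ (Fin m)) | ‖ψ (x, y₁, τ) - ψ (x, y₂, τ)‖ ≤ L * ‖y₁ - y₂‖} :=
    isClosed_le (by fun_prop) continuous_const
  refine closure_minimal ?_ hclosed hφ
  rintro _ ⟨s, rfl⟩
  exact h x rfl y₁ (by simpa using h₁) y₂ (by simpa using h₂) (τ + s)

/-- Elements of the hull inherit the uniform ultimate bound. -/
lemma norm_le_of_mem_closure_timeTranslate {n m : ℕ}
    {g φ : C(EuclideanSpace ℝ (Fin n) × EuclideanSpace ℝ (Fin m) × ℝ, EuclideanSpace ℝ (Fin m))}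
    (hlip : IsLipschitzInY g) (hφ : φ ∈ closure {h | ∃ s : ℝ, h = timeTranslate s g})
    {x : EuclideanSpace ℝ (Fin n)} {y₀ : EuclideanSpace ℝ (Fin m)} {T c : ℝ} (hT : 0 ≤ T)
    {S : ℝ → ℝ → EuclideanSpace ℝ (Fin m)} (hS0 : ∀ τ₀, S τ₀ τ₀ = y₀)
    (hS : ∀ τ₀ τ, τ₀ ≤ τ → HasDerivAt (S τ₀) (g (x, S τ₀ τ, τ)) τ)
    (hb : ∀ τ₀, ∀ τ ≥ T, ‖S τ₀ (τ + τ₀)‖ ≤ c)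
    {u : ℝ → EuclideanSpace ℝ (Fin m)} {α β : ℝ} (hαβ : α + T ≤ β) (hu0 : u α = y₀)
    (hu : ∀ t ∈ Icc α β, HasDerivAt u (φ (x, u t, t)) t) : ‖u β‖ ≤ c := by
  refine le_of_forall_pos_le_add fun ρ hρ => ?_
  obtain ⟨η, hη, hU⟩ := exists_eventually_norm_sub_le φ x (hlip.of_mem_closure hφ x) hu hρ
  obtain ⟨_, hs, s, rfl⟩ := mem_closure_iff_nhds.1 hφ _ hU
  have hclose := hs β le_rfl (fun _ => x) (fun t => S (α + s) (t + s))
    (by simpa [hS0, hu0] using hη) (by simpa using fun _ _ _ => hη)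
    (fun t ht => (hS (α + s) (t + s) (by linarith [ht.1])).comp_add_const t s)
    β ⟨by linarith, le_rfl⟩
  have hbd := hb (α + s) (β - α) (by linarith)
  rw [show β - α + (α + s) = β + s by ring] at hbd
  calc ‖u β‖ = ‖S (α + s) (β + s) - (S (α + s) (β + s) - u β)‖ := by rw [sub_sub_cancel]
    _ ≤ c + ρ := (norm_sub_le _ _).trans (add_le_add hbd hclose)

/-- if g·(t₀/ε_k) → h₀ then h₀ ∈ O(g) and the fast final values approach the fiber A_{(h₀,x₀(t₀))}. -/
theorem stmt_10
    {n m : ℕ} (hn : 1 ≤ n) (hm : 1 ≤ m)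
    -- g, admissible and Lipschitz in y on compacts
    (g : C(EuclideanSpace ℝ (Fin n) × EuclideanSpace ℝ (Fin m) × ℝ,
      EuclideanSpace ℝ (Fin m)))
    (hadm : IsAdmissibleMap g) (hlip : IsLipschitzInY g)
    -- the hull H of g, a compact metric space with the continuous shift flow,
    -- identified via the embedding ev with the closure of the translates of g
    (H : Type) [MetricSpace H] [CompactSpace H]
    (σf : ℝ → H → H)
    (hσcont : Continuous fun p : ℝ × H => σf p.1 p.2)
    (hσ0 : ∀ h, σf 0 h = h)
    (hσadd : ∀ s t : ℝ, ∀ h, σf (s + t) h = σf s (σf t h))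
    (ev : H → C(EuclideanSpace ℝ (Fin n) × EuclideanSpace ℝ (Fin m) × ℝ,
      EuclideanSpace ℝ (Fin m)))
    (hev : Topology.IsEmbedding ev)
    (hrange : Set.range ev = closure {h | ∃ s : ℝ, h = timeTranslate s g})
    (g0 : H) (hg0 : ev g0 = g)
    (hequiv : ∀ (s : ℝ) (h : H), ev (σf s h) = timeTranslate s (ev h))
    -- the (unique, maximal) solutions y(τ,h,x,τ₀,y₀) of y' = h(x,y,τ)
    (sol : H → EuclideanSpace ℝ (Fin n) → ℝ → EuclideanSpace ℝ (Fin m) → ℝ →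
      EuclideanSpace ℝ (Fin m))
    (hsolinit : ∀ h x τ₀ y₀, sol h x τ₀ y₀ τ₀ = y₀)
    -- (H1): all solutions over the hull are globally defined in the future
    (hsolode : ∀ h x (τ₀ : ℝ) y₀ (τ : ℝ), τ₀ ≤ τ →
      HasDerivAt (sol h x τ₀ y₀) (ev h (x, sol h x τ₀ y₀ τ, τ)) τ)
    -- (H2): uniform ultimate boundedness over compact sets of parameters
    (hH2 : ∀ K₀ : Set (EuclideanSpace ℝ (Fin n)), IsCompact K₀ →
      ∃ c > (0:ℝ), ∀ d > (0:ℝ), ∃ T > (0:ℝ), ∀ x ∈ K₀, ∀ τ₀ : ℝ, ∀ τ ≥ T,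
        ∀ y₀ : EuclideanSpace ℝ (Fin m), ‖y₀‖ ≤ d → ‖sol g0 x τ₀ y₀ (τ + τ₀)‖ ≤ c)
    -- the slow vector field f, continuous and of linear growth
    (f : EuclideanSpace ℝ (Fin n) → EuclideanSpace ℝ (Fin m) → EuclideanSpace ℝ (Fin n))
    (hf : Continuous fun p : EuclideanSpace ℝ (Fin n) × EuclideanSpace ℝ (Fin m) =>
      f p.1 p.2)
    (a b : ℝ) (ha : 0 < a) (hb : 0 < b)
    (hgrowth : ∀ x y, ‖f x y‖ ≤ a + b * ‖x‖)
    -- initial data, final slow time, the sequence ε_k ↓ 0, and the solutions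
    -- (x_{ε_k}, y_{ε_k}) of the slow-fast system in the fast time
    (xInit : EuclideanSpace ℝ (Fin n)) (yInit : EuclideanSpace ℝ (Fin m))
    (t₀ : ℝ) (ht₀ : 0 < t₀)
    (ε : ℕ → ℝ) (hεpos : ∀ k, 0 < ε k) (hεanti : StrictAnti ε)
    (hεlim : Tendsto ε atTop (𝓝 0))
    (xe : ℕ → ℝ → EuclideanSpace ℝ (Fin n)) (ye : ℕ → ℝ → EuclideanSpace ℝ (Fin m))
    (hxe0 : ∀ k, xe k 0 = xInit) (hye0 : ∀ k, ye k 0 = yInit)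
    (hxeode : ∀ k : ℕ, ∀ τ ∈ Set.Icc (0:ℝ) (t₀ / ε k),
      HasDerivAt (xe k) (ε k • f (xe k τ) (ye k τ)) τ)
    (hyeode : ∀ k : ℕ, ∀ τ ∈ Set.Icc (0:ℝ) (t₀ / ε k),
      HasDerivAt (ye k) (g (xe k τ, ye k τ, τ)) τ)
    -- the slow components converge uniformly (in the slow time) to x₀
    (x0 : ℝ → EuclideanSpace ℝ (Fin n)) (hx0cont : ContinuousOn x0 (Set.Icc 0 t₀))
    (hconv : TendstoUniformlyOn (fun k t => xe k (t / ε k)) x0 atTop (Set.Icc 0 t₀))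
    -- the radius of the compact tube K₀ around x₀
    (r : ℝ) (hr : 0 < r)
    (h₀ : H) (hlim : Tendsto (fun k : ℕ => σf (t₀ / ε k) g0) atTop (𝓝 h₀)) :
    h₀ ∈ omegaSet σf g0 ∧
      Tendsto (fun k : ℕ => Metric.infDist (ye k (t₀ / ε k)) (attrFiber ev h₀ (x0 t₀)))
        atTop (𝓝 0) := by
  have hS : Tendsto (fun k => t₀ / ε k) atTop atTop :=
    (tendsto_inv_nhdsGT_zero.comp (tendsto_nhdsWithin_iff.2
      ⟨hεlim, Eventually.of_forall hεpos⟩)).const_mul_atTop ht₀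
  have hSpos : ∀ k, 0 ≤ t₀ / ε k := fun k => (div_pos ht₀ (hεpos k)).le
  refine ⟨mem_iInter₂.2 fun s _ => mem_closure_of_tendsto hlim
    ((hS.eventually_ge_atTop s).mono fun k hk => ⟨_, hk, rfl⟩), ?_⟩
  have hcl : ∀ h, ev h ∈ closure {h | ∃ s : ℝ, h = timeTranslate s g} := fun h =>
    hrange ▸ mem_range_self h
  have hLip := fun h => hlip.of_mem_closure (hcl h)
  -- the slow components stay in a fixed ball
  obtain ⟨R₀, hR₀⟩ := isCompact_Icc.exists_bound_of_continuousOn hx0cont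
  obtain ⟨R, hR⟩ : ∃ R, ∀ᶠ k in atTop, ∀ τ ∈ Icc 0 (t₀ / ε k), ‖xe k τ‖ ≤ R := by
    refine ⟨R₀ + 1, (Metric.tendstoUniformlyOn_iff.1 hconv 1 one_pos).mono fun k hk τ hτ => ?_⟩
    have hmem : ε k * τ ∈ Icc 0 t₀ :=
      ⟨mul_nonneg (hεpos k).le hτ.1, by
        have := (le_div_iff₀ (hεpos k)).1 hτ.2
        rwa [mul_comm]⟩
    have h1 := hk _ hmem
    rw [mul_div_cancel_left₀ _ (hεpos k).ne', dist_eq_norm] at h1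
    calc ‖xe k τ‖ = ‖x0 (ε k * τ) - (x0 (ε k * τ) - xe k τ)‖ := by rw [sub_sub_cancel]
      _ ≤ R₀ + 1 := (norm_sub_le _ _).trans (add_le_add (hR₀ _ hmem) h1.le)
  -- and drift slowly
  have hdrift : ∀ (T η : ℝ), 0 < η → ∀ᶠ k in atTop, ∀ τ₁ ∈ Icc 0 (t₀ / ε k),
      ∀ τ₂ ∈ Icc 0 (t₀ / ε k), |τ₁ - τ₂| ≤ T → ‖xe k τ₁ - xe k τ₂‖ < η := by
    intro T η hη
    have hlim0 : Tendsto (fun k => ε k * (a + b * R) * T) atTop (𝓝 0) := by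
      simpa using (hεlim.mul_const (a + b * R)).mul_const T
    filter_upwards [hR, hlim0.eventually_lt_const hη] with k hk hlt τ₁ h₁ τ₂ h₂ h₁₂
    have hbd : ∀ τ ∈ Icc 0 (t₀ / ε k), ‖ε k • f (xe k τ) (ye k τ)‖ ≤ ε k * (a + b * R) := by
      intro τ hτ
      rw [norm_smul, Real.norm_of_nonneg (hεpos k).le]
      have := hk τ hτ
      have := (hεpos k).le
      exact mul_le_mul_of_nonneg_left ((hgrowth _ _).trans (by gcongr)) this
    have h3 := (convex_Icc 0 (t₀ / ε k)).norm_image_sub_le_of_norm_hasDerivWithin_le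
      (fun τ hτ => (hxeode k τ hτ).hasDerivWithinAt) hbd h₂ h₁
    refine lt_of_le_of_lt (h3.trans ?_) hlt
    exact mul_le_mul_of_nonneg_left h₁₂ ((norm_nonneg _).trans (hbd _ h₁))
  -- transfer of the ultimate bound to the hull
  have hKc : IsCompact (closedBall (0 : EuclideanSpace ℝ (Fin n)) R) := isCompact_closedBall 0 R
  obtain ⟨c, hc, hcT⟩ := hH2 _ hKc
  have hult : ∀ d > 0, ∃ T > 0, ∀ h, ∀ x ∈ closedBall (0 : EuclideanSpace ℝ (Fin n)) R,
      ∀ y₀ : EuclideanSpace ℝ (Fin m), ‖y₀‖ ≤ d → ∀ α β : ℝ, α + T ≤ β →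
        ‖sol h x α y₀ β‖ ≤ c := by
    intro d hd
    obtain ⟨T, hT, hTb⟩ := hcT d hd
    refine ⟨T, hT, fun h x hx y₀ hy₀ α β hαβ => ?_⟩
    exact norm_le_of_mem_closure_timeTranslate hlip (hcl h) hT.le
      (S := fun τ₀ => sol g0 x τ₀ y₀) (fun τ₀ => hsolinit _ _ _ _)
      (fun τ₀ τ hτ => hg0 ▸ hsolode g0 x τ₀ y₀ τ hτ)
      (fun τ₀ τ hτ => hTb x hx τ₀ τ hτ y₀ hy₀) hαβ (hsolinit _ _ _ _)
      (fun t ht => hsolode h x α y₀ t ht.1)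
  -- the fast components, read off along the shift flow, solve equations of the hull
  have hshift : ∀ k, ∀ s t : ℝ, t + s ∈ Icc 0 (t₀ / ε k) →
      HasDerivAt (fun t => ye k (t + s))
        (ev (σf s g0) (xe k (t + s), ye k (t + s), t)) t := by
    intro k s t ht
    have := (hyeode k (t + s) ht).comp_add_const t s
    rw [hequiv, hg0]
    exact this
  -- the fast components are bounded uniformly
  obtain ⟨D, hD⟩ : ∃ D, ∀ᶠ k in atTop, ∀ τ ∈ Icc 0 (t₀ / ε k), ‖ye k τ‖ ≤ D := by
    set d := max (c + 1) ‖yInit‖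
    have hd : 0 < d := lt_max_of_lt_left (by linarith)
    obtain ⟨T, hT, hTb⟩ := hult d hd
    obtain ⟨D, η, hη, hDη⟩ := exists_uniform_bound_of_drifting_parameter hev.continuous hLip hKc
      (isCompact_closedBall (0 : EuclideanSpace ℝ (Fin m)) d) hT.le (fun h x y => sol h x 0 y)
      (fun h x y => hsolinit h x 0 y) (fun h x y t ht => hsolode h x 0 y t ht)
      (fun h x hx y hy => hTb h x hx y (by simpa using hy) 0 T (by simp))
    refine ⟨D, ?_⟩
    filter_upwards [hR, hdrift T η hη] with k hRk hdk
    refine norm_le_of_step_bound hT (d := d) (by rw [hye0]; exact le_max_right _ _)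
      fun τ hτ hyτ γ hγ hγT hτγ => ?_
    have hmem : ∀ t ∈ Icc 0 γ, t + τ ∈ Icc 0 (t₀ / ε k) := fun t ht =>
      ⟨by linarith [ht.1], by linarith [ht.2]⟩
    have hτmem : τ ∈ Icc 0 (t₀ / ε k) := ⟨hτ, by linarith⟩
    obtain ⟨h1, h2⟩ := hDη (σf τ g0) (xe k τ) (by simpa using hRk τ hτmem) γ hγT
      (fun t => xe k (t + τ)) (fun t => ye k (t + τ)) (by simpa using hyτ)
      (fun t ht => hdk _ (hmem t ht) _ hτmem (by
        rw [add_sub_cancel_right, abs_of_nonneg ht.1]; exact ht.2.trans hγT))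
      (fun t ht => hshift k τ t (hmem t ht))
    rw [add_comm τ γ]
    refine ⟨h1 γ ⟨hγ, le_rfl⟩, ?_⟩
    rintro rfl
    exact (h2 rfl).trans (le_max_left _ _)
  -- every subsequence has a further subsequence along which the distance tends to zero
  refine tendsto_of_subseq_tendsto fun ns hns => ?_
  set W : ℕ → ℕ → EuclideanSpace ℝ (Fin m) := fun i j =>
    if (j : ℝ) ≤ t₀ / ε (ns i) then ye (ns i) (-(j : ℝ) + t₀ / ε (ns i)) else 0
  have hWmem : ∀ᶠ i in atTop, W i ∈ Set.pi univ
      fun _ : ℕ => closedBall (0 : EuclideanSpace ℝ (Fin m)) (max D 0) := by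
    filter_upwards [hns.eventually hD] with i hi j _
    simp only [W]
    split_ifs with hj
    · simpa using Or.inl (hi _ ⟨by linarith, by linarith [(Nat.cast_nonneg j : (0 : ℝ) ≤ j)]⟩)
    · simp
  obtain ⟨z, hz, ms, hms, hWlim⟩ := (isCompact_univ_pi fun _ : ℕ => isCompact_closedBall
    (0 : EuclideanSpace ℝ (Fin m)) (max D 0)).tendsto_subseq' hWmem.frequently
  refine ⟨ms, ?_⟩
  have hκ : Tendsto (fun i => ns (ms i)) atTop atTop := hns.comp hms.tendsto_atTop
  have hzlim : ∀ j : ℕ, Tendsto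
      (fun i => ye (ns (ms i)) (-(j : ℝ) + t₀ / ε (ns (ms i)))) atTop (𝓝 (z j)) := fun j =>
    (tendsto_pi_nhds.1 hWlim j).congr' <| ((hS.comp hκ).eventually_ge_atTop (j : ℝ)).mono
      fun i hi => if_pos hi
  have hzD : ∀ j, ‖z j‖ ≤ max D 0 := fun j => by simpa using hz j (mem_univ j)
  set x := x0 t₀
  have hxlim : Tendsto (fun k => xe k (t₀ / ε k)) atTop (𝓝 x) :=
    hconv.tendsto_at ⟨ht₀.le, le_rfl⟩
  have hxR : x ∈ closedBall (0 : EuclideanSpace ℝ (Fin n)) R :=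
    isClosed_closedBall.mem_of_tendsto hxlim (hR.mono fun k hk => by
      simpa using hk _ ⟨hSpos k, le_rfl⟩)
  -- the limit points are joined by solutions of the limit equation
  have hstep : ∀ j : ℕ, sol h₀ x (-((j + 1 : ℕ) : ℝ)) (z (j + 1)) (-(j : ℝ)) = z j := by
    intro j
    have hj : (-((j + 1 : ℕ) : ℝ)) ≤ -(j : ℝ) := by push_cast; linarith
    refine (tendsto_nhds_unique (hzlim j) (Metric.tendsto_nhds.2 fun ρ hρ => ?_)).symm
    obtain ⟨η, hη, hU⟩ := exists_eventually_norm_sub_le (ev h₀) x (hLip h₀ x)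
      (fun t ht => hsolode h₀ x (-((j + 1 : ℕ) : ℝ)) (z (j + 1)) t ht.1) (β := -(j : ℝ))
      (half_pos hρ)
    filter_upwards [hκ.eventually (((hev.continuous.tendsto h₀).comp hlim).eventually hU),
      (Metric.tendsto_nhds.1 (hzlim (j + 1))) η hη,
      hκ.eventually (Metric.tendsto_nhds.1 hxlim (η / 2) (half_pos hη)),
      hκ.eventually (hdrift (j + 1) (η / 2) (half_pos hη)),
      (hS.comp hκ).eventually_ge_atTop ((j : ℝ) + 1)] with i hUi hzi hxi hdi hSi
    rw [dist_eq_norm] at hzi hxi ⊢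
    simp only [Function.comp_apply] at hSi
    have hmem : ∀ t ∈ Icc (-((j + 1 : ℕ) : ℝ)) (-(j : ℝ)),
        t + t₀ / ε (ns (ms i)) ∈ Icc 0 (t₀ / ε (ns (ms i))) := fun t ht => by
      have h1 := ht.1
      push_cast at h1
      exact ⟨by linarith, by linarith [ht.2, (Nat.cast_nonneg j : (0 : ℝ) ≤ j)]⟩
    have := hUi (-(j : ℝ)) le_rfl (fun t => xe (ns (ms i)) (t + t₀ / ε (ns (ms i))))
      (fun t => ye (ns (ms i)) (t + t₀ / ε (ns (ms i)))) (by rwa [hsolinit])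
      (fun t ht => by
        have h1 := ht.1
        push_cast at h1
        have h2 := hdi _ (hmem t ht) _ ⟨hSpos _, le_rfl⟩ (by
          rw [add_sub_cancel_right, abs_le]
          constructor <;> linarith [ht.2, (Nat.cast_nonneg j : (0 : ℝ) ≤ j)])
        rw [← sub_add_sub_cancel]
        exact (norm_add_le _ _).trans_lt (by linarith))
      (fun t ht => hshift _ _ t (hmem t ht)) (-(j : ℝ)) ⟨hj, le_rfl⟩
    linarith
  obtain ⟨y, hyw, hy⟩ := exists_entire_of_compatible
    (G := fun t y => ev h₀ (x, y, t)) (w := fun j => sol h₀ x (-(j : ℝ)) (z j))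
    (fun j t ht => hsolode h₀ x _ (z j) t ht)
    (fun j t ht => eq_of_hasDerivAt_of_lipschitz (ev h₀) x (hLip h₀ x) ht
      (fun s hs => hsolode h₀ x _ (z j) s hs.1)
      (fun s hs => hsolode h₀ x _ (z (j + 1)) s (by push_cast; linarith [hs.1]))
      (by rw [hstep, hsolinit]))
  have hy0 : y 0 = z 0 := by
    have := hyw 0 0 (by simp)
    simp only [Nat.cast_zero, neg_zero] at this
    rw [this, hsolinit]
  have hzA : z 0 ∈ attrFiber ev h₀ x := by
    obtain ⟨T, hT, hTb⟩ := hult (max D 0 + 1) (by positivity)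
    refine ⟨y, hy0, ⟨c, fun τ => ?_⟩, hy⟩
    obtain ⟨j, hj⟩ := exists_nat_ge (T - τ)
    rw [hyw j τ (by linarith)]
    exact hTb h₀ x hxR (z j) ((hzD j).trans (by linarith)) _ _ (by linarith)
  have hfin := ((continuous_infDist_pt (attrFiber ev h₀ x)).tendsto (z 0)).comp (hzlim 0)
  rw [infDist_zero_of_mem hzA] at hfin
  simpa [Function.comp_def] using hfin
end
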